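/- The minimal size S(9) of a sorting network on 9 channels equals 25: there exists a sorting network on 9 channels with 25 comparators, and no sorting network on 9 channels has fewer than 25 comparators. -/

import Mathlib

/-- Applying a single comparator `c = (i, j)`: the minimum of the two values goes to
channel `i` and the maximum to channel `j`. -/
def applyComp {n : ℕ} {α : Type*} [LinearOrder α] (c : Fin n × Fin n) (x : Fin n → α) :
    Fin n → α :=
  fun k => if k = c.1 then min (x c.1) (x c.2)
    else if k = c.2 then max (x c.1) (x c.2)
    else x k

/-- Propagating an input vector through a comparator network (a list of comparators). -/
def runNet {n : ℕ} {α : Type*} [LinearOrder α] (C : List (Fin n × Fin n)) (x : Fin n → α) :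
    Fin n → α :=
  C.foldl (fun v c => applyComp c v) x

/-- A standard comparator network: every comparator `(i, j)` satisfies `i < j`. -/
def Standard {n : ℕ} (C : List (Fin n × Fin n)) : Prop :=
  ∀ c ∈ C, c.1 < c.2

/-- A sorting network: a standard comparator network sorting every Boolean input. -/
def IsSortingNet {n : ℕ} (C : List (Fin n × Fin n)) : Prop :=
  Standard C ∧ ∀ x : Fin n → Bool, Monotone (runNet C x)

/-- The set of outputs of a comparator network on Boolean inputs. -/
def outputs {n : ℕ} (C : List (Fin n × Fin n)) : Set (Fin n → Bool) :=
  Set.range (runNet C)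

/-- The action of a permutation of channels on a set of Boolean vectors. -/
def permSet {n : ℕ} (π : Equiv.Perm (Fin n)) (S : Set (Fin n → Bool)) :
    Set (Fin n → Bool) :=
  (fun x => x ∘ ⇑π.symm) '' S

/-- `Ca` subsumes `Cb`: some permutation maps `outputs Ca` into `outputs Cb`. -/
def Subsumes {n : ℕ} (Ca Cb : List (Fin n × Fin n)) : Prop :=
  ∃ π : Equiv.Perm (Fin n), permSet π (outputs Ca) ⊆ outputs Cb

/-- `sortSize n` is the least size of a sorting network on `n` channels. -/
noncomputable def sortSize (n : ℕ) : ℕ :=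
  sInf {k | ∃ C : List (Fin n × Fin n), IsSortingNet C ∧ C.length = k}

/-- Number of ones in a Boolean vector. -/
def ones {n : ℕ} (x : Fin n → Bool) : ℕ :=
  (Finset.univ.filter fun i => x i = true).card

/-- A (finite) complete set of filters on `n` channels. -/
def CompleteFilters (n : ℕ) (F : Finset (List (Fin n × Fin n))) : Prop :=
  (∃ C : List (Fin n × Fin n), IsSortingNet C ∧ C.length = sortSize n) ↔
    (∃ C ∈ F, ∃ C' : List (Fin n × Fin n),
      IsSortingNet (C ++ C') ∧ (C ++ C').length = sortSize n)

/-- `wSet C x k` is the set of positions `i` such that some output vector of `C`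
with exactly `k` ones has value `x` at position `i`. -/
def wSet {n : ℕ} (C : List (Fin n × Fin n)) (x : Bool) (k : ℕ) : Set (Fin n) :=
  {i | ∃ v ∈ outputs C, ones v = k ∧ v i = x}

/-! ### A kernel-efficient checker working on sets of vectors packed into natural numbers -/

/-- `force x f` is `f x`, arranged so that kernel reduction evaluates `x` first. -/
noncomputable def force {α : Type} (x : ℕ) (f : ℕ → α) : α :=
  Nat.rec (f 0) (fun m _ => f (Nat.succ m)) x

/-- The set of all vectors on `n` channels. -/
def allVec (n : ℕ) : ℕ := Nat.sub (Nat.pow 2 (Nat.pow 2 n)) 1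

/-- The set of vectors on `n` channels whose channel `a` carries a one. -/
noncomputable def chan (n a : ℕ) : ℕ :=
  Nat.rec 0 (fun m r => bif Nat.beq a m then Nat.shiftLeft (allVec m) (Nat.pow 2 m)
    else Nat.lor r (Nat.shiftLeft r (Nat.pow 2 m))) n

/-- The set of vectors with a one on channel `a` and a zero on channel `b`. -/
noncomputable def oneZero (n a b : ℕ) : ℕ :=
  Nat.land (chan n a) (Nat.xor (allVec n) (chan n b))

/-- The set of vectors having equal values on channels `a` and `b`. -/
noncomputable def eqVal (n a b : ℕ) : ℕ :=
  Nat.xor (allVec n) (Nat.lor (oneZero n a b) (oneZero n b a))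

/-- The distance between a vector with values `1, 0` on channels `a < b` and its exchange. -/
def gap (a b : ℕ) : ℕ := Nat.sub (Nat.pow 2 b) (Nat.pow 2 a)

/-- Exchanging channels `a < b < n` in all vectors of a set. -/
noncomputable def swapSet (n a b X : ℕ) : ℕ :=
  force a fun a => force b fun b => bif Nat.ble (Nat.succ a) b && Nat.ble (Nat.succ b) n then
    Nat.lor (Nat.land X (eqVal n a b))
      (Nat.lor (Nat.shiftLeft (Nat.land X (oneZero n a b)) (gap a b))
        (Nat.land (Nat.shiftRight X (gap a b)) (oneZero n a b)))
  else X

/-- The image of a set under the comparator `(i, j)`, where `i < j < n`. -/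
noncomputable def compSet (n i j X : ℕ) : ℕ :=
  Nat.lor (Nat.land X (Nat.xor (allVec n) (oneZero n i j)))
    (Nat.land (Nat.shiftLeft (Nat.land X (oneZero n i j)) (gap i j)) (oneZero n j i))

/-- Complementing channel `j` in all vectors of a set. -/
noncomputable def flipSet (n j X : ℕ) : ℕ :=
  Nat.lor (Nat.shiftRight (Nat.land X (chan n j)) (Nat.pow 2 j))
    (Nat.shiftLeft (Nat.land X (Nat.xor (allVec n) (chan n j))) (Nat.pow 2 j))

/-- Complementing channels `0, …, m - 1` in all vectors of a set. -/
noncomputable def dualSet (n m X : ℕ) : ℕ := Nat.rec X (fun j r => flipSet n j r) m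

/-- Successive exchanges of channels. -/
noncomputable def swapsSet (n : ℕ) (l : List (ℕ × ℕ)) (X : ℕ) : ℕ :=
  List.rec (fun X => X) (fun p _ ih X => ih (swapSet n p.1 p.2 X)) l X

def subSet (X Y : ℕ) : Bool := Nat.beq (Nat.land X Y) X

/-- A table of claims on `n` channels: slot `i` of `sets` holds a set of vectors, and byte `i`
of `lows` a lower bound for the size of the networks sorting it, for `1 ≤ i < size`. Slots are
ordered by increasing bound: `starts` packs the first slot for each bound. -/
structure Layer where
  n : ℕ
  size : ℕ
  sets : ℕ
  lows : ℕ
  starts : ℕ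

noncomputable def slot (n sets i : ℕ) : ℕ :=
  Nat.land (Nat.shiftRight sets (Nat.add 64 (Nat.mul i (Nat.pow 2 n)))) (allVec n)

noncomputable def Layer.low (L : Layer) (i : ℕ) : ℕ :=
  bif Nat.ble 1 i && Nat.ble (Nat.succ i) L.size then
    Nat.mod (Nat.shiftRight L.lows (Nat.mul 8 i)) 256
  else 0

def Layer.start (L : Layer) (k : ℕ) : ℕ := Nat.mod (Nat.shiftRight L.starts (Nat.mul 16 k)) 65536

/-- The set in slot `i`, complemented if `d` is not zero. -/
noncomputable def pick (n sets i d : ℕ) : ℕ :=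
  bif Nat.beq d 0 then slot n sets i else dualSet n n (slot n sets i)

/-! #### Decoding certificates -/

/-- The exchanges `(d - 1, p)`, for `p` from `m` down to `1`, with digits `d` read from `c`. -/
noncomputable def readDown (m c : ℕ) : List (ℕ × ℕ) :=
  Nat.rec (fun _ => []) (fun p ih c =>
    bif Nat.beq (Nat.mod c (Nat.add p 2)) 0 then ih (Nat.div c (Nat.add p 2))
    else (Nat.sub (Nat.mod c (Nat.add p 2)) 1, Nat.succ p) :: ih (Nat.div c (Nat.add p 2))) m c

/-- The exchanges `(d - 1, p)` for the `m` values of `p` starting with `p`, with digits `d` read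
from `c`. -/
noncomputable def readUp (m p c : ℕ) : List (ℕ × ℕ) :=
  Nat.rec (fun _ _ => []) (fun _ ih p c =>
    bif Nat.beq (Nat.mod c (Nat.succ p)) 0 then ih (Nat.succ p) (Nat.div c (Nat.succ p))
    else (Nat.sub (Nat.mod c (Nat.succ p)) 1, p) :: ih (Nat.succ p) (Nat.div c (Nat.succ p))) m p c

/-- The product `lo * (lo + 1) * ⋯` of `m` factors. -/
noncomputable def prodFrom (lo m : ℕ) : ℕ := Nat.rec 1 (fun i r => Nat.mul (Nat.add lo i) r) m

/-- The number of channels whose permutations are searched by the checker. -/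
noncomputable def free (n : ℕ) : ℕ := bif Nat.ble n 6 then n else 6

/-- A one in each of the `(free n)!` blocks. -/
noncomputable def blocks (n : ℕ) : ℕ :=
  Nat.div (Nat.sub (Nat.pow 2 (Nat.mul (Nat.pow 2 n) (prodFrom 1 (free n)))) 1) (allVec n)

noncomputable def wideMask (n a b : ℕ) : ℕ := Nat.mul (blocks n) (oneZero n a b)

noncomputable def wideSwap (n a b X : ℕ) : ℕ :=
  (fun t => Nat.xor (Nat.xor X t) (Nat.shiftLeft t (gap a b)))
    (Nat.land (Nat.xor (Nat.shiftRight X (gap a b)) X) (wideMask n a b))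

/-- Extending a concatenation `X`, of total width `w`, by its exchanges of `p` with smaller
channels. -/
noncomputable def spreadStep (n p w X : ℕ) : ℕ :=
  Nat.rec X (fun j r => Nat.lor r
    (Nat.shiftLeft (wideSwap n j p X) (Nat.mul w (Nat.succ j)))) p

/-- The concatenation of all images of `X` under permutations of channels `0, …, m`. -/
noncomputable def spread (n m X : ℕ) : ℕ :=
  Nat.rec (fun _ X => X) (fun p ih w X =>
    ih (Nat.mul w (Nat.add p 2)) (spreadStep n (Nat.succ p) w X)) m (Nat.pow 2 n) X

/-- The digits describing the permutations in `spread`, block by block. -/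
noncomputable def spreadCode (n m : ℕ) : ℕ :=
  Nat.rec (fun _ _ X => X) (fun p ih b u X =>
    force (Nat.rec X (fun j r => Nat.lor r (Nat.shiftLeft
      (Nat.add X (Nat.mul (Nat.mul u (Nat.succ j))
        (Nat.div (Nat.sub (Nat.pow 2 (Nat.mul b (Nat.pow 2 n))) 1) (allVec n))))
      (Nat.mul (Nat.mul b (Nat.pow 2 n)) (Nat.succ j)))) (Nat.succ p)) fun X =>
    ih (Nat.mul b (Nat.add p 2)) (Nat.mul u (Nat.add p 2)) X) m 1 1 0

noncomputable def topBits (n : ℕ) : ℕ := Nat.mul (blocks n) (Nat.pow 2 (Nat.sub (Nat.pow 2 n) 1))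

noncomputable def lowBits (n : ℕ) : ℕ := Nat.sub (topBits n) (blocks n)

/-- The digits of a permutation of the free channels mapping `Z` into `T`. -/
noncomputable def findPerm (n Z T : ℕ) : ℕ :=
  (fun E => (fun e => (fun z => (fun z =>
        Nat.mod (Nat.land (spreadCode n (Nat.sub (free n) 1))
          (Nat.sub (Nat.mul z 2) (Nat.shiftRight z (Nat.sub (Nat.pow 2 n) 1)))) (allVec n))
        (Nat.xor z (Nat.land z (Nat.sub z 1))))
      (Nat.xor (Nat.land (Nat.add e (lowBits n)) (topBits n)) (topBits n)))
      (Nat.xor E (Nat.land E (Nat.mul T (blocks n)))))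
    (spread n (Nat.sub (free n) 1) Z)

/-- Does the set in slot `r` (complemented if `d` is not zero) map into `T` by a permutation of
the free channels followed by the exchanges `l`? -/
noncomputable def fits (n sets r d : ℕ) (l : List (ℕ × ℕ)) (T : ℕ) : Bool :=
  (fun Z => force (findPerm n Z (List.rec T (fun p _ ih => swapSet n p.1 p.2 ih) l)) fun c =>
    subSet (swapsSet n l (swapsSet n (readDown (Nat.sub (free n) 1) c) Z)) T) (pick n sets r d)

/-- Checking the claim `k` for `Y` comparator by comparator, for the comparators in `ps`. The flag
`b` records whether some comparator acted neither trivially nor by an exchange. -/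
noncomputable def succCheck (L : Layer) (k Y : ℕ) (ps : List (ℕ × ℕ)) : ℕ → Bool → Bool :=
  List.rec (fun _ b => b) (fun p _ ih c b =>
    bif Nat.beq (Nat.land Y (oneZero L.n p.1 p.2)) 0 then ih c b
    else bif Nat.beq (Nat.land Y (oneZero L.n p.2 p.1)) 0 then ih c b
    else
      (fun r c s =>
        (fun r c => force r fun r => (fun d c => force (Nat.mod c s) fun e =>
            Nat.ble k (Nat.succ (L.low r)) &&
            fits L.n L.sets r d (readUp (Nat.sub L.n (free L.n)) (free L.n) e)
              (compSet L.n p.1 p.2 Y) &&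
            force (Nat.div c s) fun c => ih c true)
          (Nat.mod c 2) (Nat.div c 2))
        (bif Nat.beq r 0 then Nat.mod c L.size else Nat.add (L.start (Nat.sub k 1)) (Nat.sub r 1))
        (bif Nat.beq r 0 then Nat.div c L.size else c))
      (Nat.mod c (Nat.succ (Nat.sub (L.start k) (L.start (Nat.sub k 1)))))
      (Nat.div c (Nat.succ (Nat.sub (L.start k) (L.start (Nat.sub k 1)))))
      (prodFrom (Nat.succ (free L.n)) (Nat.sub L.n (free L.n)))) ps

/-- All pairs `(i, j)` with `i < j < n`. -/
noncomputable def pairs (n : ℕ) : List (ℕ × ℕ) :=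
  Nat.rec [] (fun j r => Nat.rec r (fun i s => (i, j) :: s) j) n

/-- The image of channel `i` under successive exchanges. -/
noncomputable def track (n : ℕ) (l : List (ℕ × ℕ)) : ℕ → ℕ :=
  List.rec (fun i => i) (fun p _ ih i =>
    ih (bif Nat.ble (Nat.succ p.1) p.2 && Nat.ble (Nat.succ p.2) n then
      bif Nat.beq i p.1 then p.2 else bif Nat.beq i p.2 then p.1 else i
    else i)) l

/-- A reference to a slot of the layer below, to be complemented if `dual` is not zero, extended by
a top channel carrying ones, and subjected to exchanges. -/
structure Embed where
  ref : ℕ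
  dual : ℕ
  swaps : List (ℕ × ℕ)

/-- The set of vectors described by an embedding. -/
noncomputable def Embed.image (e : Embed) (n sets : ℕ) : ℕ :=
  swapsSet (Nat.succ n) e.swaps (Nat.shiftLeft (pick n sets e.ref e.dual) (Nat.pow 2 n))

/-- The channel carrying ones in the image of an embedding. -/
noncomputable def Embed.token (e : Embed) (n : ℕ) : ℕ := track (Nat.succ n) e.swaps n

/-- Reading `m` embeddings from `c`. -/
noncomputable def readEmbeds (n size f m c : ℕ) : List Embed :=
  Nat.rec (fun _ => []) (fun _ ih c => force c fun c =>
    ⟨Nat.mod c size, Nat.mod (Nat.div c size) 2,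
      readDown n (Nat.mod (Nat.div c (Nat.mul size 2)) f)⟩ ::
      ih (Nat.div c (Nat.mul (Nat.mul size 2) f))) m c

/-- Reading a list of embeddings from `c`, the first one without exchanges. -/
noncomputable def readHuff (n size c : ℕ) : List Embed :=
  (fun m c => ⟨Nat.mod c size, Nat.mod (Nat.div c size) 2, []⟩ ::
      readEmbeds n size (prodFrom 1 (Nat.succ n)) m (Nat.div c (Nat.mul size 2)))
    (Nat.mod c 16) (Nat.div c 16)

noncomputable def single {α : Type} (l : List α) : Bool :=
  List.rec false (fun _ l _ => List.rec true (fun _ _ _ => false) l) l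

/-- The union of the images, and, unless there is only one, of the unit vectors of the tokens. -/
noncomputable def huffSet (n sets : ℕ) (l : List Embed) : ℕ :=
  Nat.lor (List.rec 0 (fun e _ r => Nat.lor (e.image n sets) r) l)
    (bif single l then 0 else
      List.rec 0 (fun e _ r => Nat.lor (Nat.pow 2 (Nat.pow 2 (e.token n))) r) l)

/-- Checking the claim `k` for `Y` by means of embeddings with distinct tokens, starting from the
tokens `seen` and the weight `sum`. -/
noncomputable def huffCheck (L : Layer) (k Y : ℕ) (b : Bool) (l : List Embed) : ℕ → ℕ → Bool :=
  List.rec (fun _ sum => Nat.ble (Nat.succ (Nat.pow 2 (Nat.sub k 1))) sum) (fun e _ ih seen sum =>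
    subSet (e.image L.n L.sets) Y && !Nat.testBit seen (e.token L.n) &&
      (b || Nat.testBit Y (Nat.pow 2 (e.token L.n))) &&
      ih (Nat.lor seen (Nat.pow 2 (e.token L.n))) (Nat.add sum (Nat.pow 2 (L.low e.ref)))) l

/-- Inserting `m` elements of `{0, …, 2 ^ n - 1}` read from `c` into `X`. -/
noncomputable def readElements (n m c X : ℕ) : ℕ :=
  Nat.rec (fun _ X => X) (fun _ ih c X =>
    ih (Nat.shiftRight c n) (Nat.lor X (Nat.pow 2 (Nat.mod c (Nat.pow 2 n))))) m c X

/-- Choosing preimages under the comparator `(i, j)` of the elements of `W`, adding them to `X`. -/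
noncomputable def readPreimages (n i j W X c : ℕ) : ℕ :=
  Nat.rec (fun _ X _ => X) (fun _ ih W X c =>
    bif Nat.beq W 0 then readElements n (Nat.mod c 64) (Nat.div c 64) X
    else (fun b => force (Nat.div c 3) fun c' =>
        ih (Nat.land W (Nat.sub W 1)) (Nat.lor X (bif Nat.beq (Nat.mod c 3) 0 then b else
          (fun b' => bif Nat.beq (Nat.mod c 3) 1 then b' else Nat.lor b b')
            (bif Nat.ble i j then Nat.shiftRight b (gap i j) else Nat.shiftLeft b (gap j i)))) c')
      (Nat.xor W (Nat.land W (Nat.sub W 1)))) (Nat.pow 2 n) W X c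

/-- A set whose image under a comparator contains a given one. -/
noncomputable def succSet (n sets start size c : ℕ) : ℕ :=
  (fun r c => (fun d c => (fun i c => (fun j c =>
      force c fun c => force i fun i => force j fun j =>
        (fun Z => (fun W => readPreimages n i j W (Nat.xor Z W) c) (Nat.land Z (oneZero n j i)))
          (pick n sets (Nat.add start r) d))
    (Nat.mod c n) (Nat.div c n)) (Nat.mod c n) (Nat.div c n)) (Nat.mod c 2) (Nat.div c 2))
  (Nat.mod c size) (Nat.div c size)

/-- The set encoded by a row `c`. -/
noncomputable def rowSet (L' L : Layer) (sets k c : ℕ) : ℕ :=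
  bif Nat.beq (Nat.mod c 2) 0 then huffSet L'.n L'.sets (readHuff L'.n L'.size (Nat.div c 2))
  else succSet L.n sets (L.start (Nat.sub k 1)) (Nat.sub (L.start k) (L.start (Nat.sub k 1)))
    (Nat.div c 2)

/-- Decoding the sets of a layer, starting with slot `i`. -/
noncomputable def decodeSets (L' L : Layer) (rows : List ℕ) : ℕ → ℕ → (ℕ → ℕ → ℕ) → ℕ :=
  List.rec (fun i sets f => f i sets) (fun c _ ih i sets f =>
    force (Nat.succ (Nat.lor sets (Nat.shiftLeft (rowSet L' L sets (L.low i) c)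
        (Nat.add 64 (Nat.mul i (Nat.pow 2 L.n)))))) fun sets =>
      force (Nat.succ i) fun i => ih i sets f) rows

noncomputable def decodeAll (L' L : Layer) (rows : List (List ℕ)) : ℕ → ℕ → ℕ :=
  List.rec (fun _ sets => sets) (fun r _ ih i sets => decodeSets L' L r i sets ih) rows

noncomputable def packLows (sizes : List ℕ) : ℕ → ℕ → ℕ :=
  List.rec (fun _ _ => 0) (fun s _ ih k p =>
    Nat.lor (Nat.shiftLeft (Nat.mul k (Nat.div (Nat.sub (Nat.pow 2 (Nat.mul 8 s)) 1) 255))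
      (Nat.mul 8 p)) (ih (Nat.succ k) (Nat.add p s))) sizes

noncomputable def packStarts (sizes : List ℕ) : ℕ → ℕ → ℕ :=
  List.rec (fun k p => Nat.shiftLeft p (Nat.mul 16 k)) (fun s _ ih k p =>
    Nat.lor (Nat.shiftLeft p (Nat.mul 16 k)) (ih (Nat.succ k) (Nat.add p s))) sizes

/-- The total number of elements. -/
noncomputable def total (l : List (List ℕ)) : ℕ :=
  List.rec 0 (fun x _ r => Nat.add (List.rec 0 (fun _ _ r => Nat.succ r) x) r) l

/-- `f` applied to the layer on `n` channels over `L'` with `sizes k` slots for the bound `k`. -/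
noncomputable def withLayer {α : Type} (n : ℕ) (L' : Layer) (sizes : List ℕ) (rows : List (List ℕ))
    (f : Layer → α) : α :=
  force (packLows sizes 0 0) fun lows => force (packStarts sizes 0 0) fun starts =>
    force (Nat.succ (total rows)) fun size =>
      force (decodeAll L' ⟨n, size, 0, lows, starts⟩ rows 1 0) fun sets =>
        f ⟨n, size, sets, lows, starts⟩

/-- Checking the claims of consecutive slots, starting with slot `i`. -/
noncomputable def checkRows (L' L : Layer) (rows : List ℕ) : ℕ → List ℕ → Bool :=
  List.rec (fun _ _ => true) (fun c _ ih i es =>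
    force (L.low i) fun k => (fun Y =>
      bif Nat.beq (Nat.mod c 2) 0 then
        (fun l => huffCheck L' k Y (single l) l 0 0) (readHuff L'.n L'.size (Nat.div c 2)) &&
          force (Nat.succ i) fun i => ih i es
      else List.rec false (fun e es _ => succCheck L k Y (pairs L.n) e false &&
          force (Nat.succ i) fun i => ih i es) es) (slot L.n L.sets i)) rows

/-- The `c`-th entry of a list of lists. -/
noncomputable def partAt (l : List (List ℕ)) : ℕ → List ℕ :=
  List.rec (fun _ => []) (fun x _ ih c => Nat.rec x (fun c _ => ih c) c) l

/-- The number of elements before the `c`-th entry of a list of lists. -/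
noncomputable def partStart (l : List (List ℕ)) : ℕ → ℕ :=
  List.rec (fun _ => 0) (fun x _ ih c =>
    Nat.rec 0 (fun c _ => Nat.add (List.rec 0 (fun _ _ r => Nat.succ r) x) (ih c)) c) l

/-- The layer on two channels, claiming nothing. -/
def layer2 : Layer := ⟨2, 1, 0, 0, 0⟩

noncomputable def checkPart (rows edges : List (List ℕ)) (c : ℕ)
    (eval : (Layer → Layer → Bool) → Bool) : Bool :=
  eval fun L' L =>
    checkRows L' L (partAt rows c) (Nat.succ (partStart rows c)) (partAt edges c)

/-! ### Networks acting on vectors indexed by natural numbers -/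

/-- The comparator `c` puts the minimum on channel `c.1` and the maximum on channel `c.2`. -/
def applyPair (c : ℕ × ℕ) (x : ℕ → Bool) : ℕ → Bool := fun t =>
  if t = c.1 then x c.1 && x c.2 else if t = c.2 then x c.1 || x c.2 else x t

def run (C : List (ℕ × ℕ)) (x : ℕ → Bool) : ℕ → Bool := C.foldl (fun y c => applyPair c y) x

/-- `C` is a network on `n` channels, whose comparators may have either orientation. -/
def Net (n : ℕ) (C : List (ℕ × ℕ)) : Prop := ∀ c ∈ C, c.1 < n ∧ c.2 < n ∧ c.1 ≠ c.2

/-- `x` and `y` are comparable on the first `n` channels. -/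
def Comparable (n : ℕ) (x y : ℕ → Bool) : Prop :=
  (∀ t < n, x t = true → y t = true) ∨ ∀ t < n, y t = true → x t = true

/-- `C` maps `S` to a chain. This is sorting up to a permutation of the output channels. -/
def Sorts (n : ℕ) (C : List (ℕ × ℕ)) (S : Set (ℕ → Bool)) : Prop :=
  ∀ x ∈ S, ∀ y ∈ S, Comparable n (run C x) (run C y)

/-- No network with `m` comparators maps `S` to a chain. -/
def NoNet (n : ℕ) (S : Set (ℕ → Bool)) (m : ℕ) : Prop :=
  ∀ C, Net n C → C.length = m → ¬ Sorts n C S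

/-- `σ` restricts to a permutation of the first `n` channels. -/
def PermOn (n : ℕ) (σ : Equiv.Perm ℕ) : Prop := ∀ t, σ t < n ↔ t < n

def relabel (σ : Equiv.Perm ℕ) (C : List (ℕ × ℕ)) : List (ℕ × ℕ) :=
  C.map fun c => (σ c.1, σ c.2)

theorem run_cons (c : ℕ × ℕ) (C : List (ℕ × ℕ)) (x : ℕ → Bool) :
    run (c :: C) x = run C (applyPair c x) := rfl

theorem PermOn.mul {n : ℕ} {σ τ : Equiv.Perm ℕ} (hσ : PermOn n σ) (hτ : PermOn n τ) :
    PermOn n (σ * τ) := fun t => (hσ (τ t)).trans (hτ t)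

theorem PermOn.symm {n : ℕ} {σ : Equiv.Perm ℕ} (hσ : PermOn n σ) : PermOn n σ.symm := fun t => by
  simpa using (hσ (σ.symm t)).symm

theorem permOn_one (n : ℕ) : PermOn n 1 := fun _ => Iff.rfl

theorem permOn_swap {n a b : ℕ} (ha : a < n) (hb : b < n) : PermOn n (Equiv.swap a b) := fun t => by
  rw [Equiv.swap_apply_def]
  split_ifs <;> simp_all

theorem Comparable.comp {n : ℕ} {x y : ℕ → Bool} (h : Comparable n x y) {σ : Equiv.Perm ℕ}
    (hσ : PermOn n σ) : Comparable n (x ∘ σ) (y ∘ σ) :=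
  h.imp (fun h t ht => h _ ((hσ t).2 ht)) fun h t ht => h _ ((hσ t).2 ht)

theorem applyPair_relabel (σ : Equiv.Perm ℕ) (c : ℕ × ℕ) (x : ℕ → Bool) :
    applyPair (σ c.1, σ c.2) x ∘ σ = applyPair c (x ∘ σ) := by
  funext t
  simp [applyPair]

theorem run_relabel (σ : Equiv.Perm ℕ) (C : List (ℕ × ℕ)) (x : ℕ → Bool) :
    run (relabel σ C) x ∘ σ = run C (x ∘ σ) := by
  induction C generalizing x with
  | nil => rfl
  | cons c C ih =>
    rw [run_cons, ← applyPair_relabel]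
    exact ih _

theorem Net.relabel {n : ℕ} {C : List (ℕ × ℕ)} (h : Net n C) {σ : Equiv.Perm ℕ}
    (hσ : PermOn n σ) : Net n (relabel σ C) := by
  intro c hc
  obtain ⟨d, hd, rfl⟩ := List.mem_map.1 hc
  obtain ⟨h1, h2, h3⟩ := h d hd
  exact ⟨(hσ _).2 h1, (hσ _).2 h2, fun e => h3 (σ.injective e)⟩

theorem NoNet.perm {n m : ℕ} {S T : Set (ℕ → Bool)} (h : NoNet n S m) {σ : Equiv.Perm ℕ}
    (hσ : PermOn n σ) (hST : ∀ x ∈ S, x ∘ σ ∈ T) : NoNet n T m := by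
  intro C hC hm hs
  refine h (relabel σ C) (hC.relabel hσ) (by simp [relabel, hm]) fun x hx y hy => ?_
  have := (hs _ (hST x hx) _ (hST y hy)).comp hσ.symm
  rw [← run_relabel, ← run_relabel] at this
  simpa [Function.comp_assoc] using this

theorem NoNet.mono {n m : ℕ} {S T : Set (ℕ → Bool)} (h : NoNet n S m) (hST : S ⊆ T) :
    NoNet n T m := h.perm (permOn_one n) hST

theorem run_map_swap (C : List (ℕ × ℕ)) (hC : ∀ c ∈ C, c.1 ≠ c.2) (x : ℕ → Bool) :
    run (C.map Prod.swap) (fun t => !x t) = fun t => !run C x t := by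
  induction C generalizing x with
  | nil => rfl
  | cons c C ih =>
    rw [List.map_cons, run_cons, run_cons, ← ih (fun d hd => hC d (by simp [hd]))]
    congr 1
    funext t
    have := hC c (by simp)
    simp only [applyPair, Prod.fst_swap, Prod.snd_swap]
    split_ifs <;> simp_all [Bool.and_comm, Bool.or_comm]

theorem NoNet.dual {n m : ℕ} {S T : Set (ℕ → Bool)} (h : NoNet n S m)
    (hST : ∀ x ∈ S, (fun t => !x t) ∈ T) : NoNet n T m := by
  intro C hC hm hs
  refine h (C.map Prod.swap) (fun c hc => ?_) (by simp [hm]) fun x hx y hy => ?_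
  · obtain ⟨d, hd, rfl⟩ := List.mem_map.1 hc
    exact ⟨(hC d hd).2.1, (hC d hd).1, (hC d hd).2.2.symm⟩
  · have key : ∀ x : ℕ → Bool, run (C.map Prod.swap) x = fun t => !run C (fun t => !x t) t := by
      intro x
      rw [← run_map_swap C fun c hc => (hC c hc).2.2]
      simp
    rw [key, key]
    refine (hs _ (hST x hx) _ (hST y hy)).symm.imp (fun h t ht => ?_) (fun h t ht => ?_) <;>
    · have := h t ht
      grind

theorem run_congr {n : ℕ} {C : List (ℕ × ℕ)} (hC : Net n C) {x y : ℕ → Bool}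
    (h : ∀ t < n, x t = y t) : ∀ t < n, run C x t = run C y t := by
  induction C generalizing x y with
  | nil => exact h
  | cons c C ih =>
    have hc := hC c (by simp)
    refine ih (fun d hd => hC d (by simp [hd])) fun t ht => ?_
    simp [applyPair, h _ hc.1, h _ hc.2.1, h t ht]

/-! #### Case analysis on the first comparator -/

theorem noNet_zero {n i j : ℕ} {S : Set (ℕ → Bool)} (hi : i < n) (hj : j < n) {x y : ℕ → Bool}
    (hx : x ∈ S) (hy : y ∈ S) (hxi : x i = true) (hxj : x j = false) (hyi : y i = false)
    (hyj : y j = true) : NoNet n S 0 := by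
  intro C _ hm hs
  obtain rfl := List.length_eq_zero_iff.1 hm
  rcases hs x hx y hy with h | h
  · exact absurd (h i hi hxi) (by simp [run, hyi])
  · exact absurd (h j hj hyj) (by simp [run, hxj])

theorem applyPair_eq_self {i j : ℕ} {x : ℕ → Bool} (h : x i = true → x j = true) :
    applyPair (i, j) x = x := by
  funext t
  simp only [applyPair]
  cases hx : x i <;> grind

theorem applyPair_swap {i j : ℕ} (hij : i ≠ j) (x : ℕ → Bool) :
    applyPair (j, i) x = applyPair (i, j) x ∘ Equiv.swap i j := by
  funext t
  simp only [applyPair, Function.comp, Equiv.swap_apply_def]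
  split_ifs <;> simp_all [Bool.and_comm, Bool.or_comm]

theorem NoNet.succ {n m : ℕ} {S : Set (ℕ → Bool)} (hS : NoNet n S m)
    (h : ∀ i j, i < j → j < n → (∀ x ∈ S, x i = true → x j = true) ∨
      (∀ x ∈ S, x j = true → x i = true) ∨ NoNet n (applyPair (i, j) '' S) m) :
    NoNet n S (m + 1) := by
  have h' : ∀ i j, i < j → j < n →
      NoNet n (applyPair (i, j) '' S) m ∧ NoNet n (applyPair (j, i) '' S) m := by
    intro i j hij hj
    have hp := permOn_swap (hij.trans hj) hj
    rcases h i j hij hj with h1 | h1 | h1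
    · have h2 : NoNet n (applyPair (i, j) '' S) m :=
        hS.mono fun x hx => ⟨x, hx, applyPair_eq_self (h1 x hx)⟩
      refine ⟨h2, h2.perm hp ?_⟩
      rintro _ ⟨x, hx, rfl⟩
      exact ⟨x, hx, applyPair_swap hij.ne x⟩
    · have h2 : NoNet n (applyPair (j, i) '' S) m :=
        hS.mono fun x hx => ⟨x, hx, applyPair_eq_self (h1 x hx)⟩
      refine ⟨h2.perm hp ?_, h2⟩
      rintro _ ⟨x, hx, rfl⟩
      exact ⟨x, hx, by rw [Equiv.swap_comm, applyPair_swap hij.ne']⟩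
    · refine ⟨h1, h1.perm hp ?_⟩
      rintro _ ⟨x, hx, rfl⟩
      exact ⟨x, hx, applyPair_swap hij.ne x⟩
  intro C hC hm hs
  obtain _ | ⟨⟨a, b⟩, C⟩ := C
  · simp at hm
  have hab := hC (a, b) (by simp)
  have key : NoNet n (applyPair (a, b) '' S) m := by
    rcases lt_or_gt_of_ne hab.2.2 with hlt | hlt
    · exact (h' a b hlt hab.2.1).1
    · exact (h' b a hlt hab.1).2
  refine key C (fun d hd => hC d (by simp [hd])) (by simpa using hm) ?_
  rintro _ ⟨x, hx, rfl⟩ _ ⟨y, hy, rfl⟩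
  exact hs x hx y hy

/-! #### Following a channel carrying ones -/

/-- The channel on which a token travelling with the maxima leaves the network. -/
def endpos : List (ℕ × ℕ) → ℕ → ℕ
  | [], i => i
  | c :: C, i => endpos C (if i = c.1 then c.2 else i)

/-- Two to the number of comparators not touching the token starting on channel `i`. -/
def weight : List (ℕ × ℕ) → ℕ → ℕ
  | [], _ => 1
  | c :: C, i => if i = c.1 ∨ i = c.2 then weight C c.2 else 2 * weight C i

theorem sum_weight_le (C : List (ℕ × ℕ)) (T : Finset ℕ)
    (hT : ∀ s ∈ T, ∀ t ∈ T, endpos C s = endpos C t) : ∑ t ∈ T, weight C t ≤ 2 ^ C.length := by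
  induction C generalizing T with
  | nil =>
    have : T.card ≤ 1 := Finset.card_le_one.2 hT
    simpa [weight] using this
  | cons c C ih =>
    set f : ℕ → ℕ := fun i => if i = c.1 then c.2 else i with hf
    have h1 := ih (T.image f) (by
      intro s hs t ht
      obtain ⟨i, hi, rfl⟩ := Finset.mem_image.1 hs
      obtain ⟨j, hj, rfl⟩ := Finset.mem_image.1 ht
      exact hT i hi j hj)
    rw [List.length_cons, pow_succ', ← Finset.sum_fiberwise_of_maps_to (t := T.image f) (g := f)
      fun x hx => Finset.mem_image_of_mem f hx]
    refine le_trans (Finset.sum_le_sum fun u hu => ?_) (Finset.mul_sum _ _ 2 ▸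
      Nat.mul_le_mul_left 2 h1)
    by_cases huc : u = c.2
    · subst huc
      calc ∑ t ∈ T with f t = c.2, weight (c :: C) t
          ≤ ∑ t ∈ {c.1, c.2}, weight (c :: C) t := by
            refine Finset.sum_le_sum_of_subset fun t ht => ?_
            have := (Finset.mem_filter.1 ht).2
            simp only [hf] at this
            split_ifs at this <;> simp_all
        _ ≤ ∑ t ∈ {c.1, c.2}, weight C c.2 := by
            refine Finset.sum_le_sum fun t ht => ?_
            rw [weight, if_pos (by simpa using ht)]
        _ ≤ 2 * weight C c.2 := by
            rw [Finset.sum_const, smul_eq_mul]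
            exact Nat.mul_le_mul_right _ Finset.card_le_two
    · calc ∑ t ∈ T with f t = u, weight (c :: C) t
          ≤ ∑ t ∈ {u}, weight (c :: C) t := by
            refine Finset.sum_le_sum_of_subset fun t ht => ?_
            have := (Finset.mem_filter.1 ht).2
            simp only [hf] at this
            split_ifs at this <;> simp_all
        _ ≤ 2 * weight C u := by
            rw [Finset.sum_singleton, weight]
            obtain ⟨t, -, rfl⟩ := Finset.mem_image.1 hu
            rw [if_neg]
            grind

theorem run_unit {n : ℕ} {C : List (ℕ × ℕ)} (hC : Net n C) (i : ℕ) :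
    run C (fun t => decide (t = i)) = fun t => decide (t = endpos C i) := by
  induction C generalizing i with
  | nil => rfl
  | cons c C ih =>
    rw [run_cons, endpos, ← ih fun d hd => hC d (by simp [hd])]
    congr 1
    funext t
    have := (hC c (by simp)).2.2
    simp only [applyPair]
    split_ifs <;> simp_all <;> grind

theorem endpos_lt {n : ℕ} {C : List (ℕ × ℕ)} (hC : Net n C) {i : ℕ} (hi : i < n) :
    endpos C i < n := by
  induction C generalizing i with
  | nil => exact hi
  | cons c C ih =>
    refine ih (fun d hd => hC d (by simp [hd])) ?_
    split_ifs
    exacts [(hC c (by simp)).2.1, hi]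

theorem endpos_eq {n : ℕ} {C : List (ℕ × ℕ)} (hC : Net n C) {S : Set (ℕ → Bool)}
    (hs : Sorts n C S) {i j : ℕ} (hi : i < n) (hj : j < n) (hiS : (fun t => decide (t = i)) ∈ S)
    (hjS : (fun t => decide (t = j)) ∈ S) : endpos C i = endpos C j := by
  have := hs _ hiS _ hjS
  rw [run_unit hC, run_unit hC] at this
  rcases this with h | h
  · simpa using h _ (endpos_lt hC hi) (by simp)
  · exact (by simpa using h _ (endpos_lt hC hj) (by simp) : endpos C j = endpos C i).symm

theorem exists_prune {n : ℕ} {C : List (ℕ × ℕ)} (hC : Net n C) (i : ℕ) :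
    ∃ C' τ, Net n C' ∧ (∀ c ∈ C', c.1 ≠ i ∧ c.2 ≠ i) ∧ 2 ^ C'.length = weight C i ∧ PermOn n τ ∧
      ∀ x, x i = true → run C x = run C' x ∘ τ := by
  induction C generalizing i with
  | nil => exact ⟨[], 1, by simp [Net], by simp, rfl, permOn_one n, fun _ _ => rfl⟩
  | cons c C ih =>
    obtain ⟨a, b⟩ := c
    obtain ⟨ha, hb, hab⟩ := hC (a, b) (by simp)
    replace ih := ih fun d hd => hC d (by simp [hd])
    simp only at ha hb hab
    by_cases hib : i = b
    · subst hib
      obtain ⟨C', τ, h1, h2, h3, h4, h5⟩ := ih i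
      refine ⟨C', τ, h1, h2, by simp [weight, h3], h4, fun x hx => ?_⟩
      rw [run_cons, applyPair_eq_self fun _ => hx, h5 x hx]
    by_cases hia : i = a
    · subst hia
      obtain ⟨C', τ, h1, h2, h3, h4, h5⟩ := ih b
      refine ⟨relabel (Equiv.swap i b) C', Equiv.swap i b * τ, h1.relabel (permOn_swap ha hb),
        fun c hc => ?_, by simp [weight, h3, relabel], (permOn_swap ha hb).mul h4, fun x hx => ?_⟩
      · obtain ⟨d, hd, rfl⟩ := List.mem_map.1 hc
        have := h2 d hd
        simp only [ne_eq, Equiv.swap_apply_eq_iff, Equiv.swap_apply_left]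
        exact this
      · have : applyPair (i, b) x = x ∘ Equiv.swap i b := by
          rw [applyPair_swap (Ne.symm hab), applyPair_eq_self fun _ => hx, Equiv.swap_comm]
        rw [run_cons, this, h5 _ (by simpa using hx), ← run_relabel]
        rfl
    · obtain ⟨C', τ, h1, h2, h3, h4, h5⟩ := ih i
      refine ⟨(a, b) :: C', τ, ?_, ?_, by simp [weight, hia, hib, ← h3, pow_succ'], h4,
        fun x hx => ?_⟩
      · simpa [Net, ha, hb, hab] using h1
      · simpa [Ne.symm hia, Ne.symm hib] using h2
      · rw [run_cons, h5 _ (by simp [applyPair, hia, hib, hx])]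
        rfl

theorem le_weight {n k i : ℕ} {ρ : Equiv.Perm ℕ} (hρ : PermOn (n + 1) ρ) (hi : ρ i = n)
    {A S : Set (ℕ → Bool)} (hA : ∀ m < k, NoNet n A m)
    (hAS : ∀ x ∈ A, Function.update x n true ∘ ρ ∈ S) {C : List (ℕ × ℕ)} (hC : Net (n + 1) C)
    (hs : Sorts (n + 1) C S) : 2 ^ k ≤ weight C i := by
  obtain ⟨C', τ, h1, h2, h3, h4, h5⟩ := exists_prune hC i
  rw [← h3]
  refine Nat.pow_le_pow_right two_pos (le_of_not_gt fun hlt => ?_)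
  have hnet : Net n (relabel ρ C') := by
    intro c hc
    have hlt := h1.relabel hρ c hc
    obtain ⟨d, hd, rfl⟩ := List.mem_map.1 hc
    have := h2 d hd
    have e1 : ρ d.1 ≠ n := fun h => this.1 (ρ.injective (h.trans hi.symm))
    have e2 : ρ d.2 ≠ n := fun h => this.2 (ρ.injective (h.trans hi.symm))
    simp only at hlt ⊢
    omega
  refine hA _ hlt _ hnet (by simp [relabel]) fun x hx y hy => ?_
  have key : ∀ x ∈ A, ∀ t < n, run (relabel ρ C') x t =
      (run C (Function.update x n true ∘ ρ) ∘ (ρ * τ).symm) t := by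
    intro x _ t ht
    rw [run_congr hnet (y := Function.update x n true) (fun t ht => by simp [ht.ne]) t ht,
      h5 _ (by simp [hi]), ← run_relabel]
    simp [Equiv.Perm.mul_def]
  have := (hs _ (hAS x hx) _ (hAS y hy)).comp (hρ.mul h4).symm
  refine this.imp (fun h t ht => ?_) (fun h t ht => ?_) <;>
  · rw [key x hx t ht, key y hy t ht]
    exact h t (by omega)

/-! ### The meaning of packed sets -/

/-- The index of a vector on `n` channels in a packed set. -/
def enc (n : ℕ) (x : ℕ → Bool) : ℕ := Nat.rec 0 (fun m r => r + (x m).toNat * 2 ^ m) n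

/-- The vectors belonging to the packed set `X`. -/
def sem (n X : ℕ) : Set (ℕ → Bool) := {x | X.testBit (enc n x) = true}

theorem mem_sem {n X : ℕ} {x : ℕ → Bool} : x ∈ sem n X ↔ X.testBit (enc n x) = true := Iff.rfl

theorem enc_succ (n : ℕ) (x : ℕ → Bool) : enc (n + 1) x = enc n x + (x n).toNat * 2 ^ n := rfl

theorem enc_congr {n : ℕ} {x y : ℕ → Bool} (h : ∀ t < n, x t = y t) : enc n x = enc n y := by
  induction n with
  | zero => rfl
  | succ n ih => rw [enc_succ, enc_succ, ih fun t ht => h t (by omega), h n (by omega)]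

theorem enc_lt (n : ℕ) (x : ℕ → Bool) : enc n x < 2 ^ n := by
  induction n with
  | zero => exact Nat.one_pos
  | succ n ih =>
    rw [enc_succ, pow_succ]
    have : (x n).toNat * 2 ^ n ≤ 1 * 2 ^ n := Nat.mul_le_mul_right _ (Bool.toNat_le _)
    omega

theorem enc_testBit (n v : ℕ) : enc n v.testBit = v % 2 ^ n := by
  induction n with
  | zero => simp [enc, Nat.mod_one]
  | succ n ih => rw [enc_succ, ih, Nat.mod_pow_succ, Nat.toNat_testBit, mul_comm]

theorem enc_update {n a : ℕ} (ha : a < n) (x : ℕ → Bool) (v : Bool) :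
    enc n (Function.update x a v) + (x a).toNat * 2 ^ a = enc n x + v.toNat * 2 ^ a := by
  induction n with
  | zero => omega
  | succ n ih =>
    rw [enc_succ, enc_succ]
    rcases Nat.lt_succ_iff_lt_or_eq.1 ha with h | rfl
    · rw [Function.update_of_ne h.ne']
      have := ih h
      omega
    · rw [enc_congr (n := a) (y := x) fun t ht => Function.update_of_ne ht.ne _ _]
      simp
      omega

theorem enc_unit {n i : ℕ} (hi : i < n) : enc n (fun t => decide (t = i)) = 2 ^ i := by
  have h0 : ∀ n, enc n (fun _ => false) = 0 := fun n => by
    induction n with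
    | zero => rfl
    | succ n ih => simp [enc_succ, ih]
  have := enc_update hi (fun _ => false) true
  rw [h0] at this
  simp only [Bool.toNat_false, Bool.toNat_true, zero_mul, one_mul, zero_add, add_zero] at this
  rw [← this]
  exact enc_congr fun t _ => by simp [Function.update_apply]

theorem comp_swap_eq {a b : ℕ} (x : ℕ → Bool) :
    x ∘ Equiv.swap a b = Function.update (Function.update x a (x b)) b (x a) := by
  funext t
  simp only [Function.comp, Equiv.swap_apply_def, Function.update_apply]
  grind

theorem enc_swap {n a b : ℕ} (hab : a < b) (hb : b < n) {x : ℕ → Bool} (hxa : x a = true)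
    (hxb : x b = false) : enc n (x ∘ Equiv.swap a b) = enc n x + gap a b := by
  have h1 := enc_update (hab.trans hb) x (x b)
  have h2 := enc_update hb (Function.update x a (x b)) (x a)
  rw [← comp_swap_eq, Function.update_of_ne hab.ne'] at h2
  have h3 : 2 ^ a < 2 ^ b := Nat.pow_lt_pow_right (by norm_num) hab
  simp only [hxa, hxb, Bool.toNat_true, Bool.toNat_false] at h1 h2
  simp only [gap, Nat.pow_eq, Nat.sub_eq]
  omega

theorem testBit_natLand (X Y i : ℕ) : (Nat.land X Y).testBit i = (X.testBit i && Y.testBit i) :=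
  Nat.testBit_land X Y i

theorem testBit_natLor (X Y i : ℕ) : (Nat.lor X Y).testBit i = (X.testBit i || Y.testBit i) :=
  Nat.testBit_lor X Y i

theorem testBit_natXor (X Y i : ℕ) : (Nat.xor X Y).testBit i = (X.testBit i ^^ Y.testBit i) :=
  Nat.testBit_xor X Y i

theorem testBit_natShiftLeft (X k i : ℕ) :
    (Nat.shiftLeft X k).testBit i = (decide (k ≤ i) && X.testBit (i - k)) :=
  Nat.testBit_shiftLeft X

theorem testBit_natShiftRight (X k i : ℕ) :
    (Nat.shiftRight X k).testBit i = X.testBit (k + i) :=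
  Nat.testBit_shiftRight X

theorem testBit_allVec (n i : ℕ) : (allVec n).testBit i = decide (i < 2 ^ n) :=
  Nat.testBit_two_pow_sub_one (2 ^ n) i

theorem chan_succ (n a : ℕ) : chan (n + 1) a =
    bif Nat.beq a n then Nat.shiftLeft (allVec n) (Nat.pow 2 n)
    else Nat.lor (chan n a) (Nat.shiftLeft (chan n a) (Nat.pow 2 n)) := rfl

theorem testBit_chan_of_le {n a i : ℕ} (hi : 2 ^ n ≤ i) : (chan n a).testBit i = false := by
  induction n generalizing i with
  | zero => exact Nat.zero_testBit i
  | succ n ih =>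
    rw [pow_succ] at hi
    rw [chan_succ]
    cases Nat.beq a n
    · simp [ih (i := i) (by omega),
        ih (i := i - 2 ^ n) (by omega)]
    · simp [testBit_allVec]
      omega

theorem testBit_chan {n a : ℕ} (ha : a < n) (x : ℕ → Bool) :
    (chan n a).testBit (enc n x) = x a := by
  induction n with
  | zero => omega
  | succ n ih =>
    have hlt := enc_lt n x
    rw [chan_succ, enc_succ]
    by_cases h : a = n
    · subst h
      cases hx : x a <;> simp [testBit_allVec, hlt]
    · have hb : Nat.beq a n = false := Bool.eq_false_iff.2 fun e => h (Nat.eq_of_beq_eq_true e)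
      have := ih (by omega)
      rw [hb]
      cases hx : x n
      · simp [this, hlt]
      · simp [this, testBit_chan_of_le (Nat.le_add_left (2 ^ n) _)]

theorem testBit_allVec_enc (n : ℕ) (x : ℕ → Bool) : (allVec n).testBit (enc n x) = true := by
  simpa [testBit_allVec] using enc_lt n x

theorem testBit_oneZero {n a b : ℕ} (ha : a < n) (hb : b < n) (x : ℕ → Bool) :
    (oneZero n a b).testBit (enc n x) = (x a && !x b) := by
  simp [oneZero, testBit_chan ha, testBit_chan hb, testBit_allVec_enc]

theorem testBit_eqVal {n a b : ℕ} (ha : a < n) (hb : b < n) (x : ℕ → Bool) :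
    (eqVal n a b).testBit (enc n x) = (x a == x b) := by
  simp only [eqVal, testBit_natXor, testBit_natLor, testBit_oneZero ha hb, testBit_oneZero hb ha,
    testBit_allVec_enc]
  cases x a <;> cases x b <;> rfl

theorem force_eq {α : Type} (x : ℕ) (f : ℕ → α) : force x f = f x := by
  cases x <;> rfl

/-- The exchange performed by `swapSet`. -/
def swapOn (n : ℕ) (p : ℕ × ℕ) : Equiv.Perm ℕ :=
  if p.1 < p.2 ∧ p.2 < n then Equiv.swap p.1 p.2 else 1

theorem swap_guard (n a b : ℕ) :
    (Nat.ble (Nat.succ a) b && Nat.ble (Nat.succ b) n) = decide (a < b ∧ b < n) := by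
  rw [Bool.eq_iff_iff]
  simp

theorem comp_swapOn_mem {n X : ℕ} {x : ℕ → Bool} (hx : x ∈ sem n X) (p : ℕ × ℕ) :
    x ∘ swapOn n p ∈ sem n (swapSet n p.1 p.2 X) := by
  obtain ⟨a, b⟩ := p
  simp only [swapSet, swapOn, force_eq, swap_guard]
  by_cases h : a < b ∧ b < n
  swap
  · simpa [h] using hx
  obtain ⟨hab, hb⟩ := h
  have ha := hab.trans hb
  simp only [mem_sem] at hx
  simp only [hab, hb, mem_sem, and_self, if_true, decide_true, cond_true,
    testBit_natLor, testBit_natLand, testBit_natShiftLeft, testBit_natShiftRight,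
    testBit_eqVal ha hb, testBit_oneZero ha hb, Function.comp, Equiv.swap_apply_left,
    Equiv.swap_apply_right]
  change (Nat.testBit X (enc n (x ∘ Equiv.swap a b)) && _ || _) = true
  cases hxa : x a <;> cases hxb : x b
  · rw [comp_swap_eq, hxa, hxb]
    have e : Function.update (Function.update x a false) b false = x := by
      funext t; simp only [Function.update_apply]; grind
    simp [e, hx]
  · have h := enc_swap (x := x ∘ Equiv.swap a b) hab hb (by simp [hxb]) (by simp [hxa])
    have e : (x ∘ Equiv.swap a b) ∘ Equiv.swap a b = x := by funext t; simp
    rw [e] at h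
    simp [add_comm (gap a b), ← h, hx]
  · have h := enc_swap hab hb hxa hxb
    simp [h, hx, testBit_oneZero ha hb, hxa, hxb]
  · rw [comp_swap_eq, hxa, hxb]
    have e : Function.update (Function.update x a true) b true = x := by
      funext t; simp only [Function.update_apply]; grind
    simp [e, hx]

theorem permOn_swapOn (n : ℕ) (p : ℕ × ℕ) : PermOn n (swapOn n p) := by
  rw [swapOn]
  split_ifs with h
  exacts [permOn_swap (h.1.trans h.2) h.2, permOn_one n]

/-- The permutation performed by `swapsSet`. -/
def permOf (n : ℕ) : List (ℕ × ℕ) → Equiv.Perm ℕ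
  | [] => 1
  | p :: l => swapOn n p * permOf n l

theorem permOn_permOf (n : ℕ) (l : List (ℕ × ℕ)) : PermOn n (permOf n l) := by
  induction l with
  | nil => exact permOn_one n
  | cons p l ih => exact (permOn_swapOn n p).mul ih

theorem comp_permOf_mem {n X : ℕ} {x : ℕ → Bool} (hx : x ∈ sem n X) (l : List (ℕ × ℕ)) :
    x ∘ permOf n l ∈ sem n (swapsSet n l X) := by
  induction l generalizing X x with
  | nil => exact hx
  | cons p l ih => exact ih (comp_swapOn_mem hx p)

theorem natBeq_eq_decide (a b : ℕ) : Nat.beq a b = decide (a = b) := by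
  rw [Bool.eq_iff_iff]
  simp

theorem permOf_track (n : ℕ) (l : List (ℕ × ℕ)) (i : ℕ) : permOf n l (track n l i) = i := by
  induction l generalizing i with
  | nil => rfl
  | cons p l ih =>
    change swapOn n p (permOf n l (track n l _)) = i
    rw [ih, swap_guard, swapOn]
    by_cases h : p.1 < p.2 ∧ p.2 < n
    · simp only [h, and_self, decide_true, cond_true, if_true, Equiv.swap_apply_def]
      have := h.1.ne
      simp only [natBeq_eq_decide, Bool.cond_decide]
      grind
    · simp [h]

theorem sem_compSet_subset {n i j X : ℕ} (hij : i < j) (hj : j < n) :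
    sem n (compSet n i j X) ⊆ applyPair (i, j) '' sem n X := by
  intro y hy
  have hi := hij.trans hj
  simp only [mem_sem, compSet, testBit_natLor, testBit_natLand, testBit_natShiftLeft,
    testBit_natXor, testBit_allVec_enc, testBit_oneZero hi hj, testBit_oneZero hj hi,
    Bool.or_eq_true, Bool.and_eq_true, decide_eq_true_eq] at hy
  rcases hy with ⟨h1, h2⟩ | ⟨⟨h1, h2, h3⟩, h4, h5⟩
  · refine ⟨y, h1, applyPair_eq_self fun h => ?_⟩
    simpa [h] using h2
  · have hyi : y i = false := by simpa using h5
    have h := enc_swap (x := y ∘ Equiv.swap i j) hij hj (by simp [h4]) (by simp [hyi])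
    have e : (y ∘ Equiv.swap i j) ∘ Equiv.swap i j = y := by funext t; simp
    rw [e] at h
    rw [h, Nat.add_sub_cancel] at h2
    refine ⟨y ∘ Equiv.swap i j, h2, ?_⟩
    rw [applyPair_swap hij.ne', applyPair_eq_self fun _ => by simp [h4], Equiv.swap_comm j i, e]

theorem update_not_mem_flipSet {n j X : ℕ} (hj : j < n) {x : ℕ → Bool} (hx : x ∈ sem n X) :
    Function.update x j (!x j) ∈ sem n (flipSet n j X) := by
  have h := enc_update hj x (!x j)
  simp only [mem_sem] at hx
  simp only [mem_sem, flipSet, testBit_natLor, testBit_natLand, testBit_natShiftLeft,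
    testBit_natShiftRight, testBit_natXor]
  cases hxj : x j
  · simp only [hxj, Bool.not_false, Bool.toNat_false, Bool.toNat_true, zero_mul, one_mul,
      add_zero] at h
    simp [h, hx, testBit_chan hj, hxj, testBit_allVec_enc]
  · simp only [hxj, Bool.not_true, Bool.toNat_false, Bool.toNat_true, zero_mul, one_mul,
      add_zero] at h
    simp [add_comm (2 ^ j), h, hx, testBit_chan hj, hxj]

theorem not_mem_dualSet {n X : ℕ} {x : ℕ → Bool} (hx : x ∈ sem n X) :
    (fun t => !x t) ∈ sem n (dualSet n n X) := by
  have key : ∀ m ≤ n, (fun t => if t < m then !x t else x t) ∈ sem n (dualSet n m X) := by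
    intro m
    induction m with
    | zero => exact fun _ => by simpa using (show x ∈ sem n (dualSet n 0 X) from hx)
    | succ m ih =>
      intro hm
      have := update_not_mem_flipSet hm (ih (by omega))
      have e : (fun t => if t < m + 1 then !x t else x t) =
          Function.update (fun t => if t < m then !x t else x t) m
            !(if m < m then !x m else x m) := by
        funext t
        rw [Function.update_apply]
        grind
      rw [e]
      exact this
  have := key n le_rfl
  rw [mem_sem] at this ⊢
  rwa [enc_congr (y := fun t => !x t) fun t ht => by simp [ht]] at this

theorem update_mem_sem_shiftLeft {n X : ℕ} {x : ℕ → Bool} (hx : x ∈ sem n X) :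
    Function.update x n true ∈ sem (n + 1) (Nat.shiftLeft X (Nat.pow 2 n)) := by
  rw [mem_sem] at hx ⊢
  rw [enc_succ, enc_congr (n := n) (y := x) fun t ht => Function.update_of_ne ht.ne _ _]
  simp [hx]

theorem sem_subset_of_subSet {n X Y : ℕ} (h : subSet X Y = true) : sem n X ⊆ sem n Y := by
  intro x hx
  rw [mem_sem] at hx ⊢
  rw [← Nat.eq_of_beq_eq_true h, testBit_natLand, Bool.and_eq_true] at hx
  exact hx.2

theorem forall_of_land_eq_zero {n i j Y : ℕ} (hi : i < n) (hj : j < n)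
    (h : Nat.beq (Nat.land Y (oneZero n i j)) 0 = true) :
    ∀ x ∈ sem n Y, x i = true → x j = true := by
  intro x hx hxi
  have := testBit_natLand Y (oneZero n i j) (enc n x)
  rw [Nat.eq_of_beq_eq_true h, Nat.zero_testBit, testBit_oneZero hi hj, hxi] at this
  rw [mem_sem] at hx
  simpa [hx] using this

theorem exists_of_land_ne_zero {n i j Y : ℕ} (hi : i < n) (hj : j < n)
    (h : Nat.beq (Nat.land Y (oneZero n i j)) 0 = false) :
    ∃ x ∈ sem n Y, x i = true ∧ x j = false := by
  obtain ⟨v, hv⟩ := Nat.exists_testBit_of_ne_zero (Nat.ne_of_beq_eq_false h)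
  rw [testBit_natLand, Bool.and_eq_true] at hv
  have hlt : v < 2 ^ n := by
    by_contra hle
    have := hv.2
    rw [oneZero, testBit_natLand, testBit_chan_of_le (not_lt.1 hle)] at this
    simp at this
  have he : enc n v.testBit = v := by rw [enc_testBit, Nat.mod_eq_of_lt hlt]
  refine ⟨v.testBit, by rw [mem_sem, he, hv.1], ?_⟩
  have := testBit_oneZero hi hj v.testBit
  rw [he, hv.2] at this
  simpa using this.symm

/-! ### Soundness of the checker -/

/-- The bounds claimed by a layer hold. -/
def Layer.Valid (L : Layer) : Prop :=
  ∀ i m, m < L.low i → NoNet L.n (sem L.n (slot L.n L.sets i)) m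

theorem NoNet.pick {n sets r m : ℕ} (h : NoNet n (sem n (slot n sets r)) m) (d : ℕ) :
    NoNet n (sem n (pick n sets r d)) m := by
  rw [_root_.pick]
  cases Nat.beq d 0
  exacts [h.dual fun x hx => not_mem_dualSet hx, h]

theorem exists_perm_of_fits {n sets r d T : ℕ} {l : List (ℕ × ℕ)} (h : fits n sets r d l T = true) :
    ∃ σ, PermOn n σ ∧ ∀ x ∈ sem n (pick n sets r d), x ∘ σ ∈ sem n T := by
  simp only [fits, force_eq] at h
  exact ⟨_, (permOn_permOf n _).mul (permOn_permOf n l), fun x hx =>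
    sem_subset_of_subSet h (comp_permOf_mem (comp_permOf_mem hx _) l)⟩

theorem mem_pairs {n : ℕ} {p : ℕ × ℕ} : p ∈ pairs n ↔ p.1 < p.2 ∧ p.2 < n := by
  induction n with
  | zero => simp [pairs]
  | succ n ih =>
    have key : ∀ m, p ∈ (Nat.rec (pairs n) (fun i s => (i, n) :: s) m : List (ℕ × ℕ)) ↔
        p ∈ pairs n ∨ p.1 < m ∧ p.2 = n := by
      intro m
      induction m with
      | zero => simp
      | succ m ihm =>
        simp only [List.mem_cons, ihm, Prod.ext_iff]
        grind
    refine (key n).trans ?_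
    rw [ih]
    omega

/-- The evidence for the bound `k` for `Y` provided by the comparator `(i, j)`. -/
def PairOK (L : Layer) (k Y i j : ℕ) : Prop :=
  (∀ x ∈ sem L.n Y, x i = true → x j = true) ∨ (∀ x ∈ sem L.n Y, x j = true → x i = true) ∨
    ∃ r d σ, k ≤ L.low r + 1 ∧ PermOn L.n σ ∧
      ∀ x ∈ sem L.n (pick L.n L.sets r d), x ∘ σ ∈ applyPair (i, j) '' sem L.n Y

/-- `Y` contains incomparable vectors. -/
def Incomparable (n Y : ℕ) : Prop :=
  ∃ i < n, ∃ j < n, ∃ x ∈ sem n Y, ∃ y ∈ sem n Y,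
    (x i = true ∧ x j = false) ∧ y j = true ∧ y i = false

theorem pairOK_of_succCheck {L : Layer} {k Y : ℕ} {ps : List (ℕ × ℕ)}
    (hps : ∀ p ∈ ps, p.1 < p.2 ∧ p.2 < L.n) {c : ℕ} {b : Bool}
    (h : succCheck L k Y ps c b = true) :
    (∀ p ∈ ps, PairOK L k Y p.1 p.2) ∧ (b = true ∨ Incomparable L.n Y) := by
  unfold succCheck at h
  simp only [force_eq] at h
  induction ps generalizing c b with
  | nil => exact ⟨by simp, Or.inl h⟩
  | cons p ps ih =>
    obtain ⟨hp, hj⟩ := hps p (by simp)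
    have hi := hp.trans hj
    replace ih := @ih fun q hq => hps q (by simp [hq])
    simp only [List.forall_mem_cons, and_assoc]
    dsimp only at h
    cases h1 : Nat.beq (Nat.land Y (oneZero L.n p.1 p.2)) 0
    swap
    · rw [h1] at h
      exact ⟨Or.inl (forall_of_land_eq_zero hi hj h1), ih h⟩
    cases h2 : Nat.beq (Nat.land Y (oneZero L.n p.2 p.1)) 0
    swap
    · rw [h1, h2] at h
      exact ⟨Or.inr (Or.inl (forall_of_land_eq_zero hj hi h2)), ih h⟩
    simp only [h1, h2, cond_false, Bool.and_eq_true] at h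
    obtain ⟨⟨h3, h4⟩, h5⟩ := h
    obtain ⟨σ, hσ, h6⟩ := exists_perm_of_fits h4
    refine ⟨Or.inr (Or.inr ⟨_, _, σ, Nat.le_of_ble_eq_true h3, hσ, fun x hx =>
      sem_compSet_subset hp hj (h6 x hx)⟩), (ih h5).1, Or.inr ?_⟩
    obtain ⟨x, hx, hx'⟩ := exists_of_land_ne_zero hi hj h1
    obtain ⟨y, hy, hy'⟩ := exists_of_land_ne_zero hj hi h2
    exact ⟨_, hi, _, hj, x, hx, y, hy, hx', hy'⟩

/-- The evidence for the claim of slot `i`. -/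
def RowOK (L : Layer) (i : ℕ) : Prop :=
  (∀ m < L.low i, NoNet L.n (sem L.n (slot L.n L.sets i)) m) ∨
    (∀ a b, a < b → b < L.n → PairOK L (L.low i) (slot L.n L.sets i) a b) ∧
      Incomparable L.n (slot L.n L.sets i)

theorem valid_of_forall_rowOK {L : Layer} (h : ∀ i, 1 ≤ i → i < L.size → RowOK L i) : L.Valid := by
  intro i m
  induction m using Nat.strong_induction_on generalizing i with
  | _ m ih =>
    intro hm
    have hi : 1 ≤ i ∧ i < L.size := by
      by_contra hi
      have : (Nat.ble 1 i && Nat.ble (Nat.succ i) L.size) = false := by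
        rw [Bool.eq_false_iff]
        simpa using hi
      simp [Layer.low, this] at hm
    rcases h i hi.1 hi.2 with h | ⟨h, a, ha, b, hb, x, hx, y, hy, ⟨h1, h2⟩, h3, h4⟩
    · exact h m hm
    obtain _ | m := m
    · exact noNet_zero ha hb hx hy h1 h2 h4 h3
    refine (ih m (by omega) i (by omega)).succ fun a b hab hb => ?_
    rcases h a b hab hb with h | h | ⟨r, d, σ, hk, hσ, h⟩
    · exact Or.inl h
    · exact Or.inr (Or.inl h)
    · exact Or.inr (Or.inr (((ih m (by omega) r (by omega)).pick d).perm hσ h))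

theorem exists_finset_of_huffCheck {L : Layer} (hL : L.Valid) {k Y : ℕ} {b : Bool} {l : List Embed}
    {C : List (ℕ × ℕ)} (hC : Net (L.n + 1) C) (hs : Sorts (L.n + 1) C (sem (L.n + 1) Y))
    {U : Finset ℕ} (hU : ∀ t ∈ U, t < L.n + 1)
    (hY : ∀ t ∈ U, b = true ∨ (fun s => decide (s = t)) ∈ sem (L.n + 1) Y) {seen sum : ℕ}
    (hseen : ∀ t, seen.testBit t = true ↔ t ∈ U) (hsum : sum ≤ ∑ t ∈ U, weight C t)
    (h : huffCheck L k Y b l seen sum = true) :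
    ∃ T : Finset ℕ, (∀ t ∈ T, t < L.n + 1) ∧
      (∀ t ∈ T, b = true ∨ (fun s => decide (s = t)) ∈ sem (L.n + 1) Y) ∧
      2 ^ (k - 1) < ∑ t ∈ T, weight C t ∧ T.card ≤ U.card + l.length := by
  unfold huffCheck at h
  induction l generalizing U seen sum with
  | nil => exact ⟨U, hU, hY, (Nat.le_of_ble_eq_true h).trans hsum, le_rfl⟩
  | cons e l ih =>
    simp only [Bool.and_eq_true, Bool.not_eq_true', Bool.or_eq_true] at h
    obtain ⟨⟨⟨h1, h2⟩, h3⟩, h4⟩ := h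
    have htok : permOf (L.n + 1) e.swaps (e.token L.n) = L.n := permOf_track _ _ _
    have hlt : e.token L.n < L.n + 1 := by
      rw [← permOn_permOf (L.n + 1) e.swaps, htok]
      exact Nat.lt_succ_self _
    have hnot : e.token L.n ∉ U := by
      rw [← hseen, h2]
      simp
    have hunit : ∀ t ∈ insert (e.token L.n) U,
        b = true ∨ (fun s => decide (s = t)) ∈ sem (L.n + 1) Y := by
      rw [Finset.forall_mem_insert]
      refine ⟨h3.imp_right fun h => ?_, hY⟩
      rwa [mem_sem, enc_unit hlt]
    have hbits : ∀ t, (Nat.lor seen (Nat.pow 2 (e.token L.n))).testBit t = true ↔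
        t ∈ insert (e.token L.n) U := by
      intro t
      rw [testBit_natLor, Bool.or_eq_true, hseen, Finset.mem_insert, Nat.pow_eq,
        Nat.testBit_two_pow, decide_eq_true_eq, or_comm, eq_comm]
    have hweight : sum + 2 ^ L.low e.ref ≤ ∑ t ∈ insert (e.token L.n) U, weight C t := by
      rw [Finset.sum_insert hnot, add_comm (weight _ _)]
      exact Nat.add_le_add hsum (le_weight (permOn_permOf _ _) htok
        (fun m hm => (hL e.ref m hm).pick e.dual) (fun x hx => sem_subset_of_subSet h1
          (comp_permOf_mem (update_mem_sem_shiftLeft hx) _)) hC hs)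
    obtain ⟨T, hT⟩ := ih (Finset.forall_mem_insert _ _ _ |>.2 ⟨hlt, hU⟩) hunit hbits hweight h4
    rw [Finset.card_insert_of_notMem hnot, add_assoc, add_comm 1] at hT
    exact ⟨T, hT⟩

theorem noNet_of_huffCheck {L : Layer} (hL : L.Valid) {k Y : ℕ} {l : List Embed}
    (h : huffCheck L k Y (single l) l 0 0 = true) {m : ℕ} (hm : m < k) :
    NoNet (L.n + 1) (sem (L.n + 1) Y) m := by
  rintro C hC rfl hs
  have key : ∃ T : Finset ℕ, (∀ s ∈ T, ∀ t ∈ T, endpos C s = endpos C t) ∧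
      2 ^ (k - 1) < ∑ t ∈ T, weight C t := by
    obtain ⟨T, h1, h2, h3, h4⟩ := exists_finset_of_huffCheck hL hC hs (U := ∅) (by simp) (by simp)
      (by simp) le_rfl h
    refine ⟨T, fun s hs' t ht => ?_, h3⟩
    cases hb : single l
    · simp only [hb, Bool.false_eq_true, false_or] at h2
      exact endpos_eq hC hs (h1 s hs') (h1 t ht) (h2 s hs') (h2 t ht)
    · have hl : l.length ≤ 1 := by
        rcases l with _ | ⟨e, _ | ⟨e', l⟩⟩
        · exact Nat.zero_le 1
        · exact le_rfl
        · cases hb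
      rw [Finset.card_le_one.1 (h4.trans (by simpa using hl)) s hs' t ht]
  obtain ⟨T, h1, h2⟩ := key
  have := h2.trans_le (sum_weight_le C T h1)
  have := (Nat.pow_lt_pow_iff_right (by norm_num)).1 this
  omega

theorem rowOK_of_checkRows {L' L : Layer} (hL' : L'.Valid) (hn : L.n = L'.n + 1) {rows : List ℕ}
    {i : ℕ} {es : List ℕ} (h : checkRows L' L rows i es = true) :
    ∀ j < rows.length, RowOK L (i + j) := by
  unfold checkRows at h
  simp only [force_eq] at h
  induction rows generalizing i es with
  | nil => simp
  | cons c rows ih =>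
    have key : RowOK L i ∧ ∀ j < rows.length, RowOK L (i + 1 + j) := by
      cases hc : Nat.beq (Nat.mod c 2) 0
      · rcases es with _ | ⟨e, es⟩
        · simp [hc] at h
        · simp only [hc, cond_false, Bool.and_eq_true] at h
          obtain ⟨h1, h2⟩ := pairOK_of_succCheck (fun p hp => mem_pairs.1 hp) h.1
          exact ⟨Or.inr ⟨fun a b hab hb => h1 (a, b) (mem_pairs.2 ⟨hab, hb⟩), by simpa using h2⟩,
            ih h.2⟩
      · simp only [hc, cond_true, Bool.and_eq_true] at h
        refine ⟨Or.inl fun m hm => ?_, ih h.2⟩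
        have := noNet_of_huffCheck hL' h.1 hm
        rwa [← hn] at this
    intro j hj
    obtain _ | j := j
    · exact key.1
    · rw [← add_assoc, add_right_comm]
      exact key.2 j (by simpa using hj)

theorem length_eq_rec (l : List ℕ) : (List.rec 0 (fun _ _ r => Nat.succ r) l : ℕ) = l.length := by
  induction l with
  | nil => rfl
  | cons c l ih => exact congrArg Nat.succ ih

theorem exists_part {rows : List (List ℕ)} {i : ℕ} (hi : i < total rows) :
    ∃ c < rows.length, ∃ j < (partAt rows c).length, i = partStart rows c + j := by
  induction rows generalizing i with
  | nil => exact absurd hi (Nat.not_lt_zero i)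
  | cons r rows ih =>
    have ht : total (r :: rows) = r.length + total rows := by
      rw [← length_eq_rec]
      rfl
    by_cases h : i < r.length
    · exact ⟨0, by simp, i, h, (Nat.zero_add i).symm⟩
    · obtain ⟨c, hc, j, hj, e⟩ := ih (i := i - r.length) (by omega)
      refine ⟨c + 1, by simpa using hc, j, hj, ?_⟩
      have hp : partStart (r :: rows) (c + 1) = r.length + partStart rows c := by
        rw [← length_eq_rec]
        rfl
      omega

/-- The layer on `n` channels over `L'` with `sizes k` slots for the bound `k`. -/
noncomputable def mkLayer (n : ℕ) (L' : Layer) (sizes : List ℕ) (rows : List (List ℕ)) : Layer :=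
  ⟨n, Nat.succ (total rows),
    decodeAll L' ⟨n, Nat.succ (total rows), 0, packLows sizes 0 0, packStarts sizes 0 0⟩ rows 1 0,
    packLows sizes 0 0, packStarts sizes 0 0⟩

theorem withLayer_eq {α : Type} (n : ℕ) (L' : Layer) (sizes : List ℕ) (rows : List (List ℕ))
    (f : Layer → α) : withLayer n L' sizes rows f = f (mkLayer n L' sizes rows) := by
  simp only [withLayer, force_eq, mkLayer]

theorem valid_mkLayer {n : ℕ} {L' : Layer} {sizes : List ℕ} {rows edges : List (List ℕ)}
    (hL' : L'.Valid) (hn : n = L'.n + 1)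
    {eval : (Layer → Layer → Bool) → Bool}
    (hw : ∀ f, eval f = f L' (mkLayer n L' sizes rows))
    (h : ∀ c < rows.length, checkPart rows edges c eval = true) :
    (mkLayer n L' sizes rows).Valid := by
  refine valid_of_forall_rowOK fun i h1 hi => ?_
  obtain ⟨i, rfl⟩ := Nat.exists_eq_add_of_le' h1
  obtain ⟨c, hc, j, hj, rfl⟩ := exists_part (Nat.lt_of_succ_lt_succ hi)
  have := h c hc
  rw [checkPart, hw] at this
  have := rowOK_of_checkRows hL' hn this j hj
  rwa [Nat.succ_eq_add_one, add_right_comm] at this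

theorem valid_layer2 : layer2.Valid := by
  refine valid_of_forall_rowOK fun i h1 hi => ?_
  exact absurd hi (not_lt_of_ge h1)

/-! ### Networks on `n` channels as networks on natural numbers -/

section Channels

variable {n : ℕ}

/-- The vector `x`, continued by zeros. -/
def extend (x : Fin n → Bool) (t : ℕ) : Bool := if h : t < n then x ⟨t, h⟩ else false

def toPairs (C : List (Fin n × Fin n)) : List (ℕ × ℕ) := C.map fun c => (c.1.val, c.2.val)

theorem extend_val (x : Fin n → Bool) (i : Fin n) : extend x i = x i := by
  simp [extend]

theorem extend_applyComp (c : Fin n × Fin n) (x : Fin n → Bool) :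
    extend (applyComp c x) = applyPair (c.1.val, c.2.val) (extend x) := by
  have hmin : ∀ a b : Bool, min a b = (a && b) := by decide
  have hmax : ∀ a b : Bool, max a b = (a || b) := by decide
  funext t
  simp only [applyPair, extend_val]
  by_cases ht : t < n
  · simp only [extend, ht, dif_pos, applyComp, Fin.ext_iff, hmin, hmax]
  · have h1 : t ≠ c.1 := fun e => ht (e ▸ c.1.2)
    have h2 : t ≠ c.2 := fun e => ht (e ▸ c.2.2)
    simp [extend, ht, h1, h2]

theorem extend_runNet (C : List (Fin n × Fin n)) (x : Fin n → Bool) :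
    extend (runNet C x) = run (toPairs C) (extend x) := by
  induction C generalizing x with
  | nil => rfl
  | cons c C ih =>
    rw [toPairs, List.map_cons, run_cons, ← extend_applyComp]
    exact ih (applyComp c x)

theorem Standard.net {C : List (Fin n × Fin n)} (hC : Standard C) : Net n (toPairs C) := by
  intro p hp
  obtain ⟨c, hc, rfl⟩ := List.mem_map.1 hp
  exact ⟨c.1.2, c.2.2, (Fin.lt_def.1 (hC c hc)).ne⟩

theorem comparable_extend {x y : Fin n → Bool} (hx : Monotone x) (hy : Monotone y) :
    Comparable n (extend x) (extend y) := by
  by_contra h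
  simp only [Comparable, not_or, not_forall] at h
  obtain ⟨⟨i, hi, h1, h2⟩, j, hj, h3, h4⟩ := h
  simp only [extend, hi, hj, dif_pos, Bool.not_eq_true] at h1 h2 h3 h4
  rcases le_total i j with hij | hij
  · have := hx (show (⟨i, hi⟩ : Fin n) ≤ ⟨j, hj⟩ from hij)
    rw [h1, h4] at this
    exact absurd this (by decide)
  · have := hy (show (⟨j, hj⟩ : Fin n) ≤ ⟨i, hi⟩ from hij)
    rw [h3, h2] at this
    exact absurd this (by decide)

/-- Sorting networks are no smaller than the networks mapping a given set to a chain. -/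
theorem IsSortingNet.le_length {C : List (Fin n × Fin n)} (hC : IsSortingNet C) {X k : ℕ}
    (h : ∀ m < k, NoNet n (sem n X) m) : k ≤ C.length := by
  by_contra! hk
  refine h _ hk (toPairs C) hC.1.net (by simp [toPairs]) fun x _ y _ => ?_
  have key : ∀ z : ℕ → Bool, ∀ t < n,
      run (toPairs C) z t = extend (runNet C fun i => z i) t := by
    intro z t ht
    rw [extend_runNet]
    exact run_congr hC.1.net (fun s hs => by simp [extend, hs]) t ht
  refine (comparable_extend (hC.2 fun i => x i) (hC.2 fun i => y i)).imp ?_ ?_ <;>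
  · intro h t ht
    rw [key x t ht, key y t ht]
    exact h t ht

theorem applyPair_mem_compSet {i j X : ℕ} (hij : i < j) (hj : j < n) {x : ℕ → Bool}
    (hx : x ∈ sem n X) : applyPair (i, j) x ∈ sem n (compSet n i j X) := by
  have hi := hij.trans hj
  by_cases h : x i = true ∧ x j = false
  · have e : applyPair (i, j) x = x ∘ Equiv.swap i j := by
      funext t
      simp only [applyPair, Function.comp, Equiv.swap_apply_def]
      split_ifs <;> simp [h]
    rw [mem_sem] at hx
    rw [e]
    simp only [mem_sem, compSet, testBit_natLor, testBit_natLand, testBit_natShiftLeft,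
      testBit_oneZero hj hi]
    simp [enc_swap hij hj h.1 h.2, hx, testBit_oneZero hi hj, h]
  · rw [applyPair_eq_self (by grind)]
    rw [mem_sem] at hx
    simp only [mem_sem, compSet, testBit_natLor, testBit_natLand, testBit_natXor,
      testBit_allVec_enc, testBit_oneZero hi hj, hx]
    grind

/-- The set of outputs of a network, packed into a natural number. -/
noncomputable def outSet (n : ℕ) (C : List (ℕ × ℕ)) : ℕ → ℕ :=
  List.rec (fun X => X) (fun c _ ih X => ih (compSet n c.1 c.2 X)) C

theorem run_mem_outSet {C : List (Fin n × Fin n)} (hC : Standard C) {X : ℕ} {x : ℕ → Bool}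
    (hx : x ∈ sem n X) : run (toPairs C) x ∈ sem n (outSet n (toPairs C) X) := by
  induction C generalizing x X with
  | nil => exact hx
  | cons c C ih =>
    exact ih (fun d hd => hC d (List.mem_cons_of_mem _ hd))
      (applyPair_mem_compSet (hC c List.mem_cons_self) c.2.2 hx)

theorem isSortingNet_of_outSet {C : List (Fin (n + 1) × Fin (n + 1))} (hC : Standard C)
    (h : ∀ i < n, Nat.beq (Nat.land (outSet (n + 1) (toPairs C) (allVec (n + 1)))
      (oneZero (n + 1) i (i + 1))) 0 = true) : IsSortingNet C := by
  refine ⟨hC, fun x => Fin.monotone_iff_le_succ.2 fun i => ?_⟩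
  have := forall_of_land_eq_zero (by omega) (by omega) (h i i.2) _
    (run_mem_outSet hC (testBit_allVec_enc (n + 1) (extend x)))
  rw [← extend_runNet] at this
  have h1 := extend_val (runNet C x) i.castSucc
  have h2 := extend_val (runNet C x) i.succ
  rw [Fin.val_castSucc] at h1
  rw [Fin.val_succ] at h2
  rw [← h1, ← h2]
  exact fun h => this h

end Channels

/-- A sorting network on nine channels with 25 comparators. -/
def net25 : List (Fin 9 × Fin 9) :=
  [(0, 3), (1, 7), (2, 5), (4, 8), (0, 7), (2, 4), (3, 8), (5, 6), (0, 2), (1, 3), (4, 5), (7, 8),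
    (1, 4), (3, 6), (5, 7), (0, 1), (2, 4), (3, 5), (6, 8), (2, 3), (4, 5), (6, 7), (1, 2), (3, 4),
    (5, 6)]

theorem isSortingNet_net25 : IsSortingNet net25 :=
  isSortingNet_of_outSet (by unfold Standard; decide) (by decide +kernel)

/-! ### Certificates: the slots of the layers on three to nine channels and their proofs -/

set_option maxRecDepth 100000

noncomputable def sizes3 : List ℕ := [1, 1, 1]

noncomputable def rows3 : List (List ℕ) := [
[258, 366601]]

noncomputable def edges3 : List (List ℕ) := [
[7]]

noncomputable def sizes4 : List ℕ := [1, 0, 0, 2, 2, 1]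

noncomputable def rows4 : List (List ℕ) := [
[20418, 12738, 2353988, 349508, 3359]]

noncomputable def edges4 : List (List ℕ) := [
[32821]]

noncomputable def sizes5 : List ℕ := [1, 0, 0, 0, 4, 12, 20, 17, 5]

noncomputable def rows5 : List (List ℕ) := [
[87586, 128, 18498, 271938, 442466, 364162, 548642, 341314, 295042, 64834, 64642, 12481457, 272162,
160, 285623108, 352, 643750564, 67743, 544125604, 413873, 352673, 64866, 31935, 478553, 85905,
341154, 134296861190, 64674, 89907, 341346, 122037, 125877, 707605789190, 364386, 311924292,
829659, 371853, 148279, 161407, 755613, 376561, 52257, 160809, 58859843, 437187, 755300283814,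
161229, 448779, 1445841, 376613, 11524795, 160775, 1402577, 1238349, 1320927302483496, 3440871,
3548707, 3569107]]

noncomputable def edges5 : List (List ℕ) := [
[761612, 6408110391, 39027721867, 34214642418, 5671394858, 138191012254, 99275915864, 207863123860,
4982400738957, 4942096431982, 46434009605, 339278809207303, 17864973164731, 12710153150230222,
311963650810, 34129367191258, 135839463540718, 98038255078669, 307927431144734, 181210624893859,
12623728661769302, 4609178555413615, 103978865332987, 354963723733, 423613152892399,
9290857567478940, 99184192977032, 1461465913346132, 302994324226184, 1359454733405177,
546933718996385]]

noncomputable def sizes6 : List ℕ := [1, 0, 0, 0, 0, 4, 37, 81, 123, 115, 54, 16]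

noncomputable def rows6 : List (List ℕ) := [
[53022626, 192, 242390914, 480, 2235746, 39655906, 2228066, 53022978, 213427266, 26271689595364,
2235586, 2228226, 159959330, 188923074, 173326242, 2235682, 254421442, 640, 2528, 254421634, 544,
672, 39655874, 28518594, 576, 200060290, 992, 162632802, 736, 2816, 202290082, 768, 1024, 2258370,
173326434, 1046101605, 864, 3040, 2624, 12643885379076, 5261917256196, 2230370, 4164102578148,
17186379855812, 497909335, 256202146, 261550850, 3332613, 47663, 61043362, 258877442, 3285541,
53023170, 1837569, 2422751535652, 13779388712036, 13779388700708, 261548962, 16050716156388,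
16050716156292, 320365922, 2289218, 16050916665860, 1243455241, 143919266, 2236258, 7585250,
18278274, 39658370, 2228610, 221457666, 39656386, 28964962, 10258306, 110757139, 173326818,
2281538, 2012149, 2236322, 277589634, 663364579, 12922242, 173327010, 1990512741, 106499458,
320366018, 301659522, 2289346, 296311010, 28518946, 159961538, 301659618, 2288962, 39656258,
53023330, 2235970, 200060994, 815691, 307004674, 2281602, 1376, 1280, 773913077, 1216, 122539874,
1312, 3296, 1248, 377717227, 266947074, 3072, 3136, 162189474, 1408, 1568, 41042242, 1536, 3552,
3488, 3456, 1600, 1504, 619177, 2422751577540, 304423, 2422751608132, 16050729595844,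
17186379962052, 876629, 69923613, 304413, 304905, 16050716228804, 837725, 13779388784388, 312991,
17186379962436, 16050716228932, 176002466, 486672589, 4399021, 2515065, 127886850, 10258850,
26271747123236, 383576641, 939613, 23773245510628, 95851298, 210762402, 8362131, 146593250,
298986754, 13003672711492, 4398529, 32592196167, 47730018, 250856098, 7836941, 939787, 938001,
47737634, 7261549743, 26271689652452, 106499522, 320364802, 12922754, 323105443, 2229122, 2230978,
18492714017092, 2133301, 935733, 74471618, 2168293, 67087349, 16050729580612, 21005218, 151940130,
23616418, 35199085337, 42042551, 173327458, 944209, 209053622969495334, 2826439, 71230094449,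
17949291, 45003906, 71330866387, 2728795, 274924258, 29424665951, 8894053771, 7487415, 8425635,
2616551, 215141470117, 1463382842813204070, 2826265, 98059024481, 235470887905, 159999970,
1274614979, 111846722, 27788613071, 12930434, 193495584932, 33210819637, 39217876043,
382735220046935238, 20952770, 3278356515, 53024194, 16088459888932038, 93178146, 178723074,
382735218924077446, 277592418, 2282178, 159960514, 307060322, 934333, 216156834, 117195522,
53026082, 75132951903, 6898598521, 80043872571, 274945378, 671906759755, 280271298, 2825353,
813049926237, 13723769862709, 8166704081, 128257136729, 529871500987, 33212884165, 128500389243629,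
98006168267, 45147407337, 8497507, 3712, 1824, 19592235, 37213897, 17372659, 37313565, 4134295,
4194365, 38497105, 1425851, 3756791, 462365, 30591881623, 9077247, 10031143, 12100043, 5240801279,
4191907, 36385709967, 2853263, 1433069, 12475819, 290224575607, 23360990301156, 15706454177,
47128747691, 8101123968996, 1418563, 93295879836175558, 3216359357, 114750409, 4139845,
1056111315599, 96917115247, 1196354049, 1887940512333694630, 1380767, 104316349219, 14899945385,
1327379, 1425963, 36382317681, 10041521, 104199952107, 84364779379, 14604639353, 35280783,
344681437, 40517029859, 38299845, 462221, 12719805, 38426415, 160944579499702393343816, 12898309,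
4296299, 12903531, 111625764045, 31419304549, 112020001, 30590075025, 2282466, 104581701, 12895853,
335831785, 16106633983897350, 29802589, 8044822652623, 200950675767, 313063484845, 38355511,
38370247, 4296271, 11470881, 11953291, 138626370, 210815810, 12628966570436, 431584808039,
153770688717, 66987697157, 95859330, 74466434, 850756379, 4288003, 106500098, 38722671, 37294701,
116035325, 245584216123, 156537050753, 4303253, 401846780899, 4084232673851, 22955890971,
1763356430851745, 38712417, 38684127, 38678711, 38570225, 44700400449, 98962565, 89468894635,
98944853, 148819937505, 131467282767, 357210187017, 7655613190097, 1852641767150899, 8796009823655,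
719124270359380230, 104197250233, 2917128610019, 115669655, 297724993849, 8622463037695, 116194897,
36215345, 36202005, 36214653, 97421291, 36208463, 108637281, 1503823877339, 13956193184115,
36065743, 6013102115255, 105964951, 313875729, 322370583, 229359963, 322760065, 1064516652653,
84502553, 322360911, 301702541, 108647885, 866512139, 1293909389133, 59005753, 313872061,
10792300567925, 324605993, 285313965967, 2826107739, 1315406768251, 941479325, 292703518629,
68968622180631, 382657714285, 6531079593, 7025572753907, 108647935, 2254921178195, 26611785574325,
108644719, 3506561843811, 9393021985593, 97010087, 967107801, 814742208665, 4058699150867,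
2308618327, 108635335, 108637389, 558701866215627, 6389254182595, 8643446021067, 543249077,
757855707, 191617641399952189422024, 153052311, 4064454745, 459162447, 11933852985, 459160005,
1377494779, 9264980759297, 9265013795655, 3213942265, 9264980759269, 1440859843493,
102237225077665, 12174295775299, 3172198612327067, 290313971984175, 5297846041675]]

noncomputable def edges6 : List (List ℕ) := [
[66637343, 1728759376692528, 20476402441012948, 814648140692500, 15705556694014912,
59598832445870056, 53507791778914835, 79765276667829416, 1954607794162627742, 81926888450233100,
6226436105694184852, 1062304614798977424, 5376655512527849007, 2675319133121404255,
2322428211525563914008, 4378232439256516834818, 11157821580982525598690, 620575567914845229437034,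
4717834394004850528, 519134820226464644080, 1473900554190983696634, 4791341886053073395716,
4680979752296357797450374, 1638051665133376643273348, 5597334221604621034534,
120004492744984286202704, 5168226413435121898076, 2163557184754620578018584,
3437405691191026675527, 1773585600448259619535561, 2008793364470883013898425,
946112161455783497827591, 1007073208726782807714210, 1240056060150068984755106,
7621356547485347122878, 2023840006255266504383264, 863480393921060724161,
2150515804853397544385596, 201467424770605743161550, 7727074365963859992578,
18588747432487969702350098, 1141862221339831749877457, 1761022238044511385513,
145082859674410950003292, 2203464126986659704300790, 84955152933362288883495822,
2232692721131147555091810, 35705830539370669817114, 2291904371947128544246126,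
219964336595097244223374, 7598344691453985184968, 1634512325428642750526962,
203214551868283770664332202, 84964065302078319625582, 113287417661875993054058,
19045307052318718290287446107, 85482124228812575579471, 113287452771285981031394,
936671811594438928015551, 7555687361658193736106, 303675251067259610664, 704425066777111136293119,
1242479987295652485446094, 1029301155192644640820587, 409466479915319285139720,
56607944493210124738962505528, 637241870623198432230057, 1128958683531361185216535,
203214499538283036241242490, 1289303307629094779416, 1275069599447972841206318,
2282076266977239127973254, 936671811594443268382304, 18663755169446718307611304,
282845303341043407743704567, 5795981849113581864957247965, 85287947938450436335,
4371335658315011760648116133, 43127226007028984492151626, 31669804945078533210238166167,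
141559293237245689002905517, 7865650309622971721302995729, 49116466693995434369944349913,
33067386027395855153768991846, 7231296992808181612623079093892, 1972734508166582345155212769,
6010027032579566129283709062, 45961664107784663676768866548, 2519854665609995146902885833,
33067352071813358440850156646, 1993702798529178302622343337, 4366121331796026139953982208,
6447019895949942341997036572, 6797746740643029727978136136264, 18893602806679458394943047256,
489149536091745109165217180357, 182384954068142079425011565, 1982829857595458816673631681,
4591631063615193457147289430, 2092000847160846475200397097, 28642201095952951199140772,
1480228618864198343488146470050, 161110088761054266693434349, 2184062004852018224457181377,
27944870156007407016854858293, 1597433446328933533377958095762, 9734120357931465304812948,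
118841405817308464877189240, 12991300922086455731261065941, 29393902673491059770430122339,
29592840604457850016830653427, 152999094021226455145170536, 31655680602586901967101643009,
7201331487854201020857449710122, 6010564139803858899048557250, 29363680168018686033271955493,
22379311038674679499296508709, 31655240462463957477626265376, 7308785290635055582917326462129,
31655683851391029318739246990, 37449771707728920302276278683, 11357709316891941374051786582,
38213558249322024232510890230, 48682383503951685137018142269, 7231599052074097469288610452,
5968935429987238964971030310, 794624923224656086914929, 33469504489391027473381442861,
18191062959140628265934632689, 37440860600098848569220855751, 8419496883922965341011043,
13432318013968505063023211785, 296000042350567854946509, 37440859376142056559824531677,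
3278334166028950676905904937, 10043112130111785692759141255556, 491752385049910103561400732025,
489232888942482021108777883034, 45255232429878794258863768622, 10625749321427078128498047773733,
6591012840506602151402848391, 6620832058510721223542129819, 8879159165998504087297079259878,
315936507770820364489555889592, 33469504489406615408029201709, 22489030650598707285135225353,
182247206956361871035218005, 18226968730626054831535882416, 4602424947291767807546898213,
33469504489434301382032266029, 1141301059042246840580983519013, 44314386812983275593511895762,
1030676770288813748209309050746, 18188611503042138481293705271, 1209037029946516040999650663,
18203192249060013476863928954, 288669973439051684918246338710957,
2230622848051546160623575446629679, 11371435229084065548036006764998,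
1097414651652163237364141433981, 53819387151291460219738198921, 26653927819660627288709921630,
4517352010536351349058436597797, 605673359672645643521863027000, 10989920236681567848813813675936,
599134410228341559258464461880, 4497207887095044545764756992454,
2069446816498610004806441694552539, 2819301075756958682721527892013,
404366783573713629445241086989545, 9041812227676355111302682199626,
8367452663870997686771376307601, 26537238816059992674585638996, 7826160839125433851320971566473,
6566271802192650349280104914, 4305141594147184306528641130422, 13265906671384085203073053959856,
431127003221198570709489, 311559508909535584989684403304330, 1337502922613425774389569556640,
962290290022378081955260956683, 22067755957536241151770031825155, 1243476277451150765134184735818,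
48838291217024674846699988852, 482340883531657829269335729837199, 3528408686468969506955723710579,
139720553471454713941693002315775, 11333234429585990826644820555863, 78715078789528512470107583789,
683490288109832670912204142934235, 967039791733043929401870477122591,
669597318715897666141274067325903, 667394651238848303146760373915034,
817970848864720657188689306348570, 1343100961004275105934805781319,
2956305214896071342708947572666, 66550139052184453612291492625, 708367197118146186880696802509895,
459777435191203529788602365351055, 1339418067667043405839467168915,
59545498859413552853874056834902, 2082932832880060799480067434258,
1122600495188039967470571466397159, 1337490914310719453511150756279,
1343043139845242353025693023747, 1349793423673531219507137367248,
350389162574684737933047186328699, 706690389892339894704323898171,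
115686177309099549433570690132551, 11330834918636683302326261429786,
310331683051752715239637850309605, 157012862772614776302219643826451167,
498707639594601322965848472146, 875673347092844566019817676036785,
28254934484227547557614529501132, 48903044739048290591105415869, 1337486944453270827375618053382,
330062334035681086667327504632615, 112940480692002344194055542759973,
964656997359500976268077807606535, 708171937362376727765598069127,
95979723429894183569469359288477, 498699508437464421370115316546,
417908776093003271335955602477415, 4170080098250366598624343497167, 24952757351540909262857795,
1459049004314460021202902312279, 522106250113129368453707903281395,
1459048552507971962940694324646, 14318624300527390514959928943, 3945252718746616910771880050847315,
3912637958202630038140244092973, 2583030199284163512345865108434, 7838750886723413033146982099,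
83551868504198819574480217875, 2763426364796945648865870876072, 760778996309156832760765010421,
1329883980547745032597691264422, 78090432455503377225115898130, 855542029300767831066173847332,
76709757972386091089240157302, 2314065519372080840037621722424, 841413302537141192741684084,
121072795408679261258113809202, 3912121340367472117709249331854, 1253908147429388073499558347287,
35565231245169892757647140903]]

noncomputable def sizes7 : List ℕ := [1, 0, 0, 0, 0, 0, 4, 29, 125, 257, 352, 361, 286, 168, 62, 11, 1]

noncomputable def rows7 : List (List ℕ) := [
[94657861346, 288, 19949245346, 1280, 974873954, 75041499842, 10081634946, 15232, 142664706,
75873709090, 19949245570, 64888560962, 1888, 75041500130, 75873709442, 974874114, 70000703106,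
142664834, 15328, 64888561058, 59895291170, 79868328098, 1408, 142664770, 15456, 1728, 2208, 3040,
1472, 142775682, 77038803234, 3360, 11141524327, 143245314, 79868328706, 9195472549, 143245570,
75041501378, 325912994060037732, 6189318629, 22089227330, 79868315202, 74875073314, 974875298,
19949246882, 19949260802, 64888548226, 143355746, 142666018, 32092743691, 82950280369680900,
516502510535044, 79036105634, 412272189913006212, 412272189912923364, 59895306114, 44582641666,
808447330, 79036119522, 119814374274, 19949248354, 4192, 75041556706, 59229594690, 143107586,
17728, 64888563202, 75873710914, 94990760386, 142804130, 75041502658, 17984, 10081637762, 18144,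
59895306946, 59895293666, 143742978, 109994346562, 4064, 518420729258340, 143687170, 974876578,
974876802, 75873711906, 119814361666, 18016, 142969282, 143714786, 143962530, 75873710946, 17792,
143467426, 343267556319399780, 142722210, 109994347682, 143550306, 14956005218, 974876322, 4096,
278188175300244132, 142722274, 143687490, 4384, 4416, 27606261954, 1021667621, 142778082, 4480,
18912, 18944, 18496, 19328, 18336, 5088, 4832, 3139033986, 142997826, 4992, 79701928514, 18624,
144790882, 5248, 63057689506, 6016, 6336, 1397304406809, 3971270850, 19872, 3305145954, 6272,
20384, 19744, 39066587490, 20224, 5824, 5920, 1316065856823, 6976, 4672, 20032, 5632, 5536, 20192,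
94990760258, 2389231231, 19968, 6208, 19584, 6368, 7392, 7264, 94931759778, 6464, 7040, 7744,
131300314449, 7680, 7712, 95966140032828612, 415267903645589540, 82950280370923620,
421362631582745540, 82950280372083492, 113988911682, 647513, 591333, 1319005, 104002400610,
75041503618, 75873768162, 256495075865144228, 974891714, 110660129730, 19949263298, 78536851810,
3305013, 4303715074, 974877890, 653533, 1224739290107356060157830, 13790900994, 13790914786,
110660640226, 39564086491797828, 516812269104762948, 18784970402, 975581410, 5303179938,
256495075865144068, 74875061794, 109994348834, 143482370, 325913620274959908, 30110145281,
13534279584416196, 69882413186, 4636613506, 1972763, 977305506, 1982505, 13790902018,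
22217031913014084, 527048268768100, 539822223, 26678171, 104168884578, 145455298, 974892418,
3139699010, 145538466, 477766607529063396, 49260063, 4236637777808068, 2414253629, 41088455138,
13533680393734596, 108971880002, 64056355650, 111825650274, 143193282, 3970845474, 78869723106,
44583237314, 5897273, 22446457058, 82032392962, 145482594, 78088913873021979864294,
343267473610431876, 145483362, 17953367682, 145759298, 523933284800388, 1979513, 1982021,
82950280370813156, 106998919874, 79701876994, 83696838946, 498838585905439396, 1807666466,
4969496610, 517820732354308, 75017740610, 82950320316969060, 116652657954, 76040651650,
11104067778, 8134264226, 5944005, 21664, 4969485154, 113822457922, 107164852290, 614424347033,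
5933763, 895336511345, 108971879234, 110826518050, 168583931033, 207383207, 329632410299514628,
38899956031, 19949251586, 39922274594, 477966178, 26455167, 21728, 21792, 146008674, 32015929005,
4125867586, 21696, 143746978, 116985447554, 145926466, 45070564770, 96988066082, 19093278978,
44970529311, 59895297730, 166107199660705732, 59895311394, 47067867426, 278188175300796484,
80201258658, 3760719428763, 41753728162, 31433808514, 1482976880063, 145815650, 143747202,
44749680706, 143360322, 974935170, 78870109186, 123530709121, 147580098, 7968, 82533511682, 7904,
49079085058, 90187783746, 23446667138, 339731178625, 68550866562, 720437017837, 145954114, 22144,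
1080450901167, 27427798178, 8256, 75874419458, 8096, 8352, 11607707, 22613342946, 55236221634,
53239098466, 39424146498, 46912888130, 117485253666, 18118871957771, 220081502432513, 956929760337,
56046011533, 8192, 41088457890, 47055632930, 38393638538337, 148574498, 11295337346, 21888, 8064,
34097886466, 31410416354, 1952185, 41205467187, 37927646594, 27084900674, 974894818, 76872944034,
17454996130, 15409789559665, 3367126438603, 41089739458, 52239414274, 23136, 9088, 1042485754243,
23104, 3139921730, 8640, 22176, 22240, 1963973, 21952, 23040, 22208, 22464, 110995334050, 22848,
8384, 8704, 22528, 80869095746, 22272, 66321327147, 8512, 1981599961936165, 9344, 462729396509561,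
21920, 1190182910148567912346918, 9024, 5156745, 30020348482, 8864, 22656, 9120, 28119687328247,
47913026402, 23232, 23456, 31436470018, 23360, 23904, 23936, 23808, 10304, 9504, 22976,
104919377954, 58612670205749, 10176, 6713660999037913, 24128, 24416, 23872, 10944, 24800, 10784,
22944, 10816, 11040, 24864, 10080, 481278158191145, 25088, 25216, 11168, 11200, 24768, 25024,
11136, 1313305, 234801976430320324, 386653702445992740, 17870982064132644, 516502514870756,
3950621, 243479216205117668, 82950280373409060, 282286923711368080060614,
1413229763393911719443878, 1353403, 516502514815588, 82950280375121764, 358565171109908164,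
304116594153252836, 70714088258, 65387893730, 256495075868734308, 82950280384980164,
74280470563727044, 169722678121706852, 78002403401553604, 256495075868292964, 304116594153556388,
101172947938, 39425874370, 1312835, 256495075867297444, 74542195778, 108842601, 343267473613000164,
516812274729404036, 31270126786, 338929452916711492, 101672894114, 1331413, 1331905, 35262717794,
321574374176243300, 82950280375369796, 324466793259927588, 6776217, 74042856418, 321316855,
4037561, 12216273, 68878149, 43893588239, 4061719, 60229478818, 22965201,
1962993666216503836799078, 72059219, 82950280375701188, 4051439, 4473084514, 101863517840875012,
234193318535951204, 498849131664832324, 109480051, 4033469, 5136742018, 40089297506,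
2151484597222680227266694, 9193761702871300, 2358049785, 15788730946, 18786987874, 3126887,
443056330213774084, 347615321039228676, 71880422594, 338624944212736612, 53405776866, 22612847202,
12111085, 78872484514, 87192356642, 68550855042, 94515798690, 183385155461, 17122541634, 3767439,
35264787618, 93683589410, 4049069499765, 34931807554, 29515596009, 4969500546, 280725867558748164,
247457847894040100, 23313181603, 84529272866, 4033039, 30437904578, 19019361,
608337687812122120324934, 39193509739, 4073643, 10797738402, 952191131239, 8152223, 17620446818,
278188175304331300, 104002405154, 117484773986, 106833198626, 112490981186, 145956034, 96679542466,
22113797378, 75041522114, 499153880043340036, 161046277212704580, 12161423, 100340739138,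
145486722, 116985435906, 105833831554, 4059865, 69745344865, 54122734795, 55735343266, 93683575682,
1352707, 30437918594, 161052868310312644, 8134695586, 27643101, 4063941, 195450487930290436,
318735648404088484, 102837891234, 1410780651, 30435670882, 4211718893, 36716653, 15790345602,
3461269488329, 4191357717941, 88524002146, 109742301, 24445570210, 492779401, 12215919,
60061756514, 1671383891145, 20637261091, 78372870050, 131657694387, 64546096381303, 78540070466,
867720289419, 130427542243187076, 6014068003, 45249808418, 20950029506, 73711050082, 79706004354,
94519411618, 143749730, 22449232610, 4192349190017, 4969557378, 264915981856300132, 40064942082,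
9963323010, 329633129331038916, 24458915, 890284111389, 26444596738, 28771265218, 112324553346,
86193842503, 12236467, 98013299042, 112824610786, 4072237, 329634826477615876, 242652812405704196,
24446535650, 648858427079, 77041639266, 65389190722, 3141965282, 5317885858, 10397907341213,
19782813762, 78371435682, 1428941809109682156169158, 3852961124113, 1412778749, 2592267927,
59895300578, 89854861378, 6981455221255, 48910193730, 12230825, 981061090, 82277220465,
36072626972929, 282064962529, 96679543938, 32766573922, 55900749858, 2665725695481, 145625186,
26445533794, 12650998205427, 69885164034, 114820873215927620, 161279458, 3973651842, 36704933,
206887003781, 975973122, 1248430623245, 345691887411, 24114136194, 1342011, 110827970338,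
93519383682, 505244076282097700, 13623961882071, 56734367234, 216206073, 1354108242676183,
41756391650, 281441033, 13586823447, 5585108622357, 5452468053095, 924720236224491,
1202748959010056068459878, 78039834818, 57693261405635, 330076701, 8457087233867325, 117152596034,
6282983478123, 110122515, 42918286434, 7172294697095, 40920998914, 53909310178, 46048599842,
81036299778, 319469323, 81866219650, 59039327682, 106068209, 95019138754, 109675467, 48911228226,
104505911042, 36697741, 58774295113, 12005983818217, 44584931239397, 3173933762949, 36683943,
82533517282, 280617643, 17453937346, 376532346648602348852550, 13558157563547, 110128805,
69114442050995, 719783226947, 2606970297, 36686567, 1206622831779, 76045829794, 120040163293,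
99014805922, 11616, 11615821024667, 253829047, 762874175911, 26256197501487, 40755880898,
50075300866, 287588839127320196, 138859873542735, 25376, 1290892338031, 2934638362835787,
151749986, 57401170306, 26502563496840292, 496214193181315, 292851831, 1409313011499,
81517789528513, 2095494397189, 59986210803221, 110137017, 60061812226, 2284849434491,
327170583863495, 867476215, 2962049894313987, 28605115842, 3022204836616581, 23229061741083,
37000237288541707, 16125037666, 114436477937717, 53315896758067, 101991391, 4916348316208060975,
25504, 25824, 94007124738, 12224, 25728, 12049659331502339, 25760, 25632, 12128, 25440,
8826760257002667, 26048, 533608089120905369257062, 26432, 1172642014928755, 256138007, 26304,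
26528, 12000, 26496, 12768, 25536, 25792, 26464, 11808, 12608, 12160, 25984, 26336, 11904,
12008815858577, 87038078996434052, 26144, 12032, 26080, 26944, 26624, 7999734786981, 13120, 26912,
12480, 55817904441, 435931667, 232164511, 149947829, 5563801, 516502530390948, 186757750883,
12610943, 2088655542407609735507238, 282492781, 15747936599, 5526601, 480984041742813988, 11165669,
234811203970959524, 494499610515759012, 33272983831, 1972418170372910863233030, 21828038935,
1805492264912361883867910, 80076322107985828, 5513618929367, 110481897810712996, 87121893,
253274843, 434945665, 377985660253157156, 909595089, 123423613331, 784832796649, 50281189,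
4311541863063, 32515820071, 1345373663, 1416371347267808598961350, 1467786720478328566963302,
101172951586, 150829237, 196441195077, 150829947, 177782128956126372, 698513267, 60394683106,
70842853611, 80589037864323, 110845101922, 150842619, 125835740485, 36998587084865700, 6676667863,
12195693473, 149898805, 44597090506801, 16701375, 6085200901685403953619903712584, 16706193,
102838763138, 1301148763, 1305690687, 4956576241503, 16740689, 421834194654881252, 16701279,
16700561, 469559014236183108, 383145977729, 232317687745, 495135108146350244, 4869321406927,
460340741823511, 9996157780399, 60063054466, 452626299, 5528235, 171897166476984164,
13975400385707, 26192554201584708, 114820873217529348, 338072526103, 138411719,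
1488630542975928148108518, 116941292934242052, 11769088201, 687152012125668, 38760014050, 16429103,
735576951, 45153301039, 110660868386, 37699773, 16751387, 138429267, 480769691300236964,
31935897954, 19038414057585, 83036375042, 29545560046264292, 2039541284767261884581190, 5567041,
2975525346, 77041627298, 117348629, 1069032721256722152145478, 46168196694537, 103037989459,
1101765945363, 50290519, 34828547863825, 180755190274855, 50264517, 358565245110959524,
328310111521, 36461214885, 50256773, 25052416314651, 85530176066, 96149376448169540, 50247597,
127543024636059321, 2811538309071, 5586831, 50082510802203, 102507700514, 95683087970,
35076621998423397, 16737367, 12204982187, 79871249634, 49622570693079, 94518008482,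
1097364981372047, 338624944217265636, 99675995842, 418511575, 6955484579215, 40255756674,
8390623294451, 112493756642, 30120815906, 7389449283089, 1253589055, 102339065730, 44424049732759,
39721941769, 45148484110567716, 54747160243, 1349800097, 3973652930, 34599478530, 25816463777771,
49578721058, 318285798025566852, 145503746, 96347365346, 79038943170, 6867956020521, 11502635381,
452628553, 1201284927, 34763658690, 11281072479, 10435525169057, 212090683993193764,
2587757134625645, 32804977121, 20244192233, 33621703713, 35265204866, 30938364098, 45588034274,
14608998711691, 18551401599, 16756437, 1472703364526993143949606, 57348831511115364, 9132121533293,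
4005291695, 1357741631, 1355355327, 385564405, 1204606174333595, 3971477073, 811271874,
98861288738, 646712526193953501126470, 1252374568594367047, 2240902839, 324870706656057,
36612082081, 9954256283, 452609509, 452638373, 2866363837, 102341272194, 13797639618],
[1357954143, 160323875787600036, 1256112385, 71974966186541, 73546110004345, 112497039170,
17623263938, 2115716493545, 3123839167, 260215830313740100, 22170164528913, 6173193727887,
1357300927, 414140499, 1253589157, 1883919120813, 4070812931, 1238577724138119, 3539098036480100,
56366576830275, 3737709214042807460174088569544, 1056172723, 1710017837, 50865295109933,
6319743063, 68052250626, 14127736578, 32092686553491, 185930888304429, 239569816954541, 1357321431,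
8610281224141, 2263223021, 3738592301, 12188232923, 9914585661117, 5884529405, 279313357670873,
28685412716741, 18458011938, 57136291149194909, 1199449572543127, 9914585454141,
199995780950904155885, 195093353870160420, 208914548512667, 452637163, 11734613271,
1234188470009628118107430, 30605330553, 5415911896940731, 77449517551083, 6137411490, 10762582107,
149618877, 50136788309, 100392871479481, 7042429552113, 66890536642, 12220968575807385,
13126438306, 21162461591, 2310365538, 1356666109, 4155887426, 83702584802, 76212714818, 1356721031,
15625107906, 3905519401, 1406974477916704722603142, 20360477432913, 17475759830589,
73776782930127335, 803908811011, 2387304893059, 330722889528669, 106833203394, 42874061944537571,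
4263726082, 60236600674, 11634901445, 348336991, 10841415926383367, 3768397009, 54407383522,
3565714636179, 3570912317, 294887144970039, 3166681181, 7340767941743906141, 974004856602203,
537496001424462033, 1352325299, 37986527979004753, 4823227298, 13625060482, 110827987458,
29841449752956651, 10154764064790071015, 47131698694433067, 71976777834797, 400191367087015841,
529510622245370003, 4055857087, 6329711067, 11969374807, 11881406425, 2604829331367201235139,
451401813, 2417180222851, 195093353869967332, 6471426018, 3016453277, 81866222018,
32028429116136949, 84499495961261, 11304807191, 10694195675, 95311527874422317, 31916703821606071,
7978050361, 4023550559, 23479277104347, 1673378027233491, 50198551552237021, 1357913727,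
25559650385759, 9915892982813, 31385136188690876269, 36740374996551845, 32767632277640571,
1357913701, 1357966533, 56734370338, 525179894040309997, 9169645361773131, 4035969259, 20451066626,
13280, 507489353554503143, 2973250978, 11551109433, 1346742049, 12215883183, 4335716477871619,
1411096472814875, 567163821811461037243, 12188166681, 569403086790375939643, 20340918347,
36553105547, 3695776193983976170668620319624, 8432704137286169521715915099016, 88526558146,
6971035022750220771, 13344, 27104, 27360, 27296, 27328, 27264, 27168, 13440, 27392, 13664,
464163693, 1070441575, 17168549, 28084984956661, 1288897851, 464188259, 2163795853, 1100136048051,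
27261912589, 112710044299384356, 108758733859, 1392671591, 6473684861, 635558418492373, 4020447287,
4178066727, 168516435032205, 349572399, 25530754893, 18122138269, 17174529, 980762531909,
10619241331, 20712671233, 459102827, 23186613827, 507533358953, 1043063635, 70854982797,
111190936445691183, 154232699671, 1392637689, 260946283678535972, 303645170937, 281793135085247,
1423088600172381, 1392632635, 4023262791, 656419307522922546266790, 51567063,
1139559232414799806103846, 7279318718248445, 25140990076089, 31084177955935, 1002857437437,
277071772704377219, 18827053723, 332446548422096991, 38900757274850043, 12528479109, 337856400199,
23186603811, 854115903863201927989446, 2318148194357753, 115862178471873173, 839029265033,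
87275288296251, 29478172442085959, 194848642271, 37550386913, 211462803731, 1235204418772561,
105969783143, 88029646210, 37104060009, 3053326568744292, 1392682543, 2943681036127, 6509434641933,
1199901564177969, 549800741220450145, 253589955485, 97087174730195, 335997290411, 4071034877,
4177606325, 12431010571, 1445906430992745, 3676845191378233649, 549060988194444729, 56925754187,
464216021, 1575089238272438149875526, 9361664461641, 4017154428231, 265086934001820989, 3829083521,
12075226767, 399758794540475, 38552106028613, 130166236100595, 1963693346061,
2198003242023408226706310, 1625125546027354773266822, 337701657009, 37499467091, 31361308719,
253573438643, 23210282685171792887, 2426183088208677, 25728741128772767, 56624333575, 333729881535,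
3237719917, 172626729887, 12219845075735292813, 12379436791, 464181477, 4178057563, 4126433219,
12533887149, 37177188365, 14174794355354161, 42827624849048141, 464182197, 84640137031,
39717121043, 336564656809, 40590876130, 23209569873, 61282182367, 276587901960650177, 99138022761,
37601944971, 979541329745459283, 7603719965642631, 325060758010192785, 117118345467677735,
37138087629, 12534197367, 36672883431, 112750383675, 37601945673, 34778560721, 12530326109,
12534209639, 132150495251, 36173427739667, 3318407160319783, 12534187281, 16378861624043669,
7431597521927327, 86529174021685003, 37602582401, 98723694295, 6433957593111543087, 83363660898,
6694534201077111, 331112347009223527, 45748330440611, 2275838180041574465, 20908912635822712423,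
37602620765, 14643283170, 90672497747981, 12534209803, 107999358221, 1755002293651891,
907993718819099, 112732718019, 18125128770, 30938365666, 94352064610, 84643347019,
11787478925338133, 12534159195, 36670342819, 631505689411369, 659928685783, 12534079157,
9483599426, 742084004631, 12224659571, 1594830593127710782524678, 84535429410, 332222431116033,
45100584578, 1192949305550639, 95485325992877, 267204355349545, 674371852599366557541510,
57599149659743621, 239453578562508755904518, 127617784749219, 54587770178, 253715825757,
36673714527, 30677459489762163909, 15789598450571647, 382769647787665, 32676488443441393,
37568206089],
[98869506489, 37584745811, 4178005065, 107237099395, 68887109026, 98875237725, 38261821218,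
63060995938, 18970771490, 3927973060613665749, 299381278775, 12534187493, 100117002635,
751020804103367, 7503189001284506997, 108612529727, 34817243237, 33424507403, 37602629501,
3446812565982639428885, 98869506503, 195004399349249, 104141849449, 80456700413370611,
998504551469, 107236896671, 938347658029, 338400087867, 12534181059, 238475919684301, 12534179549,
12534149249, 168535012522383, 3475971290194046521, 104138453095, 37585317661, 30120817250,
11132033218, 2381819908610870633, 37602581897, 305031311403460650671, 33213166261157413,
28729699117950833, 678877793143831, 12534155715, 28655112214051073, 44602831298, 337489604153,
33424564487, 56698924273953851333, 40986873072075, 325677021383, 14881054050173834099,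
7682204506580881298042888397576, 13443679162865744319, 300803269271, 23226134769864661,
87986904596287807, 185140605848135579, 12534186161, 514786141617432616315494, 2310380290,
337492434393, 37292677417, 79722062978, 25695134320517, 14023580528652696947, 108505308590743553,
53626812738, 15266671535393, 37602637679, 9410361179398585715, 108370760823565, 6139205282,
169743528441352499, 4049620292552713537, 3708535241994671, 313338115535, 5761717986, 95849572770,
112807869445, 87106074431687417, 338385527267, 79389179330, 112807471769, 108370806731101,
238438317045227, 729976283559191478735686, 344933032716334951921, 1488787814173506991,
112498402447, 335636871299, 6470296034, 12145083362, 135712038185, 505206760931, 268109613207,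
9930125933, 3310011293, 89369093567, 9930125361, 2167744971643, 2020910176191, 29790402949,
28727963347, 89330488125, 1126746597385, 29790415529, 1254317714739738369, 1103312025,
1197603194143, 6341643769171, 330576528750240361, 268112061399, 268114064517, 28727964603,
3092912304565793, 1804794745085, 89371367243, 2266748474087, 29790441855, 13747101680881821,
268114065079, 217469271387479, 225065183435, 6382791518201, 448220559347860805, 28770639297215927,
52366736907494405, 21716016787051, 268031345419, 1327188033455, 29790445353, 268100453243,
89371327235, 774537721775, 268111056979, 237955867965, 59802556226451147, 480996589158323,
162647489341569165, 618216658677, 82751250981, 208533147731, 86061274267, 29790405307,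
18546187341703991, 268086690401, 69511040571, 6999960535995, 268114064541, 29790429347,
3038798705476293, 5473984383799, 257938716017, 89371327249, 764621676159, 2403415775135,
267296796733, 268113878127, 5818590343808737, 267868919151, 7148470070875, 89371324451,
470767892379556397, 1510435735398983, 44949846067218869, 804204575031, 268086814541,
19469190343711089, 804342322813, 6437667111681, 1154808658058760728778900392904, 5818552809720053,
29790424805, 257925772590345, 268109534367, 1995960549563, 268072715343, 1338951891094163,
166815574476778741, 29790404279, 804080467047, 286866681252217499371, 5872235229336001,
7232420040941, 137643755832974749, 45587004115627, 268114078319, 1390439775821163, 268114064595,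
94599982509509151, 101502222779159649, 774184075949, 89371317639, 446856801967, 238323621693,
692333626103355133, 12822268572328349, 32262515192863, 89330479765, 696966637771537751,
1668265547691, 711293095349, 1545849886579489, 89371363381, 8873556427547586301, 2411882727163,
2333582720289, 5431761988649, 265898276385, 268114103575, 7238534049471, 773773971117853,
2547205235085817713, 6384866479552891, 580003926279238233, 2323274119207, 2413008800065,
2144540512611, 804342299441, 10351618050954635, 566793097392533, 267746396024952354127,
268114069253, 24676512911139499659, 139012141147046491, 804328678517, 1522568046371166549,
13594795441378965, 267010738593, 271591332565339179107, 804342278363, 57376419579561,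
7238575250579, 19492152906359, 971240348235028275, 3374377636893110821311365102120, 265825674231,
2412889076761, 258711596643550631, 718993804367011103, 19441265652703420252717697173867731050,
268114087031, 268114098517, 804341295831, 2413010157721, 804328696935, 802135604339, 268114057425,
797722186825, 804342310505, 21637057042029, 21637066124233, 835077025785247885, 24343599384114743,
250972770852477733, 285139030487187064127, 4825686186909, 979688958548225,
35154525939277596736141825561734369642, 804342310745, 12756787445151, 6606294167561, 1417442427075,
52497836187, 1417441091847, 28817002650261, 2453357136477, 4252295273873, 1399943108607,
114773457948071, 771771731372856595, 31889580832495725, 12755037483563, 112745721617776981,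
258442628074279, 255098786870287, 1413553666925, 17499266823, 705525656265282307, 4252087218321,
1415498059957, 472480794281, 472480793945, 5581256115498859031, 4236772353463],
[1411609306187, 12401162949219, 86302143781961, 26512006199433263481, 551331242084916065,
1412112633347, 472480794639, 4252327285603, 221026207788561871, 86148936349543, 12739461217145,
12756981843677, 29707527934007, 11322039252455, 5357798600005470181, 8167297443282163,
1400159176693, 4252327260457, 267756608772647, 13505769815832485259, 49010586050272033,
80853278559115907, 89834666198704995, 31050493843579477, 114357849889433, 12756981849459,
12756981835015, 12756981849445, 4252327260551, 12756981849443, 334988461782713, 113389561222049,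
4252327283755, 4252327283437, 4252327280133, 4252327256587, 218065007179499341, 91380798642995559,
127114212118271, 381342636357913, 42371404031051, 1059220520302841, 381342636358677,
381342636368103, 381226391078533, 1144027909102187, 195772919973622690939, 72073745351608517,
3429032178585514441155693]]

noncomputable def edges7 : List (List ℕ) := [
[696604243990724024, 42801552779313775073537825, 45239317189740642178175722,
123257606870930677337142097, 7881210992004481161400618435329, 10080321590611862627071233812315,
8268073063436182501183167453736, 13374919893950510373978444049452,
3412334460632814855696158337982988, 117759152346501241625452220149481074,
124302653068312042871890788484583701, 119969370731393767639125944070254823,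
125841886977206371900258885339334104, 111467601591962095609341234966395573,
170499943288994349378204453146688638, 299216470792463844727429792006793313574,
133100155238834522733439883033730752, 1222509957804915091142299922644328146070866651,
420697260563557790296887390449013200883954, 234788673759709335814162065645598025493,
209559814482106348493984568418501394237, 160584159520470036417038388042289625,
133395324984798672450675306522939712, 123763228435557469851706533271905515,
251579121463824398492112150125666915865, 1180207386505284761149640306545033785549077,
162337282168384989967623865755042825, 541434323015232830762016404610145460321382,
154410779990139917517861957962090870340193, 424142035390665031872404997596989534446761,
113548702655821451778037578302659537, 252680411714927310224556785948565436043,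
231251591987695473191107706983256973196, 195077079863068738617728440788444119407,
468811774975858669502860794712144642014184, 442308432210460224973752558168906897049857,
244962613074565726834837011050231675296, 336049890836430962967809793917528632480,
1177817868399645351032126597192375713281103, 436651945289082415488121139324368366022240,
422326546448961644388777378335667033633629, 150661175180657530264860140624034138,
736966137249773954603463497096873918086494700, 850381452402908109857617651611025671708,
202359256044274980405530258021206487203, 1159005115196507353105491596847917881909900,
485217517868056164697039276659429274020678, 792674517943283600977529006527837867473281440,
414744510851222870827632914708403702256079, 721902484634440094307855093687514066499,
2095727183421771874096747220335218854306190122, 216265544812250048289479665246775955519188,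
440482237492510969659945124824759303927192, 656613443143687663566301329851650445201377800,
878256867728426389199261035459791482519806508, 717751399085230637882954460919108207135544684,
1632707101533907660339003355051238280997677888, 1184610978186783168838037246443483368329501,
1755479314376809894571720229531790107598061180638, 770255846863363861226814536001214271455688900,
1450043354355363376582392662865908946566368, 1076349970696753618590378519267404582559111,
1447210336172365505743192109357889954081605, 5283824158808428992601835933173482780284062028,
1214062290983488141017402200425699637156178, 1072647590433729693452799673905487463034734,
1102684013488803892776299716859860991347502, 1602084124847040217051041176285052323940573,
1070885867228759239781995858993374595656009, 19586530699706196100685333250009192209609954446104309,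
5637437387011345858505923916138971320889315179, 16480654823467333689893690401255929845191205325283,
4365444725352042502194447013060996184253306153,
104522046443438322609244163873605524777753360098940873,
3867321896182431441051238644537930253408317587, 5850831580654494370705956245111340798198589947,
105483064491006770524872729193145193914859355170293644,
4101201964155730684564293066376093314300898472, 5500659736265447194876873396914853961983887893,
5212934261262078804420916299198143981093909918, 5252480590685863708535143344884354981799656889,
4290363520759029410944954468606303448160732470, 16439680360341501479574949015660633089020960498057,
14159288129642408844930767176644054065116516353, 9075615424192806244893649920775042031166026119,
4482690142407659906487877909879088858822693150, 14250153421835392069339333827187284015525436928953,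
2855613424953095723172656074107706751420572, 7700213687322953736546352177923361381419857372,
14396249861677690100818579491977567675992416923648,
19985494192952384499076322410546279015913761254745,
52980332193594667069726203556069506884392101040361286,
4808157341112832350752389838103032256654373808, 4491874972610573873904612597093793217793398029,
17881413217944603088777524662788750617714921758, 4464707026767363698894600749375909136836781366,
5160409954606302462008705022737923162989259527, 12894300489523242223885326719773210995618770137,
13947184728905815729850212328785704893204200813759,
18675021273100326595221209071010169782080800057519,
18737815574511689506989759351449591430751517078343,
51928347344696607852489766779102846482852844084931304,
184784018029445184184421180224426382944683390197091768,
37488718393913343858783398122197685618558385701036,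
19931145359375753223243134394737402868673049467017, 4952356646835061781116431231998850339210946896,
17510241672822668776347870107029382560135457611412, 5505704390260474231277674743614087279208299143,
28062476444707255459312504354153141910026459144158,
10314456587093025821491956028364188818101698637, 4868583745926184801104626004315416378867495751,
59913271021628443856184911581335842693288099230679512,
22219772828448146493178506877532987898258115546137,
10314456587093025821491956028474875472302904601,
18728504778269355631856998235892131869388218217877, 6204551879855890437307024795112841311215152113,
51043602787052497911003499683935554696883984668980891,
17620345716713728995187581328279943235760697712237, 4945538189861084810653179883801826144752790893,
1431415191215559882838409643281034527682969, 52886543166518451509670745686137222956072278565646518,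
15265321449347712784949452731276122037887469609229,
20769309463479443487882058411488242674559680178667,
17471482448661189287316770256099167736595726588004,
17549299640459392807679444189276354732926789749471,
15839137747703883459767634402840209970176271020260, 1203154194002676153556854937349389510003589,
22190433246599387396995933156918237879659847416828,
14986661270034134041635635235860792315124736072964, 4778568759600726337384652352605794237280961520,
14785636643991908693071997020428840521847671203976,
22261639170615687520187967199161527188547895566509,
54437896748381886228190280278952037631107568491801138,
4099161353387915114143871044393677834041696688, 21649746266204588587492899770838103950083088846584,
6220800326983480544332800911731792700308546539, 497639088688093093425254222896351142030504458609,
241986249108094182317858974432923299370062453667017340034,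
6135498327067834586978713229432643387726944586296,
64062721081976596341016985571180679273990804303940874,
46556690243271781877477580398097691544253074658692, 1297325249627266158797159365714534364141010846,
3911826020131961676142390773662099162396194619, 133186756040425963593181545893962410540390993,
55795188418224028510711346758293424131898014460362963,
480947640272902544062139707207268356199674501784, 14798420931447529234556551859236391591652701,
19868383024060559754461136976634182956820531489256,
1737617169586604427377222081860664693159982940167226,
5372518907662753505242683000543485792306295560, 32404689215580510631236868008919454026515675774379,
15671065798014962653156749606286612548469851425,
22825566976345788013868914789573308311532986142228,
4828427660058608266244669000894957632284274780874,
22611720491293527432996145391880271819486329833589, 14799370233273208022348842245339686454947847,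
51928358859586369997616441977676577229027795543738312,
247185822904541529028375894010332233911157904007470499180,
14378888025407186698291468498876860270556625779126, 5686296267662336933119283968908422275825754015,
63300017675297899388485246244988785776970765866587804,
241986286905851137993528965284464245729033221315962212686,
4828476967927258205267390552560186359249764705123,
59706265004544308418855704580614951230951660361807287,
18097634239762080799811521150901891869919329189925,
48110248667810866427339725581907113298501785090294,
55217392863097874195123184590857742351094339007219045,
268510990972225545653751732360788557259251954122096060327,
21756795507134956004186545293173693617350600763907,
215741221381865699818966039654220111317682593542772696431,
6276274884608047278442272524111242080578933999138111700,
7901105970265550141217241150132378084180799713394,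
15070663461652469582853500725657352873337309113667,
22141853962816839219618384243712479193025265084203066,
46551601006715078683131448968600340851308842282114,
16797112455341397104635101974304573299241873436106,
361937871810754313241844526860475582923455977475443725024,
65176050042132950478977898988804386913193788325871585,
14661157537618553725284477376503913817965322524323,
271099559927635040425685770395324640772197588116748159701,
485302257701561012778090075521023944649041716186, 5204959721490025656947041273751470581842533471,
50418277160050343816420562688892119446547319117867922,
51976508120532101745186551905388287144461516210828038,
51945285657292224839305059401898396600207358155195415,
46086894120705389456261334723430839084304755466929,
612936413066012274325161809201638072645386870203788762617,
728994218531938609122518701168950796422486265381417834832,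
65432886268111183746363641672027875827341954698963886,
228639663842885139600694509131853047003339573094427448988,
105261997127465678924085687471124215519607971227396217,
66981818124071223500920256619981025805915904415874628,
70865082133308803596576137490290141686577362936629188,
228639663842882703922171853829082576584442212438627190392,
14876594625925934600060107220917616022162349898812058565,
424161545184635366924045300998519579428157029371172232803,
235644485852192142353773556656953542795923407677015993582,
237469846073502221360337864721586918201232980448170596689,
32240543933695068100078048848411719065130591261842970,
24004766007405854987392054227393051865345576827058849,
675356763732816669904849180079308102663740946599, 228237131293533419219170675932864086634436182762,
2277620822784067969458428097929118399866790782103048,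
1520920309742546673566076093268893601356345065185248,
1269942923924897204689441855548723171955329875875674158430,
14673897498851958795099816057963762328965470733101183645,
2601002145463159871593201423525835052920534624047453,
56183561225880948999426929013235580585706381684971032701920,
3337621114739524988377616265704517674695052969373374,
30380905787652481972445479849870296101877404752873342532383,
1225127213208659944068143698964545293580271215692647,
2967949768442057944417005043255376553463678243674322,
2967949768442057944417051913819004563257056965637970,
3337621114723917448041449357997841071995134178006772,
12851542930374309795664253641450606872709438359128133279,
1596509830821854077449665992737039413606650767340208,
5888865902218618375219801118978305374504866266525198375,
7889742158960762319547158653178813304034427168244307797,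
904080314511406738531412615938860971631117743282096,
6128972544744989456896408225320271315093332639343543152,
1314552569679281413671673632129477098649636471356079,
131420344596206757089643946772809194414305140810275,
2968334140087698544324906958403939173576413611517234,
6298224712667193293268075622545534900013732495466549915,
1630476081437875769203583898105929886702048235531846,
8010741680123054192872565113900713194813779504326956151,
1498287482948724569814660085742391557490052594966641,
1498287664871090126342266694136880493309405408699198,
7884382356287275612596260370383963510842522060709256697,
7503017034010347942545948078479312957877107245294917534,
1770630841176150969447331167459319344651505196627938,
2966900969256494694511789672771203725686121298122578,
1634270365429967010276776449494884778625808151790248,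
5900890753344577103216642873215092557529174108299553018,
14683158869226952894753602881851345136110432423869367712,
38373929236351701335503503834285991298174894352001432024525,
7925851373928845621216955195369711302274503025219117597,
3509638009338579977035404916624388581928716837884225207521,
7503592588628978973274161957736335788724023533991434954,
12126862875626592810831582509902773901857730706753601345,
5640974270647645260068115846782860296432870082971223371,
9092757321861670420060805041804233308911016896990119134778,
8411396221004354242319622061445073101118546734075232901,
99680774548003144005580475196460581047751918282957577932201,
6355259135462050857420527163432191126443607305391311108,
7731100876084768898568274865489264637813144870837670402,
12968841835773523417912827258143569252080559406214501095,
14667607755640643954778689625868805296913352950049972794,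
148946029346639432335085123466429810745035923530081,
1780484249159611165435977530263413537740853273381383,
112745623932875672213817519217672187786910846176752057911847,
5672493483665120082176099011562707246714998132164656704,
8010741178168917285076098629526731513134186732629079654,
7404650057462677495469761260298616076985101153126913841,
6770267791205955606549231266193134662324600560931947699,
6594023273868169610886311246410329502772701496958879911,
14644281179749902540209217899365311801791642131803265841,
23978241668563809010069032703960708033529836447536711383,
5982340726378301603156028646947186300383026671905530993,
3976276679711850152442301065677028610853036161441710716,
31971843465639849160799180083434621673205480154965180341451,
5952737485288864370705327309750727762159718533474561983,
426990387309061386721240525904629131631086191197924,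
785046104188938350887954186469703357335822952307965986746,
14747242569462671080509956541165830659157759528294750833,
29973659769935277634717928616661885889683953855731040677500,
1400518869448501517136969349147981253388795674732810,
6613864959684575020109069667581957218660162006723029610,
23830570540694774781650317173220427540123829622520607909,
14669489488950124037774385479325673373055104789393511875,
8441519114627946230271345755216154265059837622841344684,
581869288496392719757072366519332582943990415651350090598517722,
11007250322868239494042066898906811154685162611008036765,
19588125666151100515809216449765169929060282629008753936,
90854226086671979192189573319572988703984965008195974637836,
30286317036025747458672012154762027640511311447818433248377,
5574318537537819619075416073286329665227627696257542958,
7404536915530857552523500746252259741719668909038658720,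
1228514215532302249609021686548655179062313581118619,
90854107602505563761082031560964118169098546226670657884316,
63435405238647131641052804045202153908789485194441915124442,
108876212651074060010070850826322481753843716774934936,
1227449575593078172426465112750390011970332762317627,
1309407583130711625859956833280242016232925130054389,
186793778028193558901917280937576526758010173994460650860866783,
5610767566277183067727789691774543893990198400489328377,
149872483643588938283703261868057693078557880897133142784001066,
7446738853582095060059259558907777339152892220495648957,
29367145065734056812804090645706970117108820638375129771566,
500081660977638746571821623677907549026546415594664277,
7668924427446714611534169599561909896379087027832080650,
2981070822515907102239072259216602726196367229501426,
8061076005039024620707719979978427127141614285144911704,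
20287853888059652966503771774524248302458412714107996466,
37089062708639675302353356505042354575292843137677234142988,
11756999073630981441529460311303601893917671705244917151,
38565886277719207667337541242799696421996072282937400000079,
117778998304801906007619417027191079422332848786314985089414,
457455131363845301821565269553270223664467758559890493293166136,
27539117476158442174160641818420471935638523401603471726708,
8037300811262675305430208416526503733817598129036082156,
495451791761174867628667437188845351452120136513280948224326634,
97365995913539783286604683295040641441775169583367052063960,
69188292956342667578648744222163073731789508859178188709005,
53985923097259524902302387990123675034761749856947994023588,
6610533247166276356193036913719600853566938205652361478,
40811452263878162767124398633682574350301875136291583120971,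
93325182356727599254091544857000796584686110807015334,
18458026626812409854676070707774026173240693546261381745,
2745902084085114356685110563055310625434462313815860397,
2240930236392844498209188826010162028789000610451458,
158028396507885627468930381786536954772265876582078927256848752,
9032295948420819056173872638454271960610613858416495363,
90858912872527408003698455496761613340357566521281483048268,
27877693230606059079656768392405330351120385381482863300791,
6035666258998103021279489724172490299014810839435695376,
23829148233156437961949870743185731548935110436054712707,
16038452530658665815174053795413254695956449590269369753,
7470444077373617673021236741326528473489947877474905418,
10377047898716502894258481209115404351284659718836881253916,
18343579027995368340167480233506295923074677697542483697,
19066917372084019584363926426265891746561712818795944740,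
1923521749784643191973263499984654457881312024161473446],
[7192761160357251035938500890346121421872301508851058571,
7149631030125510232206711486200939979187009943541118575,
5573586641770225695302683477950924966213021299263453070,
7894414640780186717624010922850923650118144451898588967,
44831297215406577855037163947618927231283137649861879517180,
7868465288924920974597857851368205183695247771722868263,
108865720935345891065793114669344865654231408126636417,
119120862969723987776974048609879837343344677942693230739904,
23875687131051611036250771585761568287867815621612457649,
240172506320653543065034629796444763473811682800333563239112356733,
10991664758980036297142785428451722369652250285660720475,
176069792225672129594441672054296066007004461771327430257164452,
27548429199093064009474478115116218727199307814591963776158,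
81609055783615606231648287813913088541784898197455591122376,
19160760809955340104798881874084615174626807406760344803,
1141435476859673526175256335538157318056386579064628,
1331302555199013596424468811798571217110706261090077,
36801783414402713786820309809047811089070695868250720141599,
36593180939578941983837109714408106465709584254096635851637,
1993170859005164295661982117804875445042308127344323316285557715200,
177082615898219100880363424374306243033618209776537321928045998,
10927847998224068468001891256713882770058021964688789284162,
5017174891520682276321918716206415354656453364291472050,
41486259459336262817972963175314169630065064302185196,
36593173156381320854250278915838264574191618851268504019690,
35998794766218796002063560845216801346834083052593940016382,
449001163066642541976568531262039560130751112647319005114105278,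
203005693493339520321398742422955543922756642700197105972549078,
40240189523066890006114037532995108867770503181129012525118,
44199938862769827000236555945606005647308445557120665696701,
403246108342365959614563353678374834954411410266741997987723362,
82975875198526691229895019270561343297977893993089973,
7880362110516630010404887454314910839126674907841776871,
203002440039140925572532781972598614835400717078039527220868724,
90637595557495912349467122429314767747305784949481259246503,
6806290217417284122641460091792789287923320603931731133,
30786103487162575840695917398491588775123889188193234002797,
27548282212801615320138669574494326778938666853449574877038,
184714971148636607392786982409047384437491207096467955126471618,
136157790046861716135535682023104894115803226763809591489265479,
1019262281042105682708933930657429197236756397143845644012,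
40435894537073103763087472092122854364877764795287402472554,
7122430272970578327370611972304625853854370213373823030,
613437449705846570500748496877904769413019931291646603948246812,
40911600744818805601221723818481370583532266109306375830564,
570320456116581256340762420861800246636846070011353969,
35306842790415990978038319893756360325234724763646672268036,
178222049099053452925921960413340457150404987269206649350159380,
100451659457117611557242981892296235705445207415216020818419,
35126374989125036422189976867756760942868573993998050851171,
136105286597298733669019237668170132032535900511031110241671755,
118125354958149285515764852332107052088781060541128005936249,
41076980987280640563075864721406086588661669839694680099320,
149771771167579012267868426896654534596371390861982432219687824,
73345657413398959082661410785683332964417065981256587800139,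
91202015642173340479996772143662715572247768390985406879794,
1008395830848343370673963210752390060115765005840663889289,
20173788001679733600669531664573076428625861295571483038,
138531664407363677827531543097503050007060998175319168764721992,
6195398804361788031992935071818607812501252039433361669720772,
175828721092806427057279218312321219553906220017632010868311806,
35127616975514699412419034456289695087550788179563742440389,
1796935630603773775761267530480309501944020578395590244102849692558,
117993746443908423634714014733734710957871980587549122621012,
38558761421975918236788139339244775641866009622921706641286,
97398882529015193134484667864638165277463524354668431,
72897269145499044182632089864998117899737638436387163719167,
9072586444674395722364486768498301402006962211402279341,
109297354452387041965775193741147529461334549310642779629726,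
1596904378201804834437096744404262003864504688498781,
12452103990124621643120180038411174523414458233079419966260,
497704139793501295262847403294734080656627710028980645947581719,
30305900833645525166877072870487006675685423589055056985094,
39831000370775681927032685000415678877019919371174782134180,
1226415575772323673191003629999512430311933023254437,
135709549002988030985072143537775748836098167676165108399399268,
27883257330341566890897081426795908340404800164977014305542,
607875845365785361788484491596516623783762619767568561243762708,
182616508956036293547172476445577589498181545640009740373160742,
406776308668950072602126518027788409486085797207134109436866614,
8180331117291797108713972051957271576760643406352243714,
491726118746757584771068488137816390260983152176240650707588390,
204984127422978555917700001123432424104238501082794454619,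
182604625977862945814201605896938587828174959133807015460210928,
29953218943279885407029940077352659178075785214482325935646,
81942151538345013543339798768183156069089817650624132362495,
181874413633978211534465971076314265412607311353146961269751303,
174993337603766718810460764412276284570226833876077546918716769,
318940753619577129372433437853595032068547843318607812688571599,
182634595094246939766318713708085517361818164539460439210014298,
190556451087311630611827063758354329202035836329735164525168026,
46726511974359757571400427691222998918655057924904979374106349,
138531673811303493535331791807161733307731174288603536782062700,
450797758017049891088075641328177810162282623898289416126996113,
45140475623493682488999234626051759946037821802545909937978,
72897269145513476705170490805653181950408419534567242597575,
8182262125200143537492210685644814091526030012974893841,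
138531673997916055688472828120954074863478018069055871533660178,
1926868390295968778181308630691950555581586146704720733,
407489933757605905922339964834531551493677375940612707147253947,
178619467207971406380605068678561973009748223407071151706119732,
101358597990029205117301163213600649947706083228828537693874,
115303237096158266276073810148384656254490084537017484461222,
403128398265562211078408043636441264061468341068003575819684845,
147420293301813302399082823464790811144896249200858480063038585,
198803601601430067638326953963886286926074124100359443026929136,
1013038335350662962620574712027290882577995148309413424821119,
30776233016057552848253106682244707888269214849796898497073,
61791698972189502364807282758173034806764752257368976490972899,
41707576371301686974123090623181379688585692982836418179841,
1871688017507352144171204058555618804394995213483155949,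
318515186313564733516320292693117029657515037823488779645685859,
583124621986041476869647846722151459422431446931301260791133528,
411333427620733049830940515411071534312823738888501315095154340,
5533519774141023758769992274397128820099696572955914701876,
90610050978718859045911521824160877591534625591642614863365,
199581062060971349626138725244465270759950046444264946956436378,
147999064380418236127836123570319828546471476360384152059224979,
536952991171705081877114248199860075520984401464032240260464451,
5712870248360526135139626747045491959985809181752015826,
5707787251647300421741460235612705865530782390850712048,
11595460181096777259174992103475941279869527233395270405138534,
74764492403816689565146608880332549110275641870009448547,
24305797226378605968614618044887262539320279646689259974,
436938276755594634766440580489130379514563833551675159474489462,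
135351579128025854516569660685737729898748978475212245492236,
54205780208423851759262444786615275723422766136428653800180,
21891743442692770762375820377617069778559745457674311319197270,
374340601935134530123180092612613999193977160417178901609551597,
55227022196051971243810674492979528704075351272162979168432,
135351584295898823334315698738583488195743251462039654742408,
6391918236835848154029751125585203545765574321643880628323,
44324935966504692424303544537740895862908209614757033855395,
18730623650803560970201201007565543181351656745566501894,
449872610212937590148670514621489665038515596598278995089175065,
43248779919112413045314216151229399604254809671281020237600,
1615709291402283221091372564500923262405130677518041253460701535639,
686072189629953211790703029719765266875466800727055613560298838,
824064022769348601385053185212890960326006267950544333978154046,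
32048098399325307652595811252325553636409002364740316239,
274714883380037567184451234840963830850510253124128824202923213,
234729088760704473642881130219540855695721229446536204583792798,
68870336886741797499173932351015933489471391132333126231182,
2568147300629305695690850292147302955859639442757256589435993064388,
156162576507684089991241830429100767213257209595909080036066,
306454922613445433250205941657661438512398580545994603024046463,
168770634223774395453095585096631041631991099912179999353137,
631035105197112686290052955531202662518717275874509517243868070,
760033841126116713178405562440235627575923071600978719039687547,
54693035646037779815515545785717301913831408580014613342104,
1170818376146721542892228232509779207053163196488462952556347650208,
891911220070465051758424782034585133900254159891172669122340740,
755486197151208784995178199573888482597035825826543753619758934,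
862140843345490370168697824556094593896769230564169665740974242,
12288824700230555176062033413081139855815721872852012419,
71986702370292194240771819250205145655871403789353642335621479,
3184795271479687008845208733225072630280717538577492200239479614538,
620036357424746862989775187891335205874262793674333678399319305,
94938879627024511180007356342252188329331948535110745910255,
46214283934891591604584957055461984530526782590695649104220234,
299529189125417382331418039224793339782843118679766843890710655,
2093223951094966361625028704965528984621167181482225058039471237081,
230935899887739043881824044505055866865141697844161724940484975,
95283113206482726418724309008340442306992953220410687527447559,
242516464805526025109902122951225894296553495541521300521544643,
95311136540656409165085622450489866158541122611319354007499330,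
2567828032729572102240665552208307252584105824334328222664286415344,
845208775166141531078025733891940227850568737225873777709570859,
11328833055483172888847846159647719929109653564091622927251678,
3184795271479687008845147890739235328629879200236414866560477850698,
95283113206482726418724312202069118218536550874704313137622023,
299529183787409121459374858365457867851552237487225438544922015,
1537335934364245251773481000772175336592522923320008827865691275450,
229068879052062217716662344718451833413278857094155515270056482,
3957725068012058765983180075946363102989508945647144464926675356536,
299529189123863333042952485072912228686846285093481051890890320,
1293934596547417070848566865435454763134163350903551605142462685770,
3477551791372884037819059826808875733570353829706103125734368557734,
168957264785917211054499903073744311853327742550328340878942,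
271667538110734309796640440904678100820021759569778756163879,
66667271691733534164500153730205176394816206105258190356807,
55851569298443003034949830040188265525179255278971702505589,
2629374804187281560500216605993615613177985555993105554970844369568,
1517958681222150275544632914240939376408648711671532514552190608792,
2155236159433053898169393948730250812587773817105514511243130325763,
1170339187847890613969791328337020885311889087914922697762999287664,
299621355357469648528750128022933217094358096629058838372310977,
417485819061263915572465564712586658743099480651434120537508994,
571211096984468014028376294019633328104127110291392583685233594,
548902546634934299388052255192181850611286031345561312504777056,
3607207305871340577563382861544430753055292405000967369062103127287,
233765941881468881421887151577864651077418637964575619775551787,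
316410495468400454763766521575728188955416317020250815594611673,
1136642428283390368009785565023319036327374584223369135745518,
11772533198748658564175004440483197695962347050782933724,
2806316195451075229599050710104599574024870862915597022190551995726,
4283611447972838844872489257165842448941044163184693633216621890971,
23579358597739414086027923767884959084540999315719131188993254178722595,
3478374552812601522917733752488138378030148952613895587860739445679,
553705759399908050024713725921404668274806325916234328207052260,
7576216497661052587287881298238841996007030149715172677533454,
7867603980008017515614524952469136749347607664780173677005957203,
66635238345817208189570263597166816948465438010942153387368,
1392254948020024515133157672930432256468038863033643377427672720644,
481217718010728841005710907811322253816059796112799086962984114,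
3900808327789586536992964184040385665352387644310124634101860614560,
3946115786054578901409239985149846425250466180228595584004281674234,
3851498013398935643775192239354657939642766270428341326797623632247,
4171929952148122032855597106424523656971550206295338664040271014173,
8365340386474806833420145397552492873327489767922766157272338217,
2788212308436655017946731563689013583055345360137720806439460693171,
1391870055065281546305202609597728847554564923112972249653504347441,
21760297029682984536716363793460454520791917907308597087408895315018272,
3367302243395178898228319064177993147348059805585931703052140007950,
319036082887101397388091311152226541700003999697886902108487032,
692734575507296919541489665257642627593838264653137629259918780,
233768799861028030981011141087615939718699701331606204994299819,
59670221607665680433004354846875094444318172305701012653434,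
19063602413886437653163562082503543212013081039289499402839,
692774492049626088588547748504577391960893164752798269852892323,
1522525993603379745425156927998694555187958824720061287105753764609,
19387464104681300611987069302787215526639631342163951625516862803702903,
57479572116456784149540364535517858547726016270979691168720569388,
823305674407866538593638747455142570672971473784897577569499470,
4171923728907224932385073524594684790950695148055475791769678380015,
13755696996382152048802853148624241516581894304015600494328,
16007066469419365476443088894327723466915542226091276918515913444044908,
823250519607613704092558429635942030780491559593639693851980061,
743779599801852964570542016657306911513339878883487755244170405158,
7992410339384503691573565788684096030520118936369056667967548692488922,
1920173775818996712454131741482836862264130686174814235618094763,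
108475631400897213807417482327050144876232098047601760845183,
3478374470403964618941566522494416260939950395383602443896693312007,
230962899156753219777454242776726978803510559605228712447289106,
1154201849439691662343127335395119749260522867154689248648734072087,
55675978885472558385877826613467261548415262753398951167582,
277231394805501645936853715153024409565236686426790643654965521,
212822257368116495028922384773631242375397863687117791260774979,
59106907459435196878947663719903274150745518736077747678791,
21539027025333614263874145708998287407650803189015756566224085471105159,
99538557002393026197584956929823836548039303975834975029477,
2782206003523695333723495614584906007137760882699675658067128525577,
81432747529691216939906901365957803436897165616436898295456,
51555048747313633413695749632312425939621787535734228018571,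
13755696996381972660412358257688390761364613870503260427000,
3520131848475531029460585905782700199885221954716056878934496060610,
743642445339625089072295699926310337524332054856299185539624917971,
2669559288411997872379048036321121262979060017077626857558,
4272753406348696954054578752033880302921227259967216839821567443654,
54224497401537265753120635133579659674306108112374252331216,
3476768068109768312285578654415959366877153823777744773568682504414,
108475631857780771349752814165718361340729653803305551209928,
7872339042423512716885074368733952630093690905867312632096494831,
1774636698947028308902657301493211904282322836276858830706248392518,
2087790166473614530843626579542421186335012195993967578355983263519,
1820504044539916542137354240804764610480464173788681137710194998200,
177403634307848616793433907230321192851363093540493847887667,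
10580865817043330308552311048492051617244983154748097011062584057208219,
10572114209015766924157428009302751720281341259076255841791037862532003,
2653473073817163307383614046053189604239880788287123797090,
41297892111411426784339537463203124406451908761477300365670509,
20215505029079299178052336717630638250030022112793027101305,
918034034634924680202882660863754990894018807940720643695432887,
2788143593721061897508325070414367661024300509754863905684630205479,
588021356454505901612073889335873864339876215993680069292363093,
352468630119816166261783314969285596105908955016511835164837434,
1923152799591895646493083674657161981834301821078885562245187410649,
77656745462094872298973657593105839252776107005943163760,
65233038492466528433075859687055167294704435496392420515864,
212741199024274284620760783402605159274989330237932667707592293,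
588021356506124952477234205873862775930696938904770694053902977,
743647396825254235762164040468016164061589220403674705837956830542,
1175052345081230267091532800805569639595561588066719949165396708981,
743025426106778525726626165468658253095134912418104122161806145612,
9489820369081317115105448440125857644705879689473657635065179,
2155042440889563404821861138216055941739686132477499627091840832106,
4167678019770992140353461582919786497705476639698110442366477,
28050928595280485151293090009438792803639467821853938480931455,
95288257146832544200336589561312294160570327735623754743648593,
1185700171423011427519093359071098057728374885675865583529991264878,
300484666423816427892433620551275891069194610213449753108629958,
2194618683877274570851703520630187848215234924116839035281503956,
69702010036340324279035354842180123124369361887009233726159379,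
743102891706551981811246845532521489406780745759607117995982683954,
1391859876792256177489676692112169495794840982377530317221169935030,
1187386600881891355787707694436886881045421827012194631367657301473,
1532072628404793859787672557307688603346419372211450137975663024714,
3300389697820346832491263304635735691183952636330842499273818655928],
[1639409622111282620648334047869386178594976725667860895155490750108,
741728670711282570066049911391519650397782587842010225453607481,
1958472709212616434001179230153934567493815410162357445925273955624478,
293281022241107225974729396041603659517162626914980873355878547,
1639409622111282620648334047869386178594964458107502280554336370332,
1392255056015184568401049572179311148086354816115974558482214872550,
21820674242662050395211067451955704320743554207800931220661199360449893,
23249292983237053866664048736886093381488371976155433385986,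
3481254640556237313891879496087310181987134812127944803681519476957,
496694598048604495215665843715010578398509509846893082438687939,
159913110924174763763693111770129494477398062903006584416182045,
350850079843670574998170399536238079559614588998025657269055228921,
1384330754517658113148867907956496571650607380380019229941849239886,
1532673737858500671890907859508611298893448613915951772519959163787,
955704112502980894266928992578045545957651655699086104781513874,
234047475305998524282384283171619864077574737030347409091364918,
1639365491327852026369335184969248834916996202994237260084850755216,
1384109342999109557537457887053166950774229217934483338006595580686,
1386387665630950282239909846173224455023449049325431902555377668474,
274643865640728932868278919001806903240822893984583966501160220,
2117056702969743813634259622017813641473801933175550752630542587975,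
486353961618099765053627614576558177624909118357277100406678505,
1111555199744131916767634994954796486733197475539504070030637963994,
1535356502449629801334849603673101204606374691226410781391409396675,
1958472709225621972442906384143435716052619814706636862688942034545950,
13755697128056484718971537197538794616455084927862789031087,
110988321244769585377170590799835826785765838933131812096143,
1871325609230306581378904906474278572068019235729498206199,
18364428762053912565713966461306396072846375387495130515689,
13447804443523958874914826698288667621024869291797925605746102,
1385290646370527300316588470953016025562005795304988102539465231394,
350429667394671963845785631891515079239330271638339086705742964385,
395750347657653919830440853375919650671840579829575235287290888712,
14164028861001175749177946342740990027145286765474359459712918145527076,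
348568600590371054404669911669241163145593421101400251104135222,
142975132241136648641946336164408493681748575795704650808333631,
1767109142799227505731278269143222496272230491800135473222878484577,
274687794032432711555162980031137391036389604019490686055852912,
111580084025426208857387134712651886274310591427105098313567483,
1766492066886555825302519138535603486098629578682645570869878358161,
1077958998614727570376136148282497868507990198909693310151009829075,
3133149360963870175738995607072099574406887772457176362593094607226,
1517684302486473911153128888507450746265928385343807261245306264505,
177257832487184283787694014048066077083588290367355265177911,
6027835071983478228637509968217934337863094680348819808001194006126961,
713051669899934596628741103434132097705900185286009987639082136,
1533386726799067146026051436394178950003573912603847459396951091696,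
274098302022156918000882352220153076195055478410205902119918511,
13755697128146922485490722335462968124841803932010592750447,
4271590371739744466517340663918456071863811328398346337381665506741,
315564254906691127242242483439939861836836507345963809224775070,
342292342094187815273561876210023169660296347411592278479572393,
1084266859362153657700686478546501348097453990693355949682399387603,
21143998180579701642007254879002469508569192991514130460223613970663175,
3326992174907604022719736140541678074113838448808331252085492213011,
120957243456978714133304953411981586510128622669829860871004380019,
479802960477626812582779566758609974141807332665874310337392522,
609514466407607918695862546633922885890729811135908108879515320080,
3221125590419365371637034080494313506992010356542903954356656849875,
120957243459692404579253686491567718022574141488454974140122435459,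
9485039067645676328675128447506425482601805316776310699186475,
3481254767345399664626460424475420327452889907758941703889161376427,
3163118330812057924060943204264371900458627465221046104905722280167,
691956373614207859435936024468055337041722058196218219774196863,
3221125590419365371637034032853462680865985566682343528195242330691,
13755697128056484718971537438254117433197817892306123830255,
2014891996217580084845798688978503977570006209476755526743510938870,
3221055511495616042658230176793384183129325646986537616478763615083,
479802960477626812582779566758609974141807332665874310337392522,
7670646294852189142664957791789058130792938672647430800389439690299968,
383091752580142858015524165238729426973720555683408511666510744171,
1078171293995441350932998485259513374317664749679690717966595806599,
2979581037821160915805897555162647715165824394978894401230868565806,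
78035211424425085667361254600126088746595461610581591420734065,
9391442111448397845900013104619270201433801019603025477463036444960578,
6241445382344667436539625169624465774207803435703492184,
17229976362713882185163039794231878051272032302524258771169593,
15906779667817120271995317834644437572276058734977637505845907,
53248839459362883074226879207916941027792110805107954243677918515,
16300246309993296735620715194896980724496612513239147206673164099,
10748082827374412740790661263547658084238663485144950992868519612,
15902163738901419115010601963666106523963750196954280163047801,
49291350533298274184618717936809630290712599304637190273068100693,
69365670614477506750869348751575925381964612902559359500265417924,
31967362890305670435184243069895994443073377281261166139782572740,
257220446147414667447335788964517556262455168925868978090399000497200,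
30082603594949342156589292266507528308879784543889276571501075818,
128678905475615789049597771620175567688349065560321768264223569649367,
45235888605090620380507663953730667880189883052447822581855675,
238864853135252217759599517984700174713236756249604131179452669625275,
58646053639650809718190776159381041913705193136998948043372577797,
43201638748150967102299754825890627038893802842876610972144722449815,
6799841655014951946683059288931911734189497117021848399564838,
8287221369278705291597995683708204548603933057129251520205441689,
21317911298277850396386426898400171414104875099190931217171783431,
5304457828312898699693434964114510863004625014920627993635339,
97562903526115689571299180514274316977731311482959276768365813479399,
128487338420220407078271393820498479970338900745505788788412512861288,
43143206372338485436708145302348881125918069447614259880862138643800,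
15900845126868320566046865501831504518995870786635765028276093,
189575180599343183249536624285623703721553601712797333529965076848262,
10697534141952058494272345879618719887489876927957249013762502,
257480061461224026351142473445986216031509865007717814122521814525890,
9232108191036795072171023713223871958287441854454938105166,
257220316349746139279833874122226089875493155704447306258195915010458,
700888970382970882697892609552205322240730406709707301645227941105636727,
223769405629600447697350993579000161093805252977299667289692540846715694,
5344348530379739476799354885923828049501178223697491093924844,
257220040837743222972985016830732893920052936856430160228695388719500,
154904267141616558345839480979730315932741120054655196687260874508298,
43143206400027226603962487890796571508383968891779942964102207884616,
23507227845855047905074896477346642570101299467973726908953478698,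
115143421202832669556347721413076256972994733436399787262974361305542,
28664417102439220636653831673463093161076037537696352068642071603,
225504795121435839524193818748052102216819699365779229354976429472651,
27327105805772406171212134433313465529506501834548554331273961964,
115117783279041525672449003751833400666324970410608398364371573810160,
115143421179758348934741543626867045138908581401520536200569259223078,
17212864349462796754144767563613865480423260263166243203617642573,
257193143484338214605735232708985034994032298860244341900684702558812,
27326395122887987689586021300115021553280691375264569125617325912,
192661770457677730647485795161959989270664664079009552727388549297724,
64270261458918011280078303261560549446815455221180007028716523583484,
12700628689632968152368944247130464180903706710812343219893462172,
2313461632992664764991462580002690272273084428750363003132367241779,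
171699620776745694138828585837835085509865004131730782268253186075689,
52243584922021843945073360041311674742274315537613729483961037631,
53844903228974029407303624922870622527897119207949823165581340519,
18977053066610953686026194704782824023898879401070897542465443590,
25549556401328873893956010418329465546113713240524421785557037269,
50960801647521975649075728378302562696478050259552584737881989774216,
1039624501550666273614639748847955308257213495790422346883587386177669281,
65863186850260728894722926356196603458818121675213742776685023308,
42671655952063145235729013345582053243003944392825993681338944922,
233218467626397997981843496252393161549775092037386831069724394933696,
128451150008237788313763037016158019652933911880968968013547637734385,
53269327826632383896895661473271494862822989435196498623317615547,
6093629808493368422814427576234413536711227790165259461402986044337,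
65532060094422888223379184624387162579382192333400100770191067881487,
49620514282976077427659448278741456070197310669698496382296928552,
2376115165814238751269074890547991167029423556954497237655609823,
128465981853878003795521869912865403170411186835585030195474676983457,
79085948471032633783445872632760400041792287164703432789018597936808,
115113938950209251387299508061139679661263645803627684074672582708323,
27322584626458379189874839707645400364246861537955157979257966731,
65491259922880056076373680502973082960798411761065422270571116537905,
286548474370832992237395349780118333009215816385291314012163867993635,
608714016493542005979879757944251347620310257821277922765624214744,
97713867818547520535850727021340990119083724014939096883972864085692,
85652869722820664718778444359550332607031640172631720771339347533991,
257003122358871233012299590941168753710749561970505447523622016521964,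
37881077124114006102076370952394172843673355002517921659855284558,
192656565750599554878838452980354353231550971309299261791716044476607,
85636886066760349882810516085285517741900464819185205918307351697104,
215079593465894785191442302793693475318421498671104680894825086334722,
218988824921406626576416086327675702264671035049961079395424589464139,
225449663498814619922284707261209679269189093728483925743987233686027,
100936816436294130072443625198465400836921314250713422114231032329051,
223620238820023793488842399245701436031223270876903030364942811983982,
517096026163987777915560404886257426998820562983151501399484643052515599,
50327753432660768067873998070365242889952495674144447836100057979,
1163775126158805507167220258254110604267971954750430094743642854030592934,
97713867817888090145180524714237147580225444107802501014647918759100,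
64222351305125327781897413285740529235638461759462275819984936456488,
86925279976130254233786313135020441093279737113406961585899443101608,
115177881519275822474737711574717406209985122496831318826517805001697,
27323785081402989796551636323388068905814325630724686004438468076,
149811352905934665064663247665058098442813486767842838510211188783820,
101552970543037880850080096322542883947595441570254459507058,
64275596117769956014863390647269423207141388619546563630589252614480,
27322584608081575838091116296670197005473436528797844613385235848,
225501947401476758481564870699235619433894778985292400148564325874852,
362820524511111971128077814731961452381811892466886356244391334776708012,
945740306620672555181201552186441380234489417472174605985685899235191831,
87180871615701537357365280922499308479059986175487813456402564650052,
235389662268584711659864075898125103765724304531400591678853965782860,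
431351565200946529825326401031537181410143597639507153151883591270572825,
65537026823801612949813270247482907799403800511499287522601530241486,
864671611770170286988724175538585851397475788233520412275051157488554205,
898963828992511567132607711686377133902914940963631722564270461689822,
109754940220505615147786065999466320739863634917754264903839305596466,
194737359673013288344078008094303180413244135416390069179560481483417,
1063571431384171709614448505514876097300257761249609187489772758191764412,
31983288212981919711206488406662599065136808123305927419235681999,
151900431350290820421546518604431001195142105922799946972212036654,
87233767975730061347187454304741371361766916201808175266774280646793,
155683521039810286213478375367567369500559084912928744678361610815631,
945902661183893620151692226843850659127864948805214571984259142133695265,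
235416275165830352214168666702026165285360946949231732007865183227962,
123224085327039738212055471426867925700077596781924235947917044244940,
151088547511436626919750209996493417394622674430552384552143136685619,
391879280382321984776006165747702072583720548799105547835790598390824282,
138106500234969789029778183940269517119958426281902268734580650576705,
45633717262505344629633454136136712321164264075857305426883270905647,
225449663498814619922284547907685889131421052490648894650990125841483,
43394306247877981644970746564615251969222272897555974864562929413608,
256665840507039578367473655769594821731919833885738316230732130603451,
204210769469242121457855221129936353816790700612783101093085980576,
50326330242031097594918192512112016873007442789857755312419738235,
107358804222306086365025388849303520870724846782164549134166875433685,
107333494766115766696724327036090646457344641976906864578100488786684,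
192640415213147617874006850624907963038505422397950317972347595416617,
87212143432784637433288300208508403738861099189187552673886277664748,
194684145281747738968328906954682624822835658843089569235200389651301,
343982184590900811429200841026848060038110701821053769631334667049885337,
173583393859371345094190611160824950540439604229309537434197832501621,
86914302799650333455358852997088595789066540487296753616061747921837,
53415513662748981005429097105411047217335332084653677572591078525,
173328263395781979889852268183117880779821820178242209280805724002980,
76656834120062537942293666756794324310757995288708216015877020091765,
28653520941682484409712347908159415778212192482993175091071129967,
65505193607433676158847286467738031882529213498041528222978095150812,
945902650526360208604723724258725742516907004884455029932546106148664359,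
4942213700861746947753624485078974227190026766106637470124294922388962,
37297045954581816013464391197458487360382914436034068712277214362,
258259345206538100568918035371644190410331454584722849405024435000798480,
225502212300611057043680718970631995486497255243801327702338358413912,
21531661051327811344270145170166033050692933442838895298428376355842,
27322587937662067740403574905563580028136537106462990274323446280,
259574202229190546008276970140656898178531113471672056176684399592994,
85604974140603226057616341859124916156548794911090878926155390673163,
13852654074667647282770247043536365717551651995266837994474693,
11353055071442244128505116537299550104173380435546719507845718955,
28657646765824906827946359187456552964116371859841813113597047620,
27322584705649214152506609702503364695692744989157597120061381640,
68383301635423962479599539498694081180977512296679466001515607012,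
73706330174661244744014790664133329970947367004759287249674890505,
39683153136384787969718948523624502662273884963327423153222584962,
64582124447761491820566824405384464885311003886561247036795925266,
59781143702328900088022761210949926999044416196814971278786076615,
204995275670172405797374217850109780007173708034725313524818223506933455,
205004884276338236348490104579547663605309735518827323882700337253627039,
46522032708297751029225658311320903396892942687157964618845,
175408545565042515281549989916762090347274310288893340017976,
266359851418704880462813402994308914374618277052792235857120076047819,
4490536892122098104777536625099028831560047592838104515295714314735067167799,
1500204121245313022933917388424719018736657364518080151270303,
1370658348184302053859009685078765270776194117921173609793160,
175408539879916211918366430088775778458006947456844500395136,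
598458086156681829160955517405958068445572520716868614664020916,
13022897706581577852097294883569242307578661886810242415132520904626,
49310317740850860246951141237738724640478101451723151215394,
10958792571279915425998304459447224822080267612008987639510244979,
3668658002881801747525457276577060680190606421341643651926193763,
17300850884406461167734539399883413213295768951442989838837978041780,
28302320735718119779250263441109824831008250304611325017771068116580,
11940898441683857851714495684896513018413822509846096972737504339,
5802257958567931167379000342023306430466780336566249724098752,
23322820434568216431442678741171370440722182981006419435032680911924,
87148914268281912908776839159870354866202643015251705286222630,
20509196550482973738159948008340884803048097076778209908530429999550,
5484898995129451092646916876879853468292719975819526916458580964,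
15228666629481793844449970163572918793808925333741268801914422824542,
9953118475522682760018957337204528097754972591660106910368077242,
21675150631342590389454128587494161228095641429884981897330001893932,
21612273887995329797199599705061974348379107516892436259854827726644,
1830832402002217111243998351055618823576002704705168371594029178,
28183731886351324152114724303264288097434989606972609955031797134302,
6524796728456588060429171449160695522614652971010540534040748453150,
953208670563824921134362072262767322458855098984863909454719520,
1058534252898281363456064235793377471013656282888971823077206739,
447394021922237755090810329641825286362482149966047205589803,
28176436910428922678688022188156546483145899805431356818037067198335,
26041886803599462565550950782009051072580282181021804629069858693096],
[25939382228947793905009594468733904487670883337105166958811904929279,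
13041900716210823012739070414502096515918374420814654496742128287492,
17344395270062413974889195842722658336473117907158916490827216969370,
9943092707616192173727579513851046397589929127628559622492873695,
2282665871283166716546731752330664929068548874471132888425973923953,
32574473796449234142348892461892152922347708479028485529236562467723352,
25367580833734610849290561526059031865216896124392783601026615560153848,
117635472011171563666345209639822966294460813797793581141554329,
18121663236414627399881115049451932002103616049912909667864143686760,
26559379328893000272924426396286727418728637782747720294493849407,
12989253160728106487487525715344334557227746574677543870892425162110,
25556045733170753665721228400933571315651231773613254201550811656,
13041171932095444368560861950033544380586716150353325787606574630703,
8659973074999134896281468269916752785270122949178270472616995299641,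
26511563102236117406860536722111305999048137278986747577870938217,
25939382237923987677349818292716408835333201062968440693777491345025,
32570809704077135022683502402564945332185691201264093712607678654935791,
4461737000099120100079358483648572571225364289584743340140061268,
25560364899594497237094425516616135886906261853694220791199940739,
10559347784810262605117179920834811552922398032677174637778014782949,
325599353009798810264732692507890395202494551155233954960340792852,
1830833833316181109212533989162598738146148606582217623802948815,
2951722869180958914979764476003660201768969400933287042825790286465,
10556469755924467317954634048545878532695665901355214767988315077332,
4462195109453323777715685913506370249717913880778153525383639057,
792237777313931736867620492392942024685777927223483655060575917560,
10957989801693938786806511811083413587120241529707781850307307193,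
8395160003583628014287733330335284586212233771007907660269016009105,
958351736943718800695335111389796838064817551429974283029552072313,
8392754102582576934657270325824434660370639301812373801605244474065,
56416504291043121744506653472928869195451603960394378248476527963519150,
30681719693336385252342271673221634921353833434133414188849790374426453,
4331751633761114025800410844244916697945018386609829522127939215862,
51102329064402676678698437299355484566487346686799377022913375756269030,
30675583468750534061206904658806053000931979328509638362900822102789843,
30675583468720872504691042969465909452776974589943153370033704495456943,
2509721692102556632123372093540688102682617636604030464266266804957,
56636538487447182184820314935677862790502376572794607997518015,
51517305027602072479796371090513444705922099905273636867782665,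
12055513194465831152369025967365416181857189622125749002717,
64518510277038191538165481832380689684543122875482068575051443,
35548243307967753230585200564640908279432122483486466859739,
6172628838429454640443952847680545571123394113432674593531,
1867110410180320596849757092161987904058381432206285984993028,
56662824912982517722916571858076475700005196489966342925069917,
252331327142278352530436982192930710599014803466691857646646,
5763214344137423347083726219481707366303093897515563749953300,
41366176144418748438538266031516126644135466801607629100810209,
1839136371488813153236424162259181836120272679]]

noncomputable def sizes8 : List ℕ := [1, 0, 0, 0, 0, 0, 0, 2, 8, 38, 117, 215, 400, 477, 461, 384, 209, 65, 15, 2]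

noncomputable def rows8 : List (List ℕ) := [
[10722528126754, 992, 8875694783554, 1182254547554, 14169833273346, 117733429634, 2880, 1248, 57664,
119240358523371, 11276753906050, 9446438333410, 2639688915554, 2460103170, 2460102786,
14169833221890, 2462754562, 2617196558370, 500103863906, 2361346056514, 8858828168994,
6185048693346, 590072972866, 6303133459490, 8875694785634, 8858825518594, 1770921695010,
117733484578, 59552, 7296, 19330431682, 7040, 2470497218, 1464752336428929, 839215, 5344, 8768,
2116932674, 8384, 6048, 4843589375202, 19330325026, 12991094219586, 4672436070466, 9024, 9696,
11392, 3494399742466, 1259936584646493459108, 281759954305186788, 1023258225100989349668,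
2467106210, 2361346006402, 4905793847394, 2469227010, 2467105922, 9446438338242, 2468484738,
8875694789474, 2469227650, 4902982302818, 7084740948322, 373586748418, 2472092674, 10436103990210,
19338388962, 491671515330, 2466684194, 117733435970, 100870583298, 13382600797570,
1790420374866183097668, 2583054624326308548, 3533766510498, 96516173, 373586006082, 10318019224066,
13600, 9345222788386, 19337540578, 733462651426, 2471879810, 12837162210018, 474804369538,
19339557250, 469178522882, 19339344322, 12873008344674, 10337699612994, 2474426082, 12049936515586,
2462017218, 12044307594978, 19329377346, 3685593525250, 19338282402, 100868941314,
282312591509273028, 2673436468994, 117733434626, 8875695000802, 14240, 67872, 16518998914, 14720,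
1535478596866, 713786083746, 592911194626, 11529801885378, 7737271850283, 68064,
2582950118507076708, 3485964738914, 19329376226, 455121542338, 1183626739391709021348,
7676050808642, 15328, 7676051339586, 14944, 8175625389474, 9766252116162, 2495638306, 2489274722,
13472, 9922828064610, 3896451735874, 68896, 2496274370, 8872887380834, 2133375074, 16512,
13601903238786, 67488, 69248, 13483468831266, 785431, 784521, 779505, 2129131874, 2361978327913093,
4133498335810, 70752, 19008, 72288, 4860817305602, 17664, 70432, 18720, 72896, 19136,
8976567118082, 9207461403330, 5018263801986, 8900891, 19744, 508542909538, 20544, 74336, 73856,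
21792, 22336, 75936, 23008, 23040, 13430557706846311428, 5529959720898, 69944873122, 100864175138,
590072984450, 10897770914, 117741078050, 2480370274, 10983831949858, 488857380546, 8993787834690,
474802255714, 5684592498498, 8993788683074, 1646182773690347789508, 2583890665231081188,
2488536450, 2484187938, 1422299299778, 2352917743234, 2262953726754, 2418677,
1861823326065313452228, 4672455964866, 1846373446195549686948, 1238899200476543702692,
9859744572802, 4734296213122, 2488218178, 117733497378, 19358015874, 2413997, 10717265561986,
785453922728486275268, 12938377558754, 75562289634, 10318019179906, 5226314709186,
632598902084150138916, 13174554885314, 1511829984049887355716, 1456326667172897860,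
350606061058059860132, 117738215522, 92326051432633673220, 19358600418, 1530755000058461069028,
2497764322, 415759185634, 13455123, 1059607929506, 4959215218626, 4040367, 2114163227898781988,
210532229858, 1244158154875143692868, 12044317359906, 282312591519774948, 660351605513822837988,
1646655295525355605444, 7306868459906, 4278828588994, 13818393821858, 69941215938, 4936744973218,
2498295650, 9345732742811085700, 11352665625186, 69950972258, 19358653378, 1169259228034,
4422226695170, 2137305954, 1856564373771704442948, 7096839, 697003841286104773604, 7621748408386,
16522505282, 5867351169122, 1147068810857791337380, 77728, 13174216486146, 21819617, 471992728354,
2499039906, 2046468774210, 77888, 1568503440482, 455128496866, 2413599, 268011117251073,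
4388474638306, 40268391502182244068, 584468138466, 2413593, 117738217826, 2471892194,
13565363188802, 114942262722, 11178349810498, 105519281427407298180, 2482387202,
120114161265765380, 13107093085826, 7290004021154, 10332092758754, 1112670540454688614980,
6303157177858, 4706201025186, 4020166334114, 16518689282, 15278698714719, 809743181685973, 2407569,
25120, 9348054223842, 2521203490, 41882827650, 24928, 6303154314562, 592947261826, 5642444468194,
7993056187461, 573208336098, 4486882838018, 8951276533954, 1199124089380132053348, 122822101,
3859925154402, 8858344655106, 2520248866, 2417873, 573208335394, 2510277346, 2541285716834,
1440102206496679, 474822408418, 5849287542383, 2583894443965655780, 3485964694242, 9083762675682,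
2501160034, 1419225979143415280900, 9390212126434, 5799873095746, 308867534095343716,
3024871441794, 5825177103650, 101085845, 2476135170, 545111820322, 24608, 79200, 4931102959810,
12328285968066, 236889764530871875716, 5929197725858, 2493739490, 19366080226, 4143890888098,
53067547411044402372, 8799431704642, 7111005, 733466802210, 12300170522338, 18521638208628447,
10320859683586, 80480, 11119337176354, 79520, 26592, 5089172712387, 79424, 812216245378, 79008,
20426452643499, 39029819266, 26336, 8184085806370, 4860828765538, 80832, 81152, 81184, 26304,
81760, 27904, 81600, 27488, 81856, 27328, 82368, 84256, 83328, 82592, 29600, 83648,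
52613379806753357, 85632, 6636064555383471419, 29152, 33568, 33408, 31680, 33440, 86656,
1886199763330, 86976, 85472, 87104, 87296, 87680, 87808, 34976, 88320, 33760, 2539098728405302180,
284976586263370660, 1723739311897950246116, 270443699050877071396, 1072146805171597752836,
1746442229021737654788, 76746658532952452, 9421152271778, 11361129217346, 2491834466,
1124284227970, 474817855138, 1124284970306, 2586625510897673988, 270725317318091038948,
117733506882, 1737848649681911185668, 4438933, 79127728179386319108, 1853839674681053764580,
1543951097887420469028, 11743488727874, 1751749104879724204036, 8125021579394, 11743490636738,
1527843864194214209188, 1846373446195577055588, 1497790035093486866916, 4414443, 221398443,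
8968484899106, 5948883903554, 721000965255670894884, 739247452788902595588, 557464785393180601188,
285019096828922628, 6387482736482, 944365438585861835908, 4435125, 9446449385890,
647202736910404436868, 8976938515554, 1238899200476574151332, 19395885794, 4435119, 5785836323330,
5094173981378, 1009994280427403563364, 4959220265890, 284981854578695076, 2499470434,
463286298511662763684, 1201754245695816614148, 1115299809368726621988, 1546583634794137013028,
5217881306370, 5811149821794, 647134464959099920868, 755023983755522153508, 9103453991714,
2585509219282405572, 4408549, 2534360834, 1317090730583978254980, 9348765167982086052,
11943113642242, 376012014066607221348, 1798993152374960397348, 1681992017430728594692,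
1798992769779974495268, 3273183740322, 1317090724187714662724, 660352328193258792708,
697006184775659956836, 4409401, 27970963509, 5856127854434, 455139164450, 757115509501891741700,
1804205555611974551748, 106274826261508852164, 1061369574525861449444, 2386670182018, 8911579825,
649504740204577305636, 117751906466, 278287533918953793668, 13787476173250, 950379789260193476484,
11040593305282, 649504740561991410276, 268473096086541584804, 432633499778, 1775040991665163464708,
13361125, 5217880140418, 1695009962690, 11335799016450, 4253561286274, 13320705,
167020009192896465862774478886, 11757575084898, 7036944657090, 13352525, 4335058697346,
13388232231234, 5527169292322, 1341274052555481767012, 964032498210, 1630594446232618903396,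
1579762298018, 10318028947938, 13208297992290, 1197997446337276674404, 8355568076706,
12488558594114, 117738280354, 6303154322402, 65101306299622417643280647974, 1230681515730272102148,
1564663798511259930052, 15734047891492233636, 5811156078626, 13355535, 2052098923490,
6151315749474, 11552293677826, 69997908898, 10312401987010, 8126021488591657394102069158,
7821410503458, 14074243539906, 1645010800225515694596, 208033855548523440228,
637437212447659936036, 123812933747349284, 6303151777090, 11124460098, 9353696784898,
53595506429834116, 11757573706274, 167020008892705113938531719206, 1683330267039154382628,
2934938820898, 781651479203506007172, 1800965387016731630628, 12246745133378, 12142748580130,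
11653556366338, 2529799778, 652815107779695175428, 1580392349232263658916, 647205230862903116388,
8920717487330, 7807316990274, 170732697, 5096497705442, 6230058034850, 5333445698, 3461851,
13345725, 997792666978, 1945526472189839558746899366, 12615104982690, 4987386776418, 4351948538818,
2522803010, 117741089314, 1295788872194, 8723910799586, 13328505, 16525696866, 13348285,
119853950029075, 1462641889466340170308, 7256265549058, 280377425, 4011761615170, 7526200975266,
166502334912314683706440069158, 144191701648294810116, 11695702175106, 11571975178210,
4034243151202, 92162414673133818884, 172393391320956945444, 187238585, 11068719887458,
473641702749898191556, 1080796727879878909, 13340995, 11673201971778, 935918802882, 6601163679842,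
12359681165, 14645279865, 3441000460066, 12879355601698, 2715629170850, 6685520089506,
4360379830530, 2352937003266, 90398189217890295260001650566, 455136674434, 11445490615874,
1006233186626, 2538180098, 5321931417890, 13322531, 13322535, 8380884917634, 2636885243842,
13359537, 3396023384066, 1461659612162, 4756497107106, 705392033282,
158163105465632942459412604582, 1343569647266, 144191690193546814212,
158470588937947511256043140390, 6459414989730, 7812978100034, 5783024729410, 8875718884802,
240601772004623636836, 500131566402, 361105499, 12499783667106, 13301085590626, 1802304051,
1193890161727895910756, 10478284392962, 66545058215262223108, 23507671397853, 11573241018562,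
134190614336093747556, 573203680674, 716329970622817833924, 2503081794, 5217880564610,
20870192404753191791505467206, 2557481346, 93606063, 2136475486050, 5712732828514, 6207557884418,
14074189257, 5468111799778, 6575897212098, 11974072715554, 5884257352130, 7531476650498,
344781272605481048292, 4681767575458, 1611926298139271946948, 157152296162, 13809973414050,
103804737244233998021225732134, 9030375679970, 9571072173858, 16230963835, 5903936787010,
758378881, 89312, 19230747928787477796, 8389313614594, 19052506402, 6736158014850, 545146613826,
1998022186274, 2322002221122, 2541285728482, 158470648637646088893861349606, 13109889960194,
13751218146, 89216, 361077209, 2667842776066, 10436136832546, 2530018242,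
228196348554997690493858522662, 4631188354786, 9688240264002, 13482420698027202660, 8974396923,
11147483917186, 573208349506, 533865495682, 127459087533272209, 9623280811, 1041204071,
8687329388802, 473263355934394082756, 2503614786, 277886983, 377042333371990726532, 7003208936642,
3421364937090, 9272168887458, 7458684515586, 86276058348876899925816629286, 12401395840674,
252692479106, 13166175833410, 3202005921410, 2676243692226, 13483838269218, 11119372288706,
3126112034114, 9390212139842, 3227331343714, 48839471773, 70528036945453, 9229984959522,
2111716419231276281, 8993821048482, 89728, 10334902462850, 228196380939899432228839634694,
63645478799855067094932665094, 61989304699913201171778271910, 26963447097, 89792, 1374556240706,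
4962050643426, 352149711, 2428843409282, 14077056949090, 1748490082722, 11119337189058,
11796934533890, 287468644555328308356, 90016, 1104611485730, 2650996209218, 4422228614850,
9199081511554, 1270420549605359396, 90240, 11119341430978, 80853199490, 5043561628066, 90272,
7782048887938, 16125401971, 385471132056192467, 3266708296290, 90400, 2695949843042,
13770598590914, 877656283587251088765, 7219756146914, 11591702602114, 10196971439907353,
197983470561601369201687, 40495213971820477, 90720, 27000555183, 91040, 338517683566697269, 91936,
91904, 91968, 91648, 92256, 91392, 91712, 92384, 92896, 91840, 197074693581053493, 92992, 92512,
91872, 93344, 93120, 93856, 93984, 93952, 93024, 93568, 39712, 60181678567806499893, 42592, 93696,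
43104, 94624, 95392, 96544, 39424, 43168, 96672, 96864, 43968, 43904, 97568, 97408, 97312, 98016,
8212859, 421589647232064694596, 103975416219397122436, 2591684739197616996, 1233319161342833118852,
2208309920799581028, 276079138981204676868, 94956327431259093380, 1728034875740798714628,
44991498262846442148, 1567290823216143930468, 1199124627847195075428, 1147282782764769968484,
840329425410, 24819347, 1339372570053090617060, 1090573648258, 7925439891138, 24852167,
7976018424258, 1841703151712898582436, 2591685133523848996, 1738232992560143060100,
94959055250323060548, 533897525602, 93162296940149666534743381958, 901587748275159784516,
756531464678647077156, 1861196735267917818692, 775735324041653905668, 965404195158809940228,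
1430770541954, 7976019166594, 10586416720422521481139173094, 3859973529506, 475942735284017785668,
711145853758573530084, 207530482400401652345028040678, 671774459, 1756633510852555237668, 24847389,
24841799, 24864247, 10489530526274, 1949118303001182988937170150, 1526084833107832709988,
194880682259007545667014089894, 1105703136824718168996, 1828605669930897853028,
205773276598027669743698215302, 1244166912049340662308, 671839259, 63350219942394626916,
939319607618210004100, 1082452002705082359812, 12184884800546, 1327985438965770459588,
26253860866323570372, 8126207624478373679395250758, 2209939492035830628, 1102906204013876591652,
431234700685296075268, 2603150694786, 428935188171140396868, 1621747831678679312068,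
730651606218871813604, 9304724229515604196, 7534603221602, 1575298915258488162980, 5290721141,
24819549, 93162287622793834242870969094, 24809153, 4014573644482, 1102908507175847117796,
12606661610210, 9142820558370, 26253865924305730692, 12606660231586, 2482289592130, 24785973,
255914786080586472036, 3986447753154, 1725076396246497824868, 12013396859682, 308964256226,
143465992888932386404, 214245327, 4321065885570, 252392252604068677943186078246, 13275807840674,
11040602012130, 12842829923106, 2482288213506, 2656606257314, 11796935340898, 74549191,
75376536285037201174010434406, 1486982292162, 1825927839420289708196, 319447717553364372068,
52303075519, 1580018605161965550596, 12997346896386, 74568391, 74595589, 1218408834097200309412,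
8853231042946, 1754709355647171940036, 94105186043, 1332233991466720332836, 663194864737236814372,
74586789, 8099737467650, 914853457830885245764, 507455823126156026116, 11206491201986,
540932719484418961956, 24840455, 3567554494498, 2196448571, 1045080389,
219957758376570186548071038342, 5785880662818, 4076414157250, 207530482981179042866035870758,
8126021339825503034147236102, 1115299809368766826308, 428159730061, 74552379,
1120918356881695239140, 11594505563138, 72226741020790182054916607398,
208669545353795156371097758630, 6134495275650, 21912878768854035, 659865393885109873380,
160278444278959674651135310598, 5870209131330, 145464881334912077028, 709920303130378970276,
74621295, 5493452401794, 5546844282114, 11068745295586, 400028932578904145540,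
557469489894539861028, 24790955, 2547671672949859876, 775664293503859740644, 7998511417570,
158067866682847056036, 122846384088370500414158650342, 12839993086306, 612857787430172025828,
889565842428880254724, 1528224984437684980516, 21190045793718033578793689096668750184,
11861570006306, 584476536514, 1788943614339290222980, 2794362556226, 11692870915618, 5493453780418,
20926864793780601493012431206, 10140942266754, 50343678069389982281744338310, 1394225818210,
276248461581093325348, 1412770869, 440468301558361211940, 10672298422306, 1715478390673231599652,
12946832734242, 662282764279436256036, 5527190140834, 272398004866, 11400510419234, 1517777921,
297656533043523248772, 1525591929261929256484, 45652079989981760243,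
132254330461752946036351560742, 5456902375586, 47684892114918121, 12117451476354,
98094680396249133, 1222677111682, 5811156090306, 13644126650178, 4279746721698, 74574923,
13070580941122, 8870163674722, 12572950171010, 8993881604290, 74566923, 306060505147,
1861355648224002881700, 12859735512162, 6159261566562, 12778174419330, 12615104781954,
1886031910981602184772, 28083930530514979998173062566, 721848146686573674468,
1083352493993623644388, 89530003688889307684, 9097858009762, 3387588760002, 404556719394,
319052665298954734564, 709920303068353297892, 6134483716418, 1636417550783241948612,
124734910854495618925262783942, 715583003548068370052, 145866781058,
105310736944862700015836028326, 212482065313327, 1005390575442628849348, 16796095367,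
13571051836258, 505765961922, 1560103608130, 995275973308663639940, 2572337442, 12834434899298,
1818931918733454479012, 4295729852994, 8867316074434, 1177748181250, 8906677698498, 6396009910178,
5443867727, 2445287789341147, 32183738403739969096464960542503747432, 7973227453794, 1132694350979,
5923670421698, 1388428913920656916676, 3039010308290, 10287111567234, 310975500150926725700,
11318945031970, 6654631023970, 41613066351241260964, 74638983, 146862843853, 842116011602672297316,
1517964666118643221348, 41671984591, 2636262198847929, 292397028112696736100,
1537805372583549440612, 13509212225026, 586603361672440832324, 5791161906562, 8622387294786,
262374600756399217188, 85466502736997095129679135910, 1018756980919828348836,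
994360622572161382596, 32183738403739969096464961031716109288, 88096154566936852689860645862,
4856627411149913549, 196232824548521, 137471492770, 10996738978, 137961620280121997391248322694,
9213128263746, 7458775510498, 947588312903576944900, 10703253994082, 150999518711, 8929152185506,
105260401288693598535771161958, 12300201822626, 487682667519, 18090035511, 12564515539202,
4742833206466, 1512396731471326442788, 4332247219810, 323015339214501498468, 896609368738,
54394325119, 6378292300347225533, 212100918616806525508, 7450284669442, 11276851506914,
697218330822862330692, 6038941787874, 175299921791379148502102983014, 9859783516290,
12488575361794, 1512335831, 370805935810, 14164269714530, 17989683727,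
148732330124335052912908072422, 1501549002964267543780, 11591664699234, 13112747960354,
9348057164514, 1866339067539747315268, 8462436211522, 1979067920642, 8006973254466, 1360115725493,
2392151550274, 7612790029858, 43102570819185618998848745254, 1843775858610596461668, 4011778435394,
11569210255682, 588951373280815350500, 6668698876770, 2558186135522, 72480757632228033333855557766,
163103138069, 199271491347532747, 104005437000999654545019740454, 366364692574702778148,
514208973410, 226019793535001553, 82384491909, 4872129312482, 2127740282313, 3441000526978,
10478471941370018436, 2787247091779, 93114254298004451744352560598961032, 4401939463027,
6539398314978, 6893652931554, 3639107586313, 5428750186786, 1706353294722, 11690117859842,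
1313078128395026863908, 18139833911, 4146732363138, 9033243232034, 1737239081634,
42160819176809480620951310630, 2279920212834, 2614647413026, 251258384810263, 6093695300681975709,
328256316816168423396, 193139820816658405567951586150, 50388397189, 2309378579770183, 162780389431,
6834598777058, 228497908657654250558785107750, 54419505991, 251538927545796512960382255462,
97178548962715595591431465894, 93257202299719614550458626406, 632416721174084631428,
12652175029511, 730695894818, 245753514801760996, 9789352796546, 7450327040130,
1731880778762095091, 433272686991, 5858837496665, 5528311277465, 54419462719, 4245182868514,
2503624098, 7666815967778, 3367921945602, 4945221839426, 12109068492354, 606979292642,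
9610299977602, 12058460637378, 10978992527970, 88089639224551193998926538598,
55685983657823227392043580486, 550869683141885145571, 4074037929509, 11147483927394, 18139810927,
13618623649378, 224236553267443187, 4967673740674, 7034152320834, 1023147859394, 4723125513218,
35530071113, 1596707884514, 32169450010570231, 162512034183, 878040089169851896675, 2935199167,
2198305992802, 5577659022434, 11119368481634, 25434877808757074321, 2442901143810, 8721322288226,
645892203943, 9300258948738, 8203833076962, 4557228956546, 3590847037509,
10080777504543561874960469, 243943272881113386992042931590, 672709732364428795, 4653139917,
9353685985058, 13877512158594, 1264595853266277, 2611670917122, 7053734564770, 11119372300642,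
42176950227, 1317844003093166614244, 489776021953, 54418878183, 672709732361663993, 434684523783,
2755021352386, 114980996066, 248641813841446255023025, 2038077485698, 266804402658,
330433794864626630366105, 33585432729424191178637571, 114980996642, 942348827551358199,
163258579783, 37247409390117493, 44229410016426829683185, 98976, 13995575827842, 99264,
54419547827, 9389231160590885493, 99296, 2932310929493, 4351324197493, 100288, 100096, 48064,
101632, 101664, 101440, 101856, 101504, 100448, 101472, 100864, 101952, 101568, 48864, 101920,
102304, 102048, 48672, 102112, 102176, 101024, 102464, 101760, 50016, 102848, 49728, 102720,
102976, 50592, 103520, 29629435, 29630363, 421589636036883824868, 369745809241127015556,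
2598925231259660868, 1506553299873646322628, 1009369021029396211396, 249016764450628908740,
91249304619886134030043257894, 1631143248358234954628, 1088421530271702387172, 15136598273,
607113198219907, 1196857256114308476196, 88997899, 1872888191554956858372,
117424344703316007335625842694, 70272473966001249249979973254, 88997915, 1343748107366940523844,
1312675405118873102244, 88903503, 105260876805551879312963559462, 103754895422751234959444665414,
1718277938409124423780, 97263028675702106148, 127044044680762635869757368998,
1180725979078561028676, 1407749726122600076292, 1455885905541565587652,
158470821289726254694590483078, 99638745974167544911462055878,
25134572713309020900665732942453108104, 7779270389314, 78941186040113482701071678470,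
1696237662192786550005052070485466280, 2238582158323271236, 86858824865590140484,
1541750909495128294916, 20776269957034395705533705830, 210978463044304667489672745606,
622794367103327222436, 2141527142988549932381730694, 103754895253531211154150008134,
132813598344456551104547751174, 9127184387174759226066170758, 452015905578350919428,
73550598474301103790067690022, 13295469520194, 1861672031904870805124, 13950092657339,
741133546877824929796, 96398334685572785832078075206, 1512170278652943883684, 7183230256482,
187357016061397954343380817542, 7301315128674, 4548801005378, 207331085239869736516,
1561610797165342543556, 870153921674805594308, 11167200692002, 180591027, 431237445603688146852,
99347974704361, 252041362903626941127111874694, 215998816408117625339052789350,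
138582814976406172513196676742, 1065294571650, 58400147493, 16223897205,
105260876550207453848153135462, 7073540515266, 1569552696444418985636, 228875088727817,
4669701876162, 74435981710435713428480877766, 1298640504428158845828, 1667558211981450842340,
1226207239536910594372, 74427220688162369873928993862, 1745669895241377767812, 2403446815,
29133425541644759830252524172423315528, 11321816555074, 61503524448991729,
86354929050866617828355664262, 31870114866473854614177324454, 5695965050700335465, 22797490014097,
64275387849, 118814015887462176526845494246, 11110919905026, 728355908772175859716,
528282743226550277572, 14119271222658, 711036349442, 11439908744642, 4672482825922, 4073624785794,
12842829985282, 1566565484937521119588, 2920871943586, 1489812987266,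
20776269589361832889515847270, 6232888633890, 768388826885231872196,
1696233985300841234497596024226056104, 1516303958027, 7210526887, 1512235701076038324580,
12694442863083135722944497510, 528869381083806347748, 281669257209755570308, 157731637991,
64895262511, 996265114489725383556, 13000304000898, 39100032343551, 319827384557449333,
66470713835354352363456152902, 248812969920149924384861916934, 543624964171652851865,
51216189080960810468, 10498036062658, 67026907, 21965250947096763616511329688924956968,
69438426041660300740, 3098056040738, 96576504509724638629451938662, 11827741127298, 35282825907531,
1760499570512836741, 203197751019407275935663270502, 1526399282114, 1312918409156147705540,
2552608863682, 229574381776324172423644255494, 273808736404922015919551425996396776,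
81867307285268920580, 7658378002370, 1572881230299278985348, 29687126050917632671995312614,
158464398124846054259302249990, 875994398753360411364, 1433461860924061824228,
243982022728389385742053205574, 233765548647, 237718627690756856259895940230, 64895280655,
7210488851, 4815902194082, 48852001287, 64895207215, 4279793126722, 831920995106, 9440917201026,
13540149192770, 235890049424384696342098240454, 518330054789, 912811551692800701316,
126040073016362997733794358214, 44991823081889, 148933811687342111714258976518, 2701197810469,
2650964352807, 562305760917, 3508423437472481828914947014, 9581493368898,
89341843995239752710682146694, 9507837890523526607, 4709917998487, 11602940206050, 4999097775513,
18693294145223982500, 78416752544865299076704603750, 3623814876578, 178148644599508085285882540166,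
321713265049, 5695976806044547241, 453315718667547760580, 242623258950781811530331406918,
2052161405698, 9705129430082, 180671950954851091, 4640586916330441768033058022,
98684843594919889587175512422, 134190962451705599770103680006, 176860340077168085566896223494,
49059737899669993776305513414, 50744766570227087544727562566, 9699551623650, 11535471143138,
692482958019587745284, 53803790888621405494767363014, 1007529039944183223940, 11144658387714,
23540912102025, 10683563698498, 13970259360610, 1375166523821954277860,
233960530452656730490580946918, 1616337848898, 3750336450498, 6873960353378, 13537330118626,
21631735719, 21631658445, 3978031316354, 464589066115744124057195, 2434178788199288743,
56122061319979563551097, 203800572784712800869818789734, 45488848302027, 341828160827595227876,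
2566984989909775, 7261970207938, 1394262095810, 236476395024192702766404802022, 48336895813,
133089286554967201190108708006, 7166372920002, 2700455965841, 13947693344777, 2608847284610,
914857402131689099620, 1691058898384183556676, 1233104956149454721380,
169452222158303606479126440710, 1825927839420160447492, 11656367931330, 6140117473154,
928406949439922019620, 3755923271170, 6657483192738, 12561726802338, 77740324419376523421061381318,
8993881613794, 1088421530156449102628, 584057853529, 1088421531310588257124, 10278706740834,
3895859143319, 584057864955, 29390861275166873217515025608626533960, 6399677164002,
3076682701809061216379513, 64895239833, 584057796251, 46420478360789, 11128346080797, 801147019,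
801080239, 11128346132313, 986072426231221387556, 219278436348720281173029853190, 9052924049890,
5256521184335, 11476421336482, 84447315886313959, 4149844105500650983041437901557087278216794154,
10354640609410, 1278873008817290694212, 165951130109692616401624752486,
110783094171335070434481402118, 170619323307, 260818979889707092708, 8945548532762313373083,
6435371543074, 93806900735370419518194497094, 1490649059487225636, 389664447765261975617202587,
2722042349897, 5417540761218, 1263273918781500798170807, 10711715465666, 14043185493927476715641,
243924420776680406963630835462, 21847816377292925804430349497482589224, 940257524198461,
178106323879, 131279632357763, 446804873186, 4453030726371399393132098031058393960, 2113977898562,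
6961145861026, 159927731834784245617079855526, 57653865015, 8321916044514, 5791161916066,
15247794792945645419097, 13070580950754, 1738967652436324034965496678,
175688685909148873420113144838, 5338853727970, 1730782585263, 3418607543106, 5979889232354,
4526497733122, 20616555923483463940, 4962110096386, 26620610421500074745894478833149419912,
13388367781474, 11541094604386, 11661983597410, 162512542766694430432570684006, 9266581500706,
162820101602, 1744962722739, 11276886141090, 75191929491515137666108575494, 192188929375,
1447856422658, 4852668652991, 3314722074178, 44767210985055150682991462, 41340400746381,
15116597901541, 13112747969826, 2965849500770, 13525910129026, 3621050260642, 9387528185666,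
75191930454007128545853782246, 206727471147257524773078004934, 576789443314928015620,
6069911790082, 194685909589, 64895247647, 7540308191714, 1995942286914, 9244116505858,
28273029070118585434479, 30622153667408033, 953799195155489116236625091400329547535695114,
31067504238583966184528897827, 13000315986178, 35700749020274784170801391750, 36752147106661,
194685942061, 9387528186146, 1377206567382589349284, 3446657770978, 194685854321, 13059329048034,
7810216789378, 130156891135950362103117570694, 14004041057858, 13346839226114, 9348296734338,
6761675671650, 370885375490, 4665252576843, 5040112809433, 151400430437, 7180446338722,
13484744416450, 581089373981654312420, 5254917847595, 12814748369890, 636103880691919,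
7101723090594, 7171980792642, 582455496357, 11259982196482, 1104606992770, 2855394225009,
13484744469154, 9474816241122, 11833524985378, 1514272575858561860843, 12797896602594,
7849578413442, 6384763740706, 5268572007682, 557340634358553991577, 87579458451735, 584057821385,
3681337791271739, 194685902139, 4262454630957529, 7633072882274, 4607557967371, 6263843253538,
565031479938, 4862335594275, 194685894529, 1752173617599, 946224412588052162667815, 6587359908834,
4214209439010, 584057888181, 562333921383, 898281066302857, 17878658343196856404503, 584057842371,
5799886435010, 9241165349250, 2692506967444873],
[584057852867, 9927906324231, 2920289509331, 733724154914, 194685905007, 12882219184962,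
6539398376418, 413043434306, 12193391345058, 986386021083769, 519162561131, 908534468121,
13731371609410, 5255985423363, 128094977743214259543155412582, 584057897839,
12766975460885351568367977446, 14557630282543, 5691611784342123, 1832466840507690325, 733724155234,
7787438325109, 13060061627490, 584057907419, 8557944028363656837693, 584057822473, 30926226886011,
399758238673402327, 9623697985538, 47301182283069, 5310733458178, 7450340940546, 14596634036393,
22433990451620482584118210973471169640, 77320773907844239300763, 47113736547031,
115926871617159366717, 540794244111, 18291253003977985204624078553704531432, 3958435611650,
46914511673815, 6041755253154, 11600388536610, 336175268064989855, 7652782331362, 22929429922,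
2701655832610, 573266375170, 5251113997083, 5255779286023, 43804342500467, 5256520422847,
691601077651342283, 9348296685250, 66636919175942721, 51648, 104640, 104992, 105472, 105600,
105536, 105568, 1504440378197, 86011835, 62718531861, 210872957940133332386429735558,
114409598283300666490494274182, 210875594578007579475424987782, 195919402427619868802502773382,
130260376318603719385633695686, 121773067242112880842172942982, 88276267624140703490089644934,
564466810519, 37091898450453717232321436294, 15072658231217, 562111725751, 1506540801770805397924,
564466820661, 545404300332375705252, 8649914767512246979398420969448274184,
170551663872352378549537095750, 632632947699778284868, 33530283104859874125950991388660093640,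
234874144477086860265207414566, 31256321418142076040639761318, 378607467638800372708,
138019889693227836763727366214, 312863478875808439556, 1589090075515949339364,
152119539673095364420, 187983499727, 155592499568918017766587359078,
2031662514350766118908104328725175176, 128246159175965147241710169254,
99385143036241061575965927878, 5080201777617, 175370722146593732535030813734, 774282275,
78549635773680304080960765190, 53670776070334059762790076326,
28177298288830221464714618532403892808, 21818335134168993907391646342,
32275430946219791887585397382, 774209435, 20906157547, 145921663596907509190642967110, 20906099435,
249227839402063075029423284838, 1193504200861248562468, 232285781268231128067217401670,
25814903609139306048877722722647228936, 188155595637, 62718468367, 48804527955386020306651913094,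
14836468263868139812026561959293808392, 188155585547, 251336102298683677859914099430, 188155510865,
31662940794901556996, 950833854022105558404, 188155549587, 188155559729, 1011581794555501762724,
663670296218605613498988998, 803924101215501589988, 152119539771499424580,
125588776866551512637572017414, 140049090109386476896988559654, 1801699660284304347495379750,
165049294708765435981, 3008625738184127213096032029891667336, 42321020333485,
112561601423587734304076632454, 44592192254975, 370849505049625, 60433586142619335770866263238,
1693400550551, 45721730477637, 450895115479482101124, 9490457074222436170424606452850382856,
2322896595, 5959468265841720797578433318, 581711614082, 143182705901810666386152310438,
5337586121138943531120675462, 785159002722794868036, 15287465595947586859337780358056040392,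
4663031573708947598390506374, 136785530446383209868018830150, 48606836485,
6267024820676596184959436646, 31256321654679548066325422694, 160476757878086895935573738118,
21076503656254319615117757465138330280, 806741394871449447243175273227495439442186, 5175798622786,
3710972710498, 1693400559785, 616962246894967, 10495229772546,
15660143519564934888800525021550593896, 1131352848882408324996, 1693400549643, 1554017500561,
9522403049095482332554754567282752072, 15240433389097, 14102441516450, 302344446369099120516,
411495574126447, 12722028645858, 25646214296336746033910231238, 9552478734234936633889059174,
21968931029914888328678955590, 71176061929021478089965491590, 79258010569356097602260585094,
7941879426582403, 522138268511, 849545175843614864224137113553847944, 205988078767967,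
1633002841531, 11102485223618, 141206837883098626745467775046,
13622331659853099341969183074963837640, 411495573654383, 10348270658718632100165683303123354952,
193203061591600454262564688838, 76413719550296643963724966854, 10152221334210,
59630409525468921218826743878, 11314654960739998038415276339027160648, 5080201739049,
100765607086694239964197283110, 1701416354248001648484, 45721815942235, 45721815455411,
64663184480399828514433374246, 5080201778691, 1874342566743379, 1693400551593,
227745407734362976347370869702, 1270050520793, 1693400542365, 926836790707997, 4264894024482,
5929281381026, 15240605412193, 45721815863865, 76363211286877786732583079494, 37075312922688097,
794365336529464275396, 38143846139806445959125483, 5080201769475, 103254076079955, 411468443175327,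
5080201739045, 237832841758887449442357113766, 25978136955300368032802813018507948936,
42334955659241, 13591723532810782737, 5080201784223, 4343562763938, 75894709980965691875608205062,
220695911708394072979833918534, 849034496194, 1123910986775451, 5080201822077, 255115699867671,
45707877926421, 256335617634, 5765911308674, 133652675638755, 5080201778779, 365774316340241,
5080201799949, 8058173960467357, 76202252342781, 135994524744365, 1518182105282, 5080144455349,
64604877253885283876, 5974266147490, 10597258251960188503917, 1693400535109, 8515938622889551,
11827741132706, 207164527778750667053632124646, 27560624837166768560751051138113513704,
5853240362294037, 10759525143650, 5080201723457, 5080201730809, 2712996899564312471,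
619784249805609, 2398484841161461736958967752968930632, 5080201717899,
26999287682895590531684973481416043464, 7846754835202, 21738032608457115043986569288777661032,
685820200440721, 132719854004168317316, 6037353693674718365317789670281544, 5369830990146,
247439477572770606283487000582, 25032058141235856184809477702, 45707877926477, 449616422434,
2468270008322, 10354640613986, 6277917999042, 787715802204290509092, 30034215143228377,
251372810565656237, 396820208288099, 105535755969078351005845, 12856927216450, 11777515845858,
16237887784300324558367301505, 213360733636717, 28599654685087,
9490457082119640969071003552547903496, 411454019259807, 4967733189826, 131520522398821,
136535940873517, 7169184416994, 13295872079129514353410107083777892360, 3907849053017,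
5018387918274, 10431430745961345041, 1693400545289, 45721816323935, 45721816330413,
8934117333027535102295701, 214986603936402011311671048422, 45533651197877, 455228218114,
6657483251202, 14682621349423065229291566610513074376, 262081356393637, 567215433983509998596,
80975009600932005, 1233735388515345, 5215166504098, 12561726860802, 1701416355127133099556,
45721729966833, 20165650537917051549230295351503205096, 15240605390299, 369489721772144753,
15240605435477, 132273403082941, 84372641800272554292855359270, 1184835425930400723300,
27897794401443379896809043808338349480, 3623814829666, 9010734289826, 11206404492573897880529,
1233192853975313, 105112635344659878090404557, 3703194316988855,
12480351841613334287160848761240961768, 11241040223490, 381605781215652781988, 11740628427362,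
10670265473564165197292353888012557352, 9334930378235274763756966130363698184, 42335015187325,
9699594260354, 11614413205078850959, 26727299234562088691592264285, 14676138550363,
226908712809641, 16425013313515231, 205959361847059954992925352614, 205959361847059953342720696358,
112182359923767795456115473, 37903478955155122705282839414818408, 13722892650018,
31128603388086125097439716285995355848, 15240604366941, 12575828434402,
2305200268471190058614168294420104, 2152682401186, 243982022728372112286819696934, 5080201713559,
45721816338903, 132085244191267, 3895499150751, 6871152579650, 5080201767031, 45219303305021,
32925923406859910766454709537504965288, 20430947558213141497704007370660187848, 1616374176386,
3761630462722, 110545977461287532419, 690314187323516090539, 1563315557417, 15240605391281,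
136036449651057, 1630652236049, 369340833094521205, 15738769106394934077245, 29326475747195603075,
3044636647074, 273578186768997, 1851625543693255, 2164800347714, 10857977721410, 134886675520041,
190805315337787713351205616033, 8307858327106, 8693029753474, 5109061555906, 4222545611426,
9958236529922, 173430510058698423455508535398, 6880334638786, 12894228487586,
546401892188123703169649640945112628369125706, 591945583981528513796288844815649407334276138,
11323615983106, 11918622466050, 45659088216609, 1600253872962, 8870908146210, 13916896225282,
411493250291991, 45721815683595, 18092513709901102868754098881588567304,
2262545859822133109796153767653, 2521689409282, 21886054964008384904731942053144783400,
8338080469282, 6761675676738, 1810949386412195323763, 27035863336301361747441921684014625192,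
213340601751365, 5690310910562, 13666622309346, 5332935088546,
20674967457791369105575157837528993320, 5378724779932239343743937962686189544, 274329330782195,
3703076882099639, 45721816353873, 8608730395554, 5912465245282, 885261513070025357804021077,
4939617691970, 45721816381503, 45721787676043, 11710031194498, 11941114823074, 5080201752579,
32049234785803855, 7810257887202, 411496346908349, 137165449269751, 11060049746626,
5566818120825941025883259, 243880168836654233, 123029147226551655423, 2160351937759612541,
8994079134274, 15240605440525, 491931272898, 2254806785634, 15240605365845, 4078984511554,
15240605364879, 9348333697954, 15240605449709, 46179034594102713, 6508636718242, 5305130258210,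
15240605439657, 5080201787683, 5154913828917649557727, 15240605438731, 15240605438741,
10805459200008535, 147212818053310588589, 43618047278248824315, 13284124406402,
24894704297224208707, 1410554880773, 1410554881541, 124929208318100389,
22317151842347915319727225157471230216, 29295249552541, 1302197773973, 28563737774195,
108252158594339259929089176166, 218872457029766689, 18689543346379097655559761659508224264,
15267867203272154353015199883097454120, 28720767340043087615508866984763087976, 329597663597855,
103434775971362947049895, 28412172244551286819363119637149960744, 38084983701531,
374402046145666327, 12005464336374385151171163712419182120, 644894783,
9983134484869124563103318783035767432, 38084983709979, 3813149321005, 4231664807491,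
36725379849409, 27763927355272709, 28217284528629674726912340252286439976,
1313204949265097085342933930429453288, 17412162471997248978281440294680840744,
20329953486036710619125968447536790152, 26381476175126978851060186342,
83196822008340063345846608614, 27750787302790707, 27649680786058757,
26755376976111673421995484779570106952, 27763900911520097, 1690528883214444272356,
27078417964433255, 76865021366736609, 249536938847759081, 17366223633156309, 470184932625,
203645040736827011227304960390, 170262356941816763624800870662, 83168599369016928296896268902,
17366223633156339, 2599959641016766154894803, 302344440870612025956,
118125693128867264780543459494, 3391299340049425428909276504848743720, 224263502752870263781,
221081447963160693, 504521415945654451496638054557424776, 4212211250552764596379281, 4231664800007,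
25489761641639571751139923078, 443304455122236990018345, 4231664800801, 152005036081451694355319,
249875346170417783, 13354637003237799, 14394086078927995, 12694994490927, 12694994551599,
12694994560805, 12694994551595, 240603843302978423, 12694994552321, 12694994490113, 12694994490923,
12694994536997, 1467511431752303445108943270, 69131247365453836322458854054,
1011586569907926697124, 2867295261159432681650306620920055874162906250, 38084744819381,
148382809185922888268511588646, 9254651048809095, 38084505900725, 3084883683710293,
246447929822974583, 247440123231337865802348485574, 2506086658468736804036013, 9216409339169425,
38079178686375, 1143942086886670277720422529861947711653995146, 4231664809419, 29621223969447,
3084879813951115, 103756314100976625841183916198, 1028294561172655, 3083943313794223,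
25550611632159953568918105741133847656, 241868085524882958586946043910, 2970628732529815,
38084983689579, 490140557607346547, 685850018407611007607272892237844277245260490,
1028294561219485, 3084883635973789, 374819715074058007,
3346304581591793991168197839035654507737547114, 5686111520612222759565293205, 24433632907427189,
1028294561196521, 9254180221359553, 8226339075790315, 1028294561173475,
5026411770054687569327562652662380232, 342764853707807, 8911886194927317, 7118611770882,
1028294561196517, 2847297646830874517498416765989391979058956842, 749455587722292379,
8911886194927347, 1028294561178135, 1028294561232653, 1028294561228855, 1028294561220367,
1028294561185037, 60883559954666154917578655622, 10602115500642,
121202230786031235673390460486053545736942666, 952120293897049],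
[3084883253809545, 26734246103008841, 27636533023327825, 1354898410946, 360817136053683229,
88640019475838025689, 30431568850896650715871993109535067304, 9140396028405081, 27763482968837025,
342764853733341, 4399300920251476487448667708793495027629253066, 126437913742338647,
9144627764930049, 10121374942370, 9253240496403059, 25707247936628445,
3405677006161731450201406645437991707498265450, 9251829941427051,
4140675655039075505109791120828177727304080714, 342764853724257, 9254651051331403, 342764853662775,
9254651051388297, 5533087663523063074215040418789148136, 3084883683731375,
390414255743925429799501, 188176846473281219, 3084883683732133, 9254651051388257,
42160077011921421, 156300772094380621, 137446825616155995, 18635208430112827158139196774,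
10408152542146, 27763953153416137, 10615502204738, 15424418418960841,
3464504079690714900353571713608906001922754218, 4059021398177383421, 11241040225186,
10857977669442, 1028293629588397, 499734230116655209, 2248574585202953927,
1947510686371893706160932338960374344196360138, 1628263127555799733518846602080996398402821994,
9415677253826, 840085179184891916740, 250939593495125621474239919, 247133041185807927,
749626311488855607, 74032959332153697, 1156706119408230665767579,
9285543826597347037970036456841323144, 42840973548622532460187, 83291852941224013,
83291856571925679, 3084883683731543, 3084883683725403, 27763953154170329,
26442360913235795177312015808792609672, 27763953009099841, 18381985868304576698565, 3761630516738,
102640529955062900852661, 27763951864274521, 2246594165619658551,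
3613620397725759599137651688824479321913385066, 829204763769256757561749939841028311081909930,
27421187655557371, 914313370934448381368709, 27763012782457995, 23650304724124335, 6287114218402,
8603107307330, 249875576355785403, 16195639339966446225, 14270671921273304661, 316398376134911,
154382044557102278305411, 2972623803056709375542452172367809876431357610, 1263870328490258574289,
22046669569676571166582879372577854312, 21999716704126719079454370213169135176, 2521689409954,
20728545810033, 559670347207971, 559669956677259, 186556912581935, 186556912539317,
186556912546423, 186556912546427, 186556912548913, 186556912539321, 1301289912333453,
15111109919853099, 1676680594169227, 15111109919840555, 135999989278885569, 135999989278873033,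
2461476101820108981910781720561081699147259754, 3989823803725485944196113393385663551820106602,
13618426798656493, 135999989278885565, 3603309386651955433339590938375712004547719018,
15111109919842249, 135999989278865915, 172225823375581, 14464781609230855770140827110963009576,
15111109919827625, 4429163033461239103690445708239656629579741034, 10702417668746628873,
407999967836695973, 3535998583883009713, 4091275182452948372395480242057191255020815626,
791665541854759399395166172401827496987483786, 2766588983827382026840962177112095013054705514,
407999967836734479, 135999989278876019, 407999967836732813,
3570543772620219820074121662810160553734261066, 407999967836722777, 15111109919869497,
23609194568985513985367594858528979848, 1236239902545335638247, 773003767240718231651585035,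
1210127904603784011123, 15111109919853665, 25587994158684740516597644915230799752,
6386736942833433813976947881952863272, 1223999903510206279, 11015999131592066731,
33063141626522930105935621690541985352, 11015999131592053391, 15111109919846267,
11015999131591009321, 3671999710530682671, 3671999710530671381, 6119999517551115093,
172680778573523, 514702946457398818019799253227070673873129184171833900, 1262351900486887280591,
11015999131592066067, 11015999131592068587, 1105679912837577403433, 135999989278898029,
11015999131592088641, 33047997394776258821, 1224707282430469592095058909,
1516704792435863525378585, 4699627487033469, 42296647383381341, 42296647383391871,
2497574731342065364081, 380669819891050763, 380669819891049203, 30834255942494626087,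
30834255942494622063, 3426028438054946955, 832524910447355115433, 832524910447355119205,
537532137252488350061500771444502679630131540315269644, 30834255942494621981,
2045109988741835227106327166253000364287764586, 22478172582078588354423, 3781520264385067134262177,
46685435362778606595145]]

noncomputable def edges8 : List (List ℕ) := [
[525395465460795818277820771426702, 216515090391217400159444114572388788658881,
861568284744215954165126467491935846046043,
3275259728362464177413110558980099041645519035363917272,
1155068754023073347001810245653989545832247697580228494,
780623197301840011896614024176850036369369576132906200,
833574577889617374916660790343621081338101283845506879,
23785154303993409891387940541097303073734445491013240,
2649917208723647611551805008840991616371340079789507954,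
3437817367590223355656002257821832010147717043537552943318,
421526648533070541733225812303356995942358540246305197413758526982,
419809680274628526767464902983443588311359527589276564917967630176,
96727181709460169571734366449181517075837414990739573994045293485,
251895058298327108907780781998539954960974753353557111933176255332,
137121304704555369714211404041454333296198558909901428356635978805,
709970684115634489652522393850518800425402163261176212499962514627,
247793386012767036510055199412063882219944140987537168646943384929,
132784406166673172880393811006974737320298810455537592346387254666,
18146876671813529407186414537845230693033259042080433704865923955,
215088924470094551405388184809512024769976459031387679438101664750,
819958542032851329276380448434097403492741829368393036931419961413,
165455543256103979722896192194883750544792098913939283369638411108,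
300552489795319286420230692358429559886664687454846829748439709783,
615303206771782966556416465970729602744041957324701936820033944917,
81872981000229488994308744973277608900412312738128121773653488473,
279160329385364003510938980929477326846150134009618346195061128956,
235572184478891166954384476207808750238358226377936494897770820424,
731625414298946495137123652640264401958549110097161354930367069034,
1602615031478933311335682400722364695506903212995338963509916144113353,
263363168068655308893347905145538492309430718491903473722039819326,
2171360060134122723869850168833923866153733967814618445331983999090644,
51655252954674920596495847695669173249040186826446879263989580261040041510,
49935503144931377176000650427429318261599286890170144218658851295299100654,
62208764585011262978302763374589547862707785452710395911933050111649004949,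
81575137764204880520384269631672380819265770787337174478973588008823481967,
154632491623701661952455038746896685067529543364341020119361926581962264554,
149378917463369111153864374321108933223432466273881597683694194069954760432,
96364689846921803625770681635580446431549359628129250499792624998941209257,
36973763034395916406405448888953334875278870830133450641614188706602557666,
75165850248155499392129750768630321388273698674203121857204554124037627682,
81494408580189712069449261553543408486373639030963313679642212742250561569,
51099681838268858770547396043945327292778544594242059487449151181778637598,
84778863493693056807247505258465913633487202554295368880247441685033992629,
162950155505512856025551601149598166607099995516299407572744566388342842230,
1153168622099639302425185297264881993998381057832700325395239250486569367,
162814849915996725721661229053956534441579263267708462687342280341873508734,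
257840217009734297696919359890278376549666190457445105997333502056074575676,
1129868893210247474473504545079744903880525006788718511003250638789072623167657,
56464259739167416254221864063005307151441550953809312738907342984348880944916203989,
115542153890734785036676269476284614509544953378180717104721418291726826057,
1568385691190128838139403781254807540621086953670979408991192059529755403,
4775468691499499348244198862965778699502623373220644974644528667919111936,
75921458267213197476062668785816271366342085130764392474389853597634145460,
315350359335489365279975602327856057696063374850097531885017159927348454660,
115570218616773655386457018000590342256230962487725256687393452242568675115,
107063454620898809107454794737293218473611635980706793132552425334009697170,
56527021464229913964727252046904855702753429024783446076485647043186479254,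
107063214621901524921899290448859625956014180050897389122467328513858009579,
208149593568506748395321633774493084811823012221406255718692402903555935979,
12512346578271347203171798006211680237617058292712868272920437191205609493,
89691440353006973930736031621564518223421298962613205833245345124762754699,
322509654720244605464033508744748895739301288557988833472898812844633183436,
38082286578597659751660300684512126139582329379294312292713886042879683581,
107199380550011235533318049248468092227846384679177093024866134850380137136,
53550550689977127078677300387069726893395772951181467098989012825057387777560963684,
2002298522188633614585347960103462853031640405331344868092364717193323607748928,
133940996675309861562789542011165382850910008754229133051078919161001605082,
125004159869186198911360703039439073518069305971160016722649541896073659939,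
40238832691929514178519913848347435695685248735202548980995895827077116731801062147,
68823436044734721968073082508789172039163782960036346349069349227993301,
1514456688109218100225512874563039078249497035503651759295981833579951044505418,
131550424691557751759448934115243554284764495688949960558793601224493430080941733,
1689105260608433544651630507908454523872933787530060460678868987892686291830893345101827,
66292369121278440540814942677251139007617318940329325439315242804657423724363221682,
7257378881074280928469987798351679917569218835461284726952833300193411252556,
62744136909209782150013417434007048122538835960385138934104840361981353208882910293,
70914277157359667213845123684229434637975823911845100361163236617994050405329260583,
470438937854585808513002157957010717805745521226307378944934820722894168681111127786270,
80098897811190527011636903218906874158608810401746363792413354269559825553237068340,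
150261782625079152645336045429183525302369300998460369285997772115163549903128642643900,
3662584799606830729897869951468245928379715379408283636857095187945577432764668177913036,
29726739722323844579002266316691362584052991130862816145282413552349534629466865978,
178428230710004098589076492213117829177966518745189784084318857339790807375122788944,
64355380647863704346842318764849962424865794768289085733311800565771109853181455964,
31192949711666084122766123387658163466268082903920728271169476426676862924453719165,
57522671341910793617451691740881347906566440720679595097165505616261792139988685308,
10537015651059637864632497125129204105586719521265464249391198657098911592586908444,
1187952716914913508972289480222907780178459988341526496984559633736286410421989398449418,
1522415039102691037833142769209745375510946245497514796240093425048724995998477752143557,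
1354256489105210648821381036766455018808884087322327907802759061239853798828143977847771,
247368740701092553147405835332978204194799725628826745401123462123415787628155163442,
292161624457839961645149232604450346235234086150429021856769812119006753949903334889,
76153035738440478324624791241015084620080380643162428798750310464255597017578896170,
31790166103142679648516636700286959610513725941475309113427514714330380043088745361,
136422848395240352676973992705964563078598339214819889267938333634129225618537046498,
1289536982150394765496279547053371035049209370594618608753283151246871468205859129,
135856833513897974494382492972381873399110997327102919873063696326234804178431054349,
86160171910581573979438421038182410951771088729848008488784866759930350428552639468,
74457856705828287845616886884264305948032583699969210664576023028455770784118490402,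
95334472323316808523291945759072467210706194130964112166767738856633053441658465975,
7115241369784280415503721738274760359879793968345291955922599635607627278279982501,
190103602402091334324969076904942766732589807023657318499999406002006042460679088258,
196075249406044098238515158830803449417946660085674191210079925370559224574174546804152873814,
2420810080824620165173411876328540532677105061495098208961063867638597960065875428,
45283798700292436462858831489245386490839586334972135057626438929535768194695616838693887876,
430098362586646942136920710704191610646427254920264676418918731151393126487833479506,
149611912460167324864002464091494705097283177506103594055483498319493132021059758320,
3325374888167872793946446626257948431152934626225442524125464155556829705541778947892332,
51223843965829301058733449594171209988297207964798483837399782111202970650794557743,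
62396089563117307356623436212208177378948095277867027412287774077510871716646613515,
5102482925236477349055427198477067759467978590869208032802346549297961281736906963976927,
148357212325431172534058857999183006002043967820110595201811121068706488579407487717,
148171717104239682823146020617621481806234977652729589576103689172169876433251065393,
159268686736146121137856230505942058212902858403564837360466346561167895852098766909,
1909105036204884712053959962952795163287799806392787400274429310975276824347941517804656527509496329612,
222628476708323377579214003594726650299363194464913599505032871860037112050157457952,
578453226660204008216126881936118516275825798588791960947809648373174198140292874,
196579945536523514635649979841232605518341535490339496807647339366614961630361334944154530866,
7164568732998413693763485908014487475842873622900951317224817546972389064871231769573287,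
5989916838199614481576961794556038932504743568306163681698031445121887295611118596789499,
458078085127658520413548544014303681894589443330893998556320032883293356725033948472072984662,
339238278810971997216303843025886079492738675371466862838530896115921800280210846704543124030,
3229128604717697619163049262407540790047798756153053709301915070495178368416480734,
207486865011912800786715837205980607805019350929950813960733553931464726537345170599,
149871559119923933413623416057422637741669448917810308038280286332427979481296540465,
40680329064723276031259561715458340193651343134066866876894336803291083807884214966124475919,
97446323116525093498492604916876245888636978736037782651273361547302666024192188093,
231843837113550180213907640122466611041747666314242729419949354652789930960550135459797467950,
257314470760902674886667375307472756565933601591229969325719686103001720235247692747256613076,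
189227632575418006028987609094744062917683240524679271661395538949557473663253582220139510749,
401296938975372594972592362611341577180020430212630091437521908089572073028126733412996732536,
1559451787906216590323303732694414257145772112597955011173230394188145957482799269972243245287820,
209286821932631697139399584240540925477987135340059257615458413620666289515482601026899675752,
18119833306421371800263827085391066895905046167247173863540767549794632178110938342293518,
3769665005923234053568910690081311155375372293512710574283095407297438816432754098137849082947818,
707021488583796990312047406420573855847909556583891213988171298900220480817336845546010154339,
158263556079814047376343018948471620057487169719048229147069999192028236511887286997183458859,
2809692794916322068998025837948560482473298323706571314178060828525361778741589522432802216750088,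
860720546660469914326662329262006300881194162135827966480676865550078874580615916030319896181,
13662840883386920878369756999312960811173315121892324526908582405597625710554520082199800617587728,
22220961589448024628093318501879079908443891310778286671025560071534463770715641091894282888665888,
12137136596251088818494194627665207660612760623556867464353038398028238545167151192592345598684742,
1402256516657115086688967915411923165059878566249869050300332646142376834840004820901090388821510,
8617084621774346636795807921948370197338268480737362969459098438966015546260244960696641278,
4802034729336331320309186858562245166790506981228098404692422439203999818241129663297081196668803,
365645696145362537785653135987020560729615441976184614871214100088096186926267307899907569606,
4928495124519317073944313158177682142637562738463965707670174722119348340203989874915189581683526,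
281489810513788988765005020993622635433751982631635993310725768183549235579555431384600900371,
368564332485983285619411568692575250270475742452077887002465431320392426035357276859822892046,
13997010492989113520320522975213807820674003120654617049794604586185602584100232838663957218198427,
121348257783849635525403531547615606269957583403517992952543534676677372350512925511008120027,
8864069610163172813673072896048246123646250708906986683358895111244697944399250696687447125,
158212577191241928754173330313511416414512525363348826581507401207958184254470184912327166222,
24244401191331388416626019066534438174605085146677618511167231859307697319984667477881295,
18628400772030193358405202637255445157025559530046410609275415709447853181370238666243322,
158128716742641577075573693255052377284050830130506511052193058116351041199430945597,
928847516709756859556444296563275392533985473180780404265541807756510141004172965420674061654,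
41136799388090591610744386338671436458086684998653099737746458749519775230995413545041021910465733,
375601408971357585303760365423243491249494735493570992147563572528878183404255800369,
191377608187244101371195730972170866068133631523127747870204759472206647962396976054422226327,
28615357604682547439733329858368845646621969840036862996696509152022838751151827420925096801042659,
102440966787159898680158489931329856198040391508628265407900474852170913399470001866129112737,
8867213962801558068678109188748906199724753296916903077882217606544314356444199488393130847617926,
8023191451306337911328806261186380483424081572133862962815748143180961063297624274765469472421654,
43615173058370426444166614190101751448307787010649871834849741909233579351334563299086376212374396,
10324272941632390312491234010996063657788888374714469117368394543303721088945947946769691810746332,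
192068549581471198171211908837282000993942769658787521290891553820658767881274876867379946979,
320127708584239022861710136187034543479046895736274145078767178181901237356150918640977473098,
341247954501085473365078328029252920577506773873678575359049241305934579344877691297153240528,
289240456154898995191669288603639119060490539693609798661158501565935532561304755353133129853,
4033869547026108215878273063277274208384861472087753911626115460802575309656720103049891039703332,
18013362141040950897191231106286538310999793609928210204407712351715524109508522465625893910680569,
9399858866441697967542158017807979937728494751212330634498543487725293373872010780364639452053800,
26975706764882829725367720963638108540949750045186008520486297414520831056680834120263365438915846,
40695178678615027858514960983023445704175560251792629932972283131352121553788288844412664203109471,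
26975706764875992142021658317557124445324864416615456554662855273521661973413862997519601570467429,
368201950706294301246150195047938655618522876678580745721815753214713964747350714574889145303,
4459822554922851215551333111970021510882380656308251484145167161792332607082998158620007967874,
193375930884928552137136423015835280535673697418680569931868037734876740253291834956685383173369,
122239970539722065391149102747423757554312369076823151678928795586475336495081326772959635580,
198951380008392558831675532087217787607719961566918564902851864592815288397328158556732538186,
776586241434962931388292328496821294349186515349685838097061687877789084249197795879171502122,
22438862027839232654310891452869823788004141633329791380454914221226364316094208087666509,
249097447424508213403995456292185037972933917558431297497545926960009154089550447959890702434,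
193903471662858336414867640705942477167816798921273499928849530426324322122253402186518247486457,
19234935392883389104989940920808604134249727120425333386322629448442319181822119217282559579846518,
26871952414320860140669619563026790699715294958030210975438471238624634510180415530751686859449753,
5061357893056939342369192069618105171005530278562500683872373513397564689625140984055607259955305,
18955081529284487013221439055037062154932075729851710139813300604695757841835268350503205399393160,
617295567477191268592041348719805027649046294870788136478810325035478843286683577426127054313,
19234935392883597841080097466321512973985457564332997727928928687297795477845436457498722146908022,
7866026759098197908867069504214696682218247214156275522702387111157338174604228484391770842745454,
806600077960781659186862993142042233114014938315996221224542701887625540978191352317001451980,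
20968733268417503498077203732734409399969807174437606183182488592701791846571368604453443409768850,
175143096702396246916856907458402846888788719074148753151632131838135162532953358830419858606,
483814693653143887082407296717627619884562852871059974096930267910824913831329038027446279272,
9507423029641693215659947137058968322592050817342500867051234803289952144633003561973547061520750,
144452761084833664543457817856070447963250789563736925722057369861561307225233888811332813,
13434540113517561442902852002147335449068588820549135681254059264393544635167487171256859,
306880689933215112703336117442017724177228897584205975567098746275468254704137888184302183667438751,
1523469512808980024261247180570153502483095774317914383395995198761676237015571102226584856090119225,
375670593350359262121912773572427147006013344220750900235899116241313108248768978443392601,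
563386299701278179747457690331613971088225579118782147631871899801485193923942021068179983,
226450594287161258306214039479074435518951060401320456320266530964123247079138585216377835,
1130370548815398055071338314816609571051467586793024991391857419503062902674000049331305156388186065,
77751674884414474840344282578797474094470257963004991116766583483204960178137268708650404816776844249182,
133229478997503298096089219061370220430967947799410382746032563994838989782586405489807870618165032,
414713897783976525988420398582106872452097244915926018370086649250517293868650771659825699503165430,
7797733179028228659690602016216475365088452601622220182964081350963606606059509337173649102421899741484,
77016912101226077699816607722896179097640658993417524149379708952065729209216056924687042406921891324903,
1641715335650771894791743463586023142923067343380429600723054052969428602693566317372495351565661265862452726,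
984408313217781832160845981392385319023892901787270546576279714982921009927934616529405166858327363,
915816430234210729205476780934562369889855141139091685713419654387593122993565563450288638259949443,
12336020140043563000236088148224706318128091921266438867841978907729565888617168751897155180304865,
824776251113675368756166884294586459146178940487627017318056263291782288700960348455679436980047793,
62436849027004989115587298956724259600630836910939494639538222098733788237519676714529628095119326927710,
4872396937873942460592737530457766431035111883259339170389156674944831355893770025808441477238696554366622771,
950182959722897153130316963931739305438199260546231451012802432818583282332775558610127840006374941,
92190214996185606947660907716230762060119260915842412779061108570984345590543496890322421610600524425044,
653627381224917411957790532915847590200213072767480716558029468759759080603368779637388220892610125121,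
14804542210890559836976908742167006914092796846807785075219320812645463557494744892871971441521434988919,
104922149042507649178829825380479916490534909141888072511404982258794475861904933243368523935698787992007397621637,
546900354733903421595799223963864756409442856533930076118099991189743314024902812751797260046502582,
60440325970101089491823481665522414539836849929577162961847989197709359783117518287727172735327539320256,
43315492385379190624340207248995679834205799361266185482331547304200630323436159725298576864542742864031,
28095466116211306826956235167350276940480615150364861302881698589339038224255355261691045500338,
19740777211352827574227351578091994741169056301646355878904786880433891566480869768952313214664,
17385345186924762405153126560020621213552324986956895040216993278436255054027306463272248562376,
872816106168538800363994182902912540395864061044776685151200141571715845644692504394320087211687000,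
13602793435408536704454724184688284652784083299208668986644966641203586474398158648733348717238,
93579481017953981882849933709982194110338744866550690051984027071097623218324141759166764461838676106699,
88182802041722914698695106189622120925691762327361193761482310713175027809816543144327450968221692827301,
34881787698694431835878374731009527429612091663371630752356891719972538786881312704126356274907652358176,
33195684351195014766347927267413215293079574744632026769147640725581933144201259765875809786942604154305,
4434309590551245762941257143310109615541195609853005989509159029482346845054761150738188942555297385998,
236401818325729769361508893033798104470590652851804998510837923443852202713229646679410115776507260,
22285815028186118398836045218869770936400281496857337869400571452846828823870295208601884539358808537920,
24200204553402610587522958863283688254349889775139941771903614520931356573621767143541580533199738725056,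
14776331209423654349370361593747086624832374219758496156346434587789852199050898874191016692441003,
1881437479740337533661318982350310943186822706327845387466337473385252433406910085652824742222918652,
42535078485029422670399902354737775851929601574044355802991135433283338025791640425318193986402000062,
144494463205883921176729431295544590792689430606592370105683043872299215911565511579668227342481103,
805727250708154090607865021354886232799831247277474076152188901770970242204008280266367661301889351,
823355535556766489636473498961571171384790454801053218316199720891874068310826272988683516249381009,
32666471175309771519918026062163133541518202807108471215010516751759205099409232651520076491374228861347,
84234873440191833941729663857726011428856757761869277393769485446082479330303674391884641065922655053393,
22295471208107186158954819957779477305823624127882117854138368489083623851245780918954427517199279419248,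
3281569949690728788824853175975808482033972187173762482326616978885614243104878525259002924791641786684280731,
26010466080629357989325608243468398123919771087187194157581191931081469599672494309985788468918839691105,
426369244014668168414311964613148298440016295262374333224335988164052368446713698353402470081893709,
649790864747675958062411887339592437996178867551769418951216067932188545025027132647742392951599418,
80407348992363065893602948900723976505538193299463248537358842350609968671344609044631746639961193303717,
9031184823997138969493443983040076528056962340226851872743189588868449790860294277393907125704,
26962568631295162122578738893136896446165991530945782542939393809457404888019004045478261577200095276267,
35751330084411912538585382937355510391438961554606608222210765784643836571919246321723999225378,
681455728625071744572031651097349099803379198913096243380646270102300529798347201350852147626589998,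
28102558885452025698143753671811571149541156057333186326463613518935669476258887302482711755798,
27544147689007343447339623526599673562401329618425278619412680887676393280598677548017876180244180295029,
22285514798201217635035923559301120816239173083265043234923401929607759193678819770538726907274384979081,
227411664326060284937725245287961741825060403655072973721792616145140801139359762560788698,
606923036796073761050350614327198730043850800879194122985289516390076108968808325114221361,
168596231587327351515980874389852507260624971833225172822886130191410254936618487467855169,
204124170943415112962357018357861675006914381160739686366772187123283706932606326897578068,
32091899673272531618533574189479555941583220971419734907164610687332391346747481688523613979200,
579735782083777386816935592215282818454830216778452284523267747469640490111063288493972908770535534,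
1097548217906828692034788881318715207930778612797528728888180765360515073995680508053369323021288319889,
56717470628755260578387852170277092482426960304816973432648064483118573982568849465041895648292259965282,
51907970111629984653150449763901492274352387148243447103841060913324167148269921355808468589636826931250,
378350219074802119922467360787680741206926201020463970389846875046173892372556034596940079132597440,
36499379599126066080237222933935839461379082480460650238753523258474969145551591343111578196035490210019,
1739357272705662034025637865301385462633526697799287991914836905278719206302275845908005441036614145,
55842922241722045350580719385941346101204729690604205851208452148978106246496740328791296670945885,
45949353622234586597327327806068726971106856122772683491219601004575632065190003050589123707347023450722,
455155673354604057223237318344653732343966850774057707485621901697652735883236853979045124068994405,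
36495803764627485885023980476135791423308463178451342960607720223923969429123051264144004254203687113901,
984404937240859410946130371754646232252269887048518107347660141163177947746013909897987811540757500,
307054741952242165353516530440125443031732446457866783281180957849365876702873865703429073543857399,
38474162817176658932001401305790817161771843459206165645592489782155552879082746291388758862590525601494,
727703947664629587343421033564576200136767955759631294011640460894363112898483173156896339521236703,
94089423930970708467027577397575845903084300421563974685257533551003047549947006435569341356660155668095,
34581414238743845924158490450424023686312138174577166454943546779140769410275305123534823996526165092529,
16277590783825735718812149522253976798774443273370422869561788211625801615228938045834133579426896109516,
22138901459061386296007210809573166999202040394104829358214027069774322063595677356338700018127764126889,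
51247539425602459192992344292437018502190151268412662828535274486534316238573402282984735299509845241109,
30404748622430190551076195922832274479627489648244116563001188192596793983141632826641811276424,
805727250857869916285069164848197272392435385427324910976582495808076122047829701695552355162428901,
1019367826317751276775104752220103910065123635596323300058421258896226322068746176354005557226,
1446662673123306984209516234586192422335977873332299841810464907739124058597593074555190197147252270,
23892184185813752114886829834241344456067598518972916898086518197547806741526476577577944987637,
242095787350662157881658923260768060504272915041354420152291342867901434530638280296291160864809777,
85382128597757571431356592232476842545993923868732812374029724514823069792436468658665182486811609388398,
16460286454262969051568395686419940122095969430091673219775223396131360102425726942869846933571935337652,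
24676492323847507691547084590009565179352446459817667113109361137652231699920363110136221603378589247179,
3374848834129917540063804914546508690108420897060147629617011849595622624652317098233404957434149265820,
4682555077173045320027286804246122345706276967199001304892644760087338655843256567477909637057532604886,
14387440184885731086936400669892813285165755161463868400916770412883326352665247551145602065273676423205,
8053063222855457006814902991328420081889533891273036149155901636495257200672736543864417809107478122777,
22424630809564384555568712533180817080853200734876366575535425058775876626160884557848665974697090917795,
18353506642950563656525033436396328497283211242333742036442727945844088298927319162032973282774465439474,
1592008362803947650516089680650767425072664827184705237928401064350170738020341812346612236754133019,
27608710960827530139688884251953775086581388003640062774065677911609882953636173552907822143791890444646,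
413586745554937668416780416643906601329894845233788657289668563110192568752218223893155607777658204,
10707252476203521313829839074826874628309657183456375419225171557475654964103689758885564312438110283446,
1006545258205034571713856765615802371940208348837516862931603540703642353055623974802463160619359982,
92897967963634755893793494090237018996463552093572721354344973736039114949682854793448819409335849322209,
17207497468447514957341271422645163410696364002542378598846544168987916666012282893243918972988717088223,
1648294468285857224305039867699403181229215183720216469272420465460758959714526511959702654171573703,
12286540647679408340958468842267480717508716661613908982933860346429463059407538739799991747667589548654,
38558376081079961153258800566378932543104504096055272503392054994782507940132678369576848301691053221832,
24842885453211335562201964091138151535820410561638826290314249474400446739930814846203428929292874078707,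
44418930488296042994685632995201130105678473457477546453671862387931740836401958642024152237380316821667,
51972621802708798629156551147319864979073032425164385868099474681566074687373388282047897435028813175054,
5783153841492669906940429425401760344269666140081202180636697018801611384680165462557037976990088481654,
86228129228806797887781015491664224388954558878511052299537867734773950675821448638939947065844855702640,
970797627815092622331824401287355517391531538126949772931081375268971515622418984395760763321559310],
[73544724077766974501550071638352591582368289295453544288889000223609218387047849613806102969075285,
378011480718850063839183795451334822576111976304938771327352102846421291516248784512598985320484666,
88346273105790848634503247600888134827668030922775217765114714911064241352930831732191596924655930733790,
573080518645752771044439813354454959070393579095295829117927586216824886448717016914585540723681419,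
1486875401136628060018214574825221543852308232220272758954975971601908739872555754274633358637957514,
1669857190108692044861860426381447110822352169213305762894513634336075953936823908716024268947558367,
40444731880526610564671331082389053708929376894198817759751123953935290179219388358769923180321754207263,
77751706605519439004310543283899074032741270098367938547985489128968974991762419873559456996999990015861,
52308630813478055174678519557637220349213738913681059283420431259574784606189507066623380036510136850498,
19083771086499689995700732818025488304838148902839560425773027600996017201413935033150743247481419436092,
47985788292347802631155308171497606131339625514352208681884189127299785937165017271016836044485276519634,
35069322705536194007691004610094385548834391039632979163902990263298153989443069103456843937105509265202,
8702754869347852502025188938915886419171956403153263041627601349725695860158155297485821609942578020103,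
91332603624861427170022505739514556060133800308537597114866746151478701483705004926372803299487888541858,
37484788215172296234949785870206963830647618566826425008472997230008395883121012906989401789370234695114,
744657995018278722638415332600625105451516057193496067428490976494494516704619169780993718784210290,
575023507731594275500086090533984624687065673757781488251836707274393893406359588555306695420502003,
877095013397649817355902235221870026003035340972131144876749309909687674783433727554210838735862249701,
31741653257186924908460956988009458089318629207994652262339710733821534205216463234447862226627908420860,
9726071043394385112544955661527436482580662251805283716134451171126908599951544695989487752664746319641,
61479645949277270549544568328651301098709985953985407227784859109933573619941966542133028186580493374059,
896296003010511199818905730503416973546955605692134908215225449859556283449278997628156673447262281030,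
31741653257186925012395310390555261608042780975749649593469361435700469886250696829506394168176241526332,
67286746596554506233520461604582165371650853076981472933001476920253513391950737960904754641399997024625,
41097743360151956869591214649315620118808792110711898655454286736671288625658061716343794399450012604172,
1352663540850605055036494928172019595504889196379891544160576754321767121904937930187275981556795465357,
2889233865572824816618125217235074183463570672019771402253533527409632807921945039663395101919606471641,
24105247460935679726858761395983825205418991192517718930576779577493533256109382086873921531454980719977,
36527197751085056549695802711831137899122579283801239866982154271655710823475267516344769802289825057419,
357516788906527569554659539851335364337632449705790475089556502567010506310132272419763919470823613,
1872330382964899895025897528592116402307086567730637418605791662709154053328224132669387243129009207,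
26023931269316331131239953054186023184170939580893675129781439441162920151256239978514218360258728597071,
2256456117721915223160639288887655272056685618459744814999817835753381096542047940198616098684835596839317088,
516088253775404062857058066506261629182763584805870324985024207695149108155123230378437491695583912,
42719366013012621939329882469288065562579277001691435515185480359070057453789000046076846744073435490325,
336294760699516952872851893379303129073932402272553797888470280302653285235486724230855257100212645770042140,
2397424256762931941769245601152472401055255382389434997890399855119615480216308913283822461312261579117274754,
19276505618906030105252947212926383803212483233768176912953172857211217456598683873265858154573196595938,
1887870920567166322273183239671378127272090564137894951579696444310294613151055143810333057857050417304,
45741579793173036155072383452492712492728381080501947899066006262522903148296151593436504481431463250886,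
38695201029623784980059965851206116470115384791576158772737197818819225168063983441393795893942691801127,
6763597969495610090087318397849072489316410826785652827148188746261276947797197423615838350987,
16415897275309869989736059605262220750833512373398542458163090004064944500933452053494315497674,
276602662538087884639021104473202802092176235829243842026843102394312324097645337580705499287968057083185914046724246,
38923606809597895278895869235574191968255645599058944668733020171791915894420827955159017655662643380543301578130,
33069104027059534408454923346577470208021429668183040518184425899108811205977369947896494289130217503412,
306829972198543038416118734083356228145026825626169062319730301250318400441706875666813904687914440867099601,
20429325219321450145731132342713220889843049989500509743146114046465776784239855275531141862032095748209,
34895687099397141106216030102343465204030914991579190932418188270192010289967013174582033275020337585737,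
24455785179348463290347989245459123821441587886528916000951624108530945312443585309333810853814233542831,
395787132814116962731576887451609005986361155083836391389632856954977565870231416286256081724414481607,
1593084520332273282652451668147856418032357562679629948842831967382470896595760077414921148671204615317848464,
891034922967215263075059752017429538016426570972987211195630298155891135222539758979321681570243217566004272,
24016642899116092973638917928122332072554448591832743900744660891627515338015360408850118232363656349377,
1585776095113524616060264762481626569920342446294922208777024238631841575363029862792839137833284613418050205,
1662780232853510437152870697125349161321566235078298375283757573498972364246480230731650423321966719747079932,
29439829961453152430849798840861919571410534238665966504724942626630620755883639799702746195383740957999,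
281731720173319621758828366887653528664582248746914904921292259458656463627102175927987234921220198429062146,
633447828796903476732897244317288398049874405915477321788575909232479180435963499455572568824856017519694086,
18333854303833677217138836427548372452018797108435378524182313566229719763057568221511527879811883713818,
354226658546813921669493598950003226343565241997459404367168530269216903649568955516717869159162031185484994,
293342830295053952648481738767983148148169290721132137720670211667482597023723660158438211515331861631402674,
672485804912106806898394311008860768508365814045085983111251159672369173900689608780722194479388539396974843,
29028801730046839331682478253142202063315308710529592341947689026412378735885196543308120746168199660480,
997673870695821897497968233770654370527071359203731960141314880206187405061661405011412215676194624943853198,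
70408251615599026628955530712413043498011797901719618993078735616199273338649136434057684138247087454144292,
2061662156483547365713001206503753550052052624465344335103258153949680469503148960336242121444110321173549017,
1405939834827894410617690186915984780384974270394707562719527456413013002934542224078478426771444477193756889,
502247859027733314887963377057680060013104567493548864214690898882639909575403888196994405248916425338120686,
997624541667250389974734191767511186290608322770432585746256758144018338123822128479204398079373592639724124,
955678247437196344131818474107942317157849926001266492814802497163369560558137860031905470855917723878804217,
1192618900305505595975232313826076920288536662417130481303417668876932019867195250220820219922054015451226197,
799303722737360200606502840161014518746176454698514571305251500615167280128986544609074457018771989883320638,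
22878339927433860895533882686471740996183347370682851082106199352872122975912172857416793718114629522107,
2001933447010819579154693933741821969247520900491442110422720775257792372798421587382380390960626454861577114,
2403914780611052515530159740040428536418125772162204817929664621885341269026863948727761099464657094720932388482416108,
2084311833718754296084816083881585200077051712718617479116774510946431247102866054370481311974970829733745460,
19282986578527318815402381188153821435689020200139024842256653460603199026549748423911693277889139686813390,
842495099673151836844066712713175678068913764634646643581658466130873039114867391699363900035761077,
1909291715705583149842240897169014606476781142902130600284108272847261613971717934245931783673343008011371068,
1553136889407359198392700072591686763556163571671185105023727518135829983249560400428068742102704463169220095,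
49476953225917197594829353355650376416121376919643369946427327292802178663453892835226432030680075553587,
26728593834922032093597809398269323491636181841809658053672331102903871096923834680450965824864584875813,
43459266371072023205840004698434108440804890731234771370097772457931357047688101715268505571752583494496,
2413240750627561113772264771128263408362513281598063699892014261409864886641211240502465836625634717084795916,
21753598425344761594256879758206745279602015832161928718330539784255087239423670978865493596066162651052638,
2239109938069157675065296003530583239844554180136867466865421722637783652334338741540936924714200783743989963,
304646626097033895027046949832352005023031834748023454861131230860113163080859396820162498901589315935580892,
3085680857504442345697325351994349419462459201993692675660543360201290895734500314474987709075438127572,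
1009595304888747777537166926285392936687400871222312221409084790624606493887092062027608224652367322205512854,
1732031621052495331602690038980514350566904166354645840865408812517709921413263215933012433424382277052683500,
1244289386738526050626157872050805516952594065415582310284572816137267215027424983772758098494224479462454323,
538843127778472956664035288510869521058203836285047517782572568066836201102008829645199456626612902879622666,
29020112173207043024339640518071415265698772392199034152606296742279543697990832843518245553879345561425,
448815507857967028053628441524678515004557429386083873166102347134238403359188426545506430438751412299385828,
1089445421873704987102084859728549407723595277718624485815845546569665024016471439126302531065171563582124768,
1217975503777414837046270401544194975595327578625429206718765105716754133886047002767299498818926937106334972,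
31363699131680506501757927868683692437642665154678856434067022585292752428973808602715252424165854382042,
940447911388274614713852315511084328410657666674898357112368601131045760195255714171982823268176274597807980,
29472314043028378637158627717213953315541508041387775754491676594684003953885694177723766145716525577746,
858704327721552320968364230593713293016256028540072554589688719970500420585285773177005029954058567167606970,
13858435589190448038865516523403101921708073486983365447749809872354694628459183401387014170031582146426,
2225370090194669101000031214535724442856368856085837751286654093079242554932654969508315845249359571576669704,
43543056248909245229411706426991149054115296138263646834918278310440254953748255266141308199503128061647,
375820906555175384606398998667995104326875994631529247392435424556522802190939322268147182210815262733666030,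
2202150754030799106484584154735036132303739773127289817534637924195133324993809724834995153225642261675500834,
30140520987728022378008414580119609757075051328212931651716466684966555595112294174543465034902604165572350,
99464143073876857700256765745513907513235076699319946433980927991989311056491192967670229328702363767717664,
134436421674563946295704606377364785004418163877542766233469988154826203881541614341110326738269834967837840,
48431491024964334678991981512916692005482851866628776997008655394137248652992320331193552097043315236990,
189758417692028267611123844766838457821984750924772062098704216533826854857874618167181995186948521313233266,
2015128366601392497781479872707758469618651896081914411389700412959184881185221513011826558622471696359169766,
29020112173207043024339640518071439465307054263666681135832016839890693591609358643702998478523347283793,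
15876422354358703921320254962971187782417613463744044703073227384782941914463492999941099629859105552375060591521,
2466509681973078963052543296872404663418063925030892579161526536628006938135354397829569127770002899595360829,
398969994013053083488980144328103376809220743480522314086312471373030459539963330337145331391322081330826421,
1499395829461801072080740170295953817340865758745313612070481895284946201639968821393164637812960369385134369,
1826171168713949636376543604575553406475660866520200690868701240840535023226585402502924811705012040972,
2087069991739574459147115417688658628987212783383983521009302461435156028241376414920766945598815195252033094,
446685631310414307057481494045372107493798724640635941822881421040934654499996686448855734401282448717566117,
1661059402564518984837634805017040156726172932502594593135469875547829884459499801780438290012018811158663066,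
716573734765217710069379676630086229980188845842993218662635090049373756997090961552167694819745394061596126,
941635221996505413787400194483497414681178568666769620515538671659623643153075912646374534922541746712482430,
1134156838899814291066563230251725975765067052819923584845309302295953877695233258476475659673636877464173441,
1143206257695338283676990366509754413114483104877345672963915554158245508349677505735756721429602550180479338,
13631841984007348864539219412874758233620180089158394057294154712022762875212705188600615127786052119475,
77697923221577336726055789758293654487323157882255115435376252990357954943441174872394272140244148798139318722010,
2457660187168099299892149420579684499967330582829235119403997785290793534574690010434586051381206076975458794887048670,
99485419313951073682149388865974797496964759926793050101195540791407341609377507293264599625076604028634275,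
1146912939613320453757777966246746283975252533213180374159979178145314125211676611456891037636811674278800789,
12268121246821607160251737218731748983891785422788016081305123244287660520524858440717534555069842963415,
469501860342024774523939292403805647585569185987462581243370922529500601402076986040575266310182838099014110,
3085680856883176251910595234083446436531110895745960681967277369453296911315865075897845503425715467732,
2579305895393311246392188916545981410934157509150239087751060806597690081226696113298091281731760358434682162,
2285948151934285144355732175397891126752191881067605564759116817924106904607133360233014562828499624643345171,
939245421571789232662247242662006944854256924356833043045020941283451923162357471872419975137529869337737983,
1243785507219950533266083376158969187039043140689155139030152364101108109876799399162593783761789155194533442,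
1499380636298483475954064938483803432514455691843590485188710389175737577398254634298864909039419112475463475,
868259067867704488411224472593146223786409525273006494788744937948344662201881911918989379951120193937151335,
1143206257695338283676990366509754413114483104877345672963915554158245508349677507464322488277251819428643178,
48461968572483856990684563884092097361298345545607192508425754114903265473840649239301206616621652471745,
868246395680609028897612370986248128146157158827742822711172054888173924131591230854180080317636764886376514,
17252837014817753384214961677121743135629815457921790163118706110081492124710988912776101922286707213515,
9616185894776190177251903048749366046389152045914824831883960684914109173161337525346223468657806323774,
493523825152110458027747254110527464628139147872635640003369776223483262377486312777264988691050976310915746,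
259380931932137668667330145792773923510186286616878530293797424141039261799648432707241356771727046111891444,
50924707515315277110774732400095537044486329169903926868454771116747171857274644947614743484134240768130629242036,
868259067867704510729971069240982892626940278240739741877900817153716172315513488459158666085823783877018247,
2040893397804060858850992637759919273493231034279946305460108130355770651824233216672568341172881565455495265,
105885411823024575423781504183383249194109907586324069604844076262638566802755136263141445701073194015940754,
114209976742096026091813059092128518470603597050750224720318609866244372424264160229585459609798105,
40377217569051998780857283463575953980544460692317824269522291404032287376639771567601012332740453691680,
400912806763475713334501767633108518597808853659379536978597737579837928613506817595607961242200997173886675,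
299062064059486852106436098457545871919457811650484505480572059882277120514159601783406585918604896183652612,
688559819619082147432295723404380640708770271367523816650828244169284722998568283625094957899444930,
9552562850196800613811766350086467202275172591549722833587691822533414014818929247996453291395672256314,
35077755931034669033031938351329351906023678262888412868580167068295514255219607442974481945258655433482211,
353010088858074244534970739571004134963866560047600922932751709461959574061950274915382523679188368329875710,
1476159171818538797915613763892697459753212864113869849312147391490472821220971402593695473885214300707588113,
939558602417283500482163251707839645602249263641781144639374564794574732327415417814360158120948291198291232,
1300398591769191169361811288087579189197497709417485289608830718439484651879314497194040599331250563884411921,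
755176527118365012598214112160567235502469031961945093683335760019128398821011416889229032272546750604658283,
2226520107292992146945306257737041005595127405523270802139987286074995725388274665552213332174215908380848855,
9537833082960713282796539116623877698165031908359831361220347341783260822745384505669676335723578176708,
1332363682502955142859856166983090325252592355364191072749499512957999938808985510188381740509311279343572262,
41219495553898925285472634318956400471150190511947704989444148348092311755149020168004085048327243976471,
868230441410414680060927675381773503705045047230000688734422590749170489512795750568587555778259838827653332,
797994377618829969770880961792038231664606755158342716537689617659145933829226300275496587670006586182805315,
2600031433937803211723502280754686593179177376873105291785743694482455300029086569689047763532991931111836807,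
1359397845447558060031730192897977667765777062158123486645699454943650357349515360082006125089800674285996913,
8647389130850968970020833643843060897276452896035953034298314297955077827204235454229713858526151504843,
8632641870449229582957181044100303529695314700045134470710141859710136218573773799003799090798122893253,
142253943659865765519390349494998494083365012740873053542338255989359120833104397350127773639790852701049585,
12767736587374859412083914747389149996968236848856735322305140659992353828343716007009562467393018045433,
1336612678809054408105564458228880570492488887437413657941155394092387306207798628173892936914961530615296744,
166334818845134462530510969719946238820111966052797687149296028857785688712307262606646105047974960660384337,
868246394823436950677746998831215798995172373847841682852292881501170231065522177293267718275774309719677986,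
213366664652875362194613001540838127349695202929758380589417567301133270492354186329883666166892993667566670,
43715586277516289448341850562472002411063594168633862402454251838020825851096918055839831617699751477377136301530,
18291794625546324060411630485850803072702056605119751218640920384066805159510554090441375104232541131304,
260200787671288820583089831683964113214489495796186813553565019507383575491766231753679266101357475352605738,
1103480583675797405948424637560515560001771719369576873768855720038023104129877825063328027469365408029373577,
33959203905032681138159154189244885762553412745977125146702023358980852195427439055828859492619113178119868676008,
1255906540384641157914205086104621047836017340356369841413611409633453352388090165567466650976413247743241765,
6978487155880739866277381989397199835503718108568778054335626422519215726447944615433596104768756984000,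
661048348259522800810040567964205402735148970080490354860048843780102473194141559847146639305114707400341860,
32418450224051708059468288007062317384390539568909751027595815614109229621954713699294241429044475258322,
27961658223497337030845190774663956177350578034159746016432854469463243987731596952372308800202866663000076819100,
844797333305185130326648704565930751290218870939512013927237655005641236338404627602744268632751826261593019,
9002947365398704467486513931985825065501601491597075795023760158080285194450325753379072806630081244973,
12296712635121902689940408346024043020113486181548485414437610002224011085200349356179739157988727668306,
1755166657366817463567451579006684269699918621600181476131203586177835073405467404242420426363930707077678494,
33997979423201552580395181010697469263249971690512281275900241737531015223176871325044288705098449122188,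
10510671482699860355932834249089205235624265910864306129337917181734718044316313345065588023323347980909,
34007018407151683128444327027355812199562118161990225461122547612174634679511189873726619029030191249793,
1759659160459656691798223197865068684979942922643202272961250311486370414943558825204572513262134718259094719,
31782669476031838690220469799705700244742771333110475234966876141064938550739656431079070407743610139682,
120339740255847584384724961159212353178669837713179436707876314265491025272038731142772551648051685764553826,
1759659160459656691798223197849373526623397601551683145854458907322519815073094251683255385676939993079640767,
96934249292570736508720062300964556794400692449040793291256691570819637105376154516760612194525765285801432,
6227564070352423012630547340489416197223812993203779866664641097130776981366301670075448296847546204020302303778,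
3947167369230951508092668381363586892281613598359387801109356764023268407617630565526610633572187142065,
2413261200301691274219051282160134661493489135683193259971248057573309270773125003421497064460701131394440503,
356946923413551941721863909248158891770629557016268408721141528952439713655956379341261576721188626307164,
3529052419539791565109900336224751206876789998972429231824252714352097759636060606971284417138278923000,
610131044182192231923863942263875360534953324375959932840299318701343019858402349306147643606005068157989510383,
183038528315990976354135901426646489208580935683362617907082357512698825424887013069530506425015378332625514079,
823284223831399195294768183173775510746713278827573481327867735856500225016797850288690369277614082116585226157,
549054026152166669814402628685871351464551863083970540236671911501632931566135089855906652729642462840307285179,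
137299223525236309218636666924185183824670814019049087514117043240894892601641874608291009618247742598379732420,
1472994830911159844481642061645543652004249804744114923242428952606080914034228175043329278339934030419503160219,
384842743904530335676893104157795962571661252050826670892513179950569881411530426328359968614358070357148145809,
1680791695997832887020056230362851547792115449849115797976092008084759765845901568624409952913802502578567101191,
518587702251191994080671359542885195775539458614396485439486562233449092805495269216418444870915529959742427462,
658868524553430316830400267653332161368970247855941054752948368708416843412494960206366737626247126793,
15167753427974457580024848575425875765642758808203072170100729590756016415755821642118131093218339332234336,
823302601902714623722169464248766511187020395590943097949508227671878269414249515595040275809851253543652851837,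
21234985660568754996150018903542975524918389410900991634150214309104373837695627547565463205326432522799512,
297346750928785582218322402276743048603643061483701020992683958500343939497968655401748739121065933094266072909,
1006238488448252648360994808320540886349978702863263242263329275158779823688081954224411659383571003759679919868,
426978773046311812284742010094639547218561812133590264701965055861755722157699424125005947972541620447383562464,
162574685244284668642160058234863968203500496244301389400747159698523895946601235975785619536633830502141240809,
24912061224581084893591934986670374272025474695952052568849676646740147143547561605811461287559649622826300,
24719079018195764592066650691560133492883705347207353875882605633977374189346098276500766666630214030506119076,
190795547147809736295182040329295314270764735720802226541732600893972476285128966324779758983275301735005299183,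
885926166844292255500879278956699356332696545551932509659291059448545410086581408663255502997302933672375628062,
652262841371110485332142615169259858711266175940868093123692784034740428948868722018616400657575983690373416921,
71655882375612560814651360040485370763327514699096677228407701391971922843445290506421387002955345880747652693033487166,
652245155195763258221759194521840771483767672463511551044481144223407245866150545506827672313408429608656035834,
1439100331871435288096450893013877317388959375612092993695145961688417304839722750810203965679161271239940523655,
1358469016538209867659593521717835603335530440672057209059210186047201623005235328496699943070311502169672172045,
354802897519098575099040530341025791473649148400181306855285552108756045608174666692403972505047187686821416464,
27613252442842114833124447681629621027962405747038195032491119965085647123829497820158778846195461786133788487502799,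
1207486254902706069104962962065548555320148451963680175939424349633846004092048937732999522362236145799001168581,
363289599302724282272052022307804036160325392175884324536098808733553310950699425639937246241922762877009312981,
580467486713853265848800053265097304029955576854554577512207599095708227508693401272911038231560041935753250104,
732896541915933090536994574784830068236313949219396324345804034096156502705306682976909861214104977126359874534,
122978606522198449821929511577384169999935393793936904357169743950013071794208788870869042401327269519064555164,
9397226414369487991874756130394038594035293418755198854230642817491930582074356941604772528140520798568946577,
1250127451069201862119761604421924576329212065086511946956083386580107294427478317132650142225544416088615593195,
664881211255323862844581574622267528149681829736735442662498491308596852729273787656993636575407965817970354580,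
15022544157058015539980388568852002191545717313352314465711799816845627765795909569099473448051928448817398105,
3200474566186562751438975860649461350054277867895921982150410423958950313216201004150953251953806461564067,
9563107779123916674206719949397058406197467575382967353987259443161661279839687413009229997594695246097184,
199192116281511184486205794044862683941199506353296750665381620794429505941500321071056895303647062572411219654,
425627652728736883954143497662046168271522648783214138519521585246871304245843296778266590452829661387728795685,
1136327556615059711759284801215722953034532817827712318841132381916692998325327212617414737691862666561474051639,
7506598301381536725925007867939811705790190199184292320102593283999149267492546174269944835020213743389555,
6092805679164330599047666842346699761035870580302731771691452074517097492883234613796404831132272033374221,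
15051178132853877984099117348793458479714246277551112449495059581446153873608261003753812449672531947362787434,
1402921487320843747487531976597989507115364920018421714914742924645887172863762145720592464322101166662867884481,
1000584762433433106072426769289875174274393540287723614305810973459739763533139260020975514326514056895466371425,
11510143243886843703237256725433844782815763741651006025726554416966129383081034139283008651988677837780688377757164252579664,
122981342728318693283967527711453920573573539177737290258478509343355482876203182967852355281038268112785649564,
1252295891970211888038692019248791545570971720942804066070883013645827009350007634116184137632294568004206995007,
816798757051223352054149091887859068484994945973586421601586417834548943705023106868297558199738183807168566210,
980643902095800073475832261187956196667630753174400087447533008023610034775433850069679924041101541204196061921,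
1081444826335015993458519944541696448695123931536101657145437822119534600700151695055277145688973920979163517635052584826,
647788174233164739205501725735479711549921329646290846043200368345161325716585274406705793033719816084064027683,
66025679242881550857396250882545990521492645260395550563382842707988050833588257857687285674101011105628452337,
579394557924786288074747519053853897407966814918824613165489828866672330424601810303815733748025416352794961345,
434724506766079521591305959161975170266593367241143478800738845039698140818599636824205522970190440361471135234,
10082342739446130632756874759814071160654189294233264136980706628508533563907495290877298955815008679490580,
668136303982723913948071977277206236612388333977110291152699242585886808786504469883051856276431390817955426083,
31557271073322951749213671875671696102038181369859640579491059618865647098938526944694078166633570428561998088894018,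
823312495834038923582327052268570707095642632289547166677070684810143051633608778345129829058380015156386534780,
179868803628615911488553721555707042848443605904612135358957264057128003849713644938266137238115509624635948374,
1571868551291081535664590844213802761774565611688494073492315793588434388211461013053570255589581558204529560699,
44141161144117596533471614025334613092795620027018347281149308181197472405285329430438540001092781831754641921800327,
18542536930929592554606617568675955926714040676741373168518626930903917144134561763953405868620289402150190217602108,
615363551723697428110678519325162969285814846191626116594504484793987681918801552475561820445649418343584555018,
859837006488995051891985521761758688274728209316474611374987670186152745485523457684280624019364120088348214160,
530709398794310439772730950602666112796287115061088752537904639199647020169096737507970938577123059899498008587,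
155954732123762178568752565565426062509984475048836581653183578738041095792816634379197320309201599434118249553,
351441072137993651061085861198731118081032135534557388866840334694525454108054981851997714362071778943481185920,
1616333508604290136325065809450814700089789672477177200838996507129382670160415351167680834285599815472427092159,
554389915891052745990878076063796746256785700725500374202422143237218456374661584311076016849507557816275755018,
469313310464883549126395300713367362147755007753727780828436457108310122091963492612596125902039377620859491301,
447963206066114173515665534712406320673740877973206105765503692942591622642262358607075945971581482116079496100,
155484585408187981940262719834079101535845100352842985286876497515098546731890455150845319163906469188175641162,
429623637046857572712228612339799979165240263316821900540641254074618244527244503256017361402410862295829217762,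
671768801262083211181663465231263383997109195492793237176203478066005034903203499564574381460973179039085088883,
1405918935482534624507252805118002069058269618473774515909355136860884276015961234386594264548588215505071975340,
1294581149885076485138624599736370096158909079420506148202402077622188844283799892114556314782160012244256892887,
19163881494201719034619882466073362506163863037912258088101929436457776113710354016011772592035147183576331],
[540699800121208063389167664670230243682937108744353453375836087508015981345891220668937211714352966569875081536,
38063823044785418896421142685357888370021061642492433341453457624696236943195096582243094598397373157426562800,
556843935738666271570119017244240998036315768371199566639841375287006512983610947134789415247541000857773363867,
173912465397515884053064243039257395672157061416736760894442327969321107524856939759808818424086895105261879866,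
5377179827590691215152580334725909813452507663725141428364764443689016746950846010151102374402130042038689,
76899741842112781479237506048666347449944246092418146046412845013835879717162960846778725064988800313411754439,
34977327988752366882640472539144801101729991777279251621965646152733113369089936738972559312902664927938680289258659,
526160251603187954577820705622785273440320155885324881895827478296325675613148630933534855783684338921563306821,
431178503253224371909483062123595621521744028694949905933808293531291209790478810640811597723918510736126790870,
1652176953054239156104692552121618356092281611816219275502965336431349705371056878571157170576093771591652046223,
1701539587674915215201112905641968683600820403715935195974300215917035309972340822464254880490274087752049646470,
737276053751491015066293590685274103140124462304193732798232728366614813888025315922832347840211975254359793744,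
609881085824230291310035351368175284593929743781356276468559512901232676595588792863072613881054595220227695415,
1240918059641872485651163726917612310789290545770189824637370998920613061984813375740487926935513593243408026977,
21364488156678309627846327342553378764582243245389508191665404493805868978120900159078363187652580254783694,
4284309997438193098328747704064669951230262680579548499493742431996112910465136922525208215155722659744297,
523437534754240611415584667680444662921555001465117026243654646551235022985556942231871756565834882868422877936,
497059567900650131337843537332508167755493331195822325154537803529054528979023716156044885572759548719314532980,
384292278967874896729591333812141950096984897953833683517279533760473599581960217871315742529072376420943649202,
7264244527238780042969565436109233288093603529534546571334016836192085884267543329428942520060885421832518617005737,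
611562597803677749748657737408554573013868522238661823217740946009542702080769985254503130900757806912032375356,
10113256931128844981379354130181838075857767803629701377292932814936252962467555275321963137822797497294916,
2240419107482920158504550239608838338691951377526776504191192217011240299773683221998510262536308652593394,
384292278967874896729591362231164034065517949306204151117757284042495347384164331065542556465227173022074185942,
965949614918458718152519219525917721856081879494101235737532896157775593891869842302755253792227679804250488527,
22381718961761931036889542584578026015904215973615986474898898736466913123026929702651447687787963344877106767296919,
795616805518035929380190036090356472262584779720912279455675698887416534599619610289833757394606728315858386135316,
173912465168777555234605581630509531493410536105093632201859501151398518752005771420459327099526125912259580346,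
1500040968206417674120091283153934269289961208303856528876605196603481203819234036074957578911718056469487306468,
34364200198547631643207198526853709023696991692421702567184704649898101811163124252933451037110308977722697,
1515298517413194257122930641133973416481398638112797056054704507578951050958673800366399688172829047720472169783,
56112754213871650004913314056006423160191840006343340716206468901787726711999124913476483349532743653198719495271226,
30122838987993403168402259379132715777036933833884989067622825163719489050627602485371947658320758041502674,
1298896817164042932565271210026501538109678964295116819736912642592989650144736319468812986218333068262578046914,
552489438950116289677699062705962493634890228901506731062470829361910215546355907386764517920968563797635918050,
523309865482064026651522563162261807260993345449128698034637696027046664923667233547441841224866636662601792736,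
774203756364921099177844002491544814596214231828604092530243754934786093237842762924696110696640787642349632736,
353805460915463335734226840841503473450467836023007331326751594843481895522267800916445776882215472643282135376,
1618593415128882189035641450592439854879663856615237235378903466362131916388774657750283048886447049887659038392,
611562597797374775876914694792934635592922197883839565279758766189367844654489218833717839446899951776452215356,
950698388989866299607466866555443773018048631475238173668277034874715863182032764757370230697807736272708081243,
9631766448943200378932559604106639473196295152021072840735731951699789872401229239070418652123782483796728,
8205170032362762029698924221143195157156269189230030726520890064147455325552000877004319968241414950419416,
29576172751654716172576228211779343126127870034049703634424066777070504853982175017007035550913527472804657874,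
53508774569441786930200249782320543628156780994224657780919570668779401349149516341682673746319915639198457944064106,
8217072669539171788759606741161673748808189190654980186015209412956014500628353167723599553514463886598947,
1283625385972398647421104236554024148816059723910234062402384257892135293787413650321410505405450908217169447029,
15108137381050126009283417012802552678010288860691925793549942831284290614301860651169291958509623382966006,
268756903595732443562255343937162612431586297200668455610492613820258319998314449062517294297485119162912904326,
6084149870502446973232120019619185682517547708820265483878825575466449893152881680771192242523517402953196,
589239031158017886798431717966036138901971892275852352592031405289290593027560869968283657967943557640141605126,
268753368139511995633384544592365531415543897236157233877168754741046760908686809662743331653123796583006569746,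
4104789825601628059490441486201099805177812745740447740755971942037477779173562533738256007309628693203200826974221,
7485988335001670960189137271921447467780257056632450309638327493158775402384438705927044128734824747178186739315819,
792816557133974322969703769302089313408315800655721906300562362919463846067621870061054455895080667670397528519,
1632673621993024794819527435865769869744963610988713416998055353295157284484768654349746546752074320009614877867,
25115293296351638533154440682490515636130989890402452450990585246802370392731470310451406365985181623247819226241961,
19017824669222829844630910469629533704849174213347382890528647959972891732814060071835177500603200995539374397,
199779514219130915593854708823470110103051251297433082057313444687179504836100447444223512133491629566109383,
199885417659225166788772350209778711393423264957342614684158997798268231228972537838093091895002943146564837,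
17030338372248746515554304751768269579616371672061087446440897320234293454036084521727364902093690279299093187,
806917856063457915300987299921376963121028124657509217000921046827539648678871984890977735427157834381,
8139544453799252949986631525787908399812968958915143648045994002332147425307874803656103494046548400784,
193084646805250796160888254523081675451028274098124939927995039482112262539384513976271410759715628998537632,
386651516142035833290004483569705797080424395688301076467477862933010843263374447826428303690666864135052362,
20987021916602502852379919352666090415153627270557510407605989583687156158100508779864602953226907337625792,
4854167330900557091461547034127195043236361152388362792741219805827820002894823388726379810559833127966850133,
6928054830871729538824949243142407688891590654661156067152764226200607662148032600904679090102212584351198918,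
3062293221495455892593024624512580520031400833665024327772546947727711315901716907335613675496550442748581729,
12945710695567528634844032960428187857214623866061727291144783938147887729990090348494386591812288108639134171,
6922378781553532696573577997346661967192584972665271941186145409871072586662249191070299310689594131259500421,
15960773439855476086618314398792235533732731012085636535625300555966225060256963716323488107254586387192268633,
19262788575575417380312539951150242664050453071417278667348387757415168332627156049795273358868079186371115292,
9504863822018373257153479592502492849313593230619062183784921929631788466208591545451075598421380036094960099,
1524663822220366428893464902853148946726413709265951782968973347766096239651277396024948869720890809567446568,
17257474112472926916953953299121194109114146126673030188738302393423197758066111491203909414845456311368042533,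
9334782154590003476222669551822364554930780382912175048702775026225290367451847913515730568456736764714349069,
12427734649997205925169213261175232376447311831534552742961307742891809600477159603794535471576966063938261063,
146111770858224218467523618715985018396413521103742204952477550434400800061218314701090250364988444653022807592651,
109603306711851806902912505418506349196530777730461347619657853043447050472346299610526361335188018164876727836705,
7359483631964257510285599403033206641478442370761897162452870592651994841749689070617451822282042727145112765,
38909439680708575285994441728184365753792320005155418510879891107866416348061363838805079872401184446119499,
11675930386984233812334713763481344498106341702471703183542744266060938782385066651094735667810180035317528849,
525748122721242280024582235852284795765722311273178869302964582288785859103979077549317209368003194565727,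
1881689683768896035685512344474157584054909180932971634680550996046703815283692516956036190475502321527263493,
448280445491616756191305871228810769190632446499059608329053135979131741212055384064966018984635122838034130703,
16850266447160381957367644238125612435562719577281035997097006348788961074712394519324285774837125106624321184,
44642620365674569362329927435921861677841999711103347275756345826455539086535033495195673879812949981206041221778,
316951941957954816363646704578076203752710779102689954433221011248418295297790234110802299796908865540525597,
63688312390366272405438857706929862700338545088689640637462401556812813337066775165263032122757887406381590869013558446008,
324978661172631188970071962116483822013548871744006115959839688402482984601678746809273909039522450040402984353093,
102231249003223245598579834486842613332867969125284063853209642618295442059225665415178247816440244424359240570077,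
1086095707684474976967772357733179437919539077730642530284779777968814171320746669668944033052380539024151957488,
2616518749997251427078138675898172775593650070354355225598989531586175590619484570331242283549690587564563264,
156295221143639469541923177545813203125299609817952610730164053870748935026398092543158423313141624320524572837490,
4675628507207603096391208797291000090318726382912350034107462115317463929590404467489588007662191339125169666,
284405829197996181282134610441672043724532728189435395291468361550750351850212926679059309727063468319458049759493,
159189009717421588092097891268191058931594330817732253993391810803829461866493926207716114899493398308414356416529,
4850531686679883945700320887981928005380377851769716280345648859660240331815639176186849286370079152721470726,
4106075927396055773631405137566200508487533629820108139777699676012561527746242460189353834217813103682709295,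
341201306954757672623450946967264188674916844407216345961020906231275639962151590164067825862100069470918,
187214353419304942664077229276138038164658836712125840066484567806200684513699774699129704065549442186161,
6358493369396560225250542098148340117402335932221684739608171955715381685781208630287311593957344092189931326,
9605323363883488660857892348720121921552953520212092226905743527161268020515202060059125903282817126611094484,
4949381656158467244718461614932836785962965493262250721972568341368085075711643461642151539890587036808369641,
754816408129059415941018316212208401572431863652279554752705113743868889191233750978268497079204030805346,
140865434916869011221199565704352346320725507004581863190873651502125298939880909193200318328060171391005373688926,
6920469150386115065934137190980658660341502397538483433088597789427553220543441349780787903670256962591896446,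
3529942270939457908353822059003922443041201545103650742964185606893145427917407688430552194550641206,
902942074579333400467583211035499409733395060286971089103130080881241810216222888434015355265766291,
3085855018257172587716124428782734106715921999518584663235443566608458934286824519192107721197295675,
282927010294229565948786123543665025352259431334423191102203629833545813663170707773655237747739178456942,
540702128820211256694528074464968527131055058652660039567623516780565370092983435890172861322216032,
541377499361365289019091805804519653271135499724532772765342972719472597290309587719466539412547453,
18693842457775041687994206551258423694329246859827008594116216528725228602553193075334637587114601080,
6656705670146274005147035957617544788364842670798851561233028618636193709208927063133808657388024458,
193743531602857624619657892022718251162678615661082157667326740467489664332701186462110699483933632381,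
179028979030940006080371070602131970741585060420481084869870053529112487174224536005059186394052914835618,
196040966349980146102913064144774251247812489903917440120238358733973570706459048083384737291173029757,
250563348940972831183064579342007625282385351451234088709885665030373539217469330013217591126480242220765,
244331095116276387897650180168457930508825145767552354846880619617496790526950409292453321065746935615602,
1184035244928314946700181935145447587058339233531794050520575649884789839393902069990664115,
3820438818428806725763176227608156063647536817609535658244405059096417276424269990055133096]]

noncomputable def sizes9 : List ℕ := [1, 0, 0, 0, 0, 0, 0, 0, 0, 0, 0, 0, 6, 29, 81, 167, 266, 300, 225, 98, 34, 13, 5, 2, 1, 1]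

noncomputable def rows9 : List (List ℕ) := [
[126837672318946, 5878598562, 110503002840898, 177352516073954, 19136, 49774654507106,
3299950966722287481604, 125497379129954, 243662312265105407868324, 88568445168358664744644,
213672221180226, 51022488977346, 184496281410690, 245878653997122, 5917367554, 70624993047778,
222387389574306, 125972779269538, 195542100504610, 59595319926329433, 233890586613602,
15363042107554, 65710631982018, 205210044859825907935108, 77101915460418, 415439488324401460883844,
168234656130338, 263309012999202, 28992, 226276170689986, 168234641883746, 105920, 161262514402658,
30016, 33408, 161883703464224494303780, 382135358666700242728516, 176751710957602, 245773021690050,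
177068625383458, 24087494009282676967588, 88109583057288573214308, 161911140764348799383844,
5958748706, 189362267677314, 102989364594797158850212, 114997364301864193547588,
90516797563094883204, 5936686306, 212965760603234, 11533637181090, 228540810280354, 7770332918178,
362594380544471041155108, 260522759901602, 173615580612290, 133050565817986, 145601658257122,
89326932530172444356, 131360368493186, 369939930608551028543172, 5997972770, 142254256530914,
189362267679042, 34450532667234, 56786396465186, 169706967598658, 134648292538178, 6791943,
20322067, 114167760431266, 441693026946, 381593054072166348716580, 114517663259138,
241692758496610, 144525458810690, 4865248931362, 6390374095810, 34344883036866, 52943798401762,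
365831922813887961836164, 234621646199842, 58437004766114, 125497379142882, 189368870062978,
379454258324201841110468, 161737924049922, 173397733811714, 8879548735298, 190894051078242,
58654911321154, 195759996878050, 6000122306, 109918092096581756873540, 61642195, 97608978001602,
87586518076802, 23101034026594, 131232022854052110286660, 554821647, 222387389589218,
121179468663266, 196063704169762, 88735331790530, 136596049329666, 41376, 32641548288514, 119488,
41280, 216279498124591185662020, 447176639724877413375780, 120768, 120352, 93191979820866, 41760,
48576, 453074744917603322206340, 414999861153174796457828, 431324894292907465792772,
48362333299202665662980, 90587526459386231715108, 377810655523311158113924,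
444079961017519609759332, 75251390202250502023684, 176751709364130, 133050565831618,
326061779757418955107876, 29078844160660629504964, 127925724411037367017668,
104718975148920948926276, 284674002653169908008580, 323849006217232630544164, 78627081943970,
200162721736106764545508, 1540190443, 46883322517623, 493404373171053371231489562119206,
2545430756718325697764, 361303316420453573110596, 384990571171214698019716,
137109955614559743042724, 369737315229158352593540, 358903896132172578351396, 83413810251074,
391035312580048462163428, 161737924062050, 9136536578630295972, 44420235060098, 114114881237218,
79129032653211763684, 93825782257858, 2904378317890, 134225786636866, 128402558907778,
140717656800459102920932, 229895468425121554457444, 558380311789560675140, 159268632110786,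
38451119157912401805444, 265863475372562810618756, 2904374793922, 67488894595906,
308154867226241040671076, 152587020858082, 436312508083540040823300, 82489456745794,
285050106968253071294244, 170439637565627549567140, 32331203235106, 138301599632172965837188,
92327061956642, 432252904831260049801060, 181588571617834730342820, 19591966302522725407396,
4894935910975626050089, 234377421518690, 97344814330050, 516546789, 516546787, 111745011793,
219317269607106, 103788801663362, 91493224593259, 131723487748706, 5182270009282, 251484095324258,
184370895746978, 2065944821698, 115758922473666, 53221108804642, 1549674249, 180964127645378,
217092378626466, 262745168588157235201732, 211176575340962, 249747666298466, 262094230317986,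
43304433641826, 45304830781122, 38669488995714, 454026904462077176248644, 72065644073165459865924,
222413820587042, 175807677714882, 121278584951266, 17947357703142895016403827622, 88801356719330,
204904314950082, 218261009538722, 154191368809538, 146195914650754, 57820010451783649820196,
83559103222882, 157734318336778347423076, 222262042748674, 144525476600994, 6000136578,
98209786144802, 6049011522, 155474386976714454668292, 133426978173186, 105538501799170,
171562339449570, 221364023625154, 234621646215458, 257373516732130, 378852064333298648280420,
285143155972184983700548, 102131599095842, 142399592646850, 160080798411618, 69885625982978,
69885625983010, 71489938611746, 183228699046370, 194320703951330, 171951907216930,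
25683383631716677530692, 17759727704098, 21912633748322, 134648310328482, 96268685975746,
322238543313753934036708, 411479390379961674024964, 87527134092642, 247721977102099692413860,
28098363336386, 31162590414242, 62906170640002, 246354137517698, 160305222242786,
123383746563665828076164, 177610020111266, 376572711163, 381189068423875211783780, 180858536086562,
33487975333229989030288168743526, 1549668153, 455648895351979295772260,
270941429827520166968437994169702, 5999987234, 93475701164262971948670546140774, 194690438447234,
91191527925090, 157763307054242, 133426974348482, 85255981618882, 87504021533547477502459631665510,
121681312131842, 1129718143775, 197491637539778, 56352, 133024, 97622213282210, 163051813786658,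
248347966749794, 57952, 57920, 56224, 135968, 176045305477090, 205729578857698, 138944,
238247910416772258083300, 438952228309042513471716, 6825026894088154563300,
68011838079399378905316, 333691660464662117544164, 263628862215651951451457324441798,
217626818162722196808996, 330845306301474445077156, 424465084323068933212196,
230814414765629932215108, 307433533028213069211876, 223196101200471874963812, 3194983919,
655756916880843375121784951341670, 25210535863987833122276, 181848124003525, 3194994605,
397555638606837039719588, 510037330069433714991463054750406, 427572559621963640580804,
41204354520147866995780, 90734641056439781796, 152144549756416631959012, 265863501194750306139588,
378739898083924636103108, 408230422184095619154148, 138113059020588016349028,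
329057036675749796332548, 370666526665524975933316, 6066642626, 12695711316290, 153366102093090,
45878995989359531845700, 129130225469117929499652, 152666320954530, 85160891017003212110916,
18559818304028162794340, 311924637355505651725860, 304369396665995472814564,
261464950854673442365828, 196116605155938, 278626354118772398880680887714310,
312674611424498185219044, 265593499527490, 69326593048641583517572, 320463820357458728914852,
50575239911025091656708, 339563763378512695072548, 85991398357299077951172, 174995510432034,
132221318336376090210916, 293529958755885214954820, 218254398202274, 390055385555991680364420,
65899876679388011257060, 143878480759106, 138384499827744428393124, 776390637949, 766865073083,
138900349739074, 241593774782114, 260549269362722, 45813331560322, 146011115790082,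
299850814102522101471652, 188634179091677, 241587517247142916495812, 196941904978530,
462722487009529638283872850372678, 554254874441141972177555881699622,
18113432890150943547773236486, 213125549266242025725892, 288532453991531398447940, 79459092489186,
6073077698, 145536148074545812190667260354118, 225057135192558868980740, 1111388926329246209991439,
287724627509505, 9585030931, 169865404922274, 28755156973, 296694853973311129439050402407046,
280118141151462450946340, 212563151348706, 382614824464276619426724, 301569144167302036213956,
164508539443500817588168843952230, 30792917597922, 9585041301, 2250457339829081346491980147398,
168433928833224272963780, 307960761613451079610038393486150, 220109612530050,
151683268144202354925988, 33645077640386, 205388140903790965814532,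
700351131543088789547140435876166, 468123929519406751513144239383718, 17852275545154,
261151964646508844836068, 140260128953626818819908, 91046268141314, 258443181839298,
103155120524226, 31849367352290, 398388032172624344362244, 411530569980251789335972,
195462973291362, 6661280158498, 24197126687010, 142589611296706, 58742905280708203714308,
114689399270210, 59348983525318711163492, 67944523296578, 776390507769, 127913981520322,
241402294848706, 152474927436162, 302022156100560941062340, 87546896902050, 94024023017314,
238153987408130, 94024022557666, 22117452605410, 101627728165467762858862451703398,
239045384306178, 6066645410, 201398444840898, 54825670505506, 268252933549360934163874369460230,
149741464978178, 13633390634082, 344463342881109295657572, 776390644057, 141138559023234,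
594035204045521677046695253792326, 79159629728369701316, 89230557725186, 117488748135042,
270848463834771657713956, 6068943106, 134952055774594, 74797871147874, 6150301026, 162847234732738,
151827706282786, 461092199758544948066532, 306017158235832636958004991097286,
378854613420628699342564, 137375199068642, 175807677730594, 119938296517602, 98005112332258,
154343315886114, 42360282575618, 285155515549214043748, 5998005666, 140471734875234,
247984950858882, 137777908092834, 63329444252706, 187649471861477706456036,
370003122496791463482692, 12629780637922, 291866685035613471160484, 28755181179, 35923034911906,
13725228095614479, 1903506323579704878042204087295777, 348595524797352719016228, 9547078351,
6763952420445191265862736187, 2324398428127, 262391340980738, 22817227772450, 115758922490466,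
90214695884771215503716, 21522505809356982826942913169, 305923146096854738461636,
195862622339189861487445553434982, 2835512525743645738095196403627, 222090320415010,
20962547796885, 71338156501698, 224051257921762, 20962547814259, 109651729820290, 257155576639170,
20962547789543, 187469564544746153184900, 6661216120642, 37599323440450, 193989985924034,
127016658213848816346148, 6068941026, 11104548148834, 142815551424834, 183228699138690,
229511365565506, 177273408179394, 65679942251586, 60523382615586, 176065061157730, 19152253248738,
98209786161666, 120715294600640405403991503657766, 88742136066370, 87296039794146, 230627303812866,
517909094910718002604886427522214, 147100512890146, 47213030812354, 47470569602818,
183228754986882, 223648444935330, 321036133276979829415364, 14556988926265138820989883306982,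
105447845877833410549380, 26805749504396434575551736332390, 69666373976834, 2577547622792642358788,
23661973695970, 114167832779362, 145694194779746, 121278584963330, 160305278183298, 6496146259074,
12602538690, 298221966463148795212868, 20102205578879450952222967511238, 119050286156642,
160839420721890, 173515269824098, 242934144132866, 6009042594, 135150194253954,
2905099615319943300, 66018005113226139940588646620454, 76995200814630243712804, 258276633985122,
4442832294850, 179950143236983177279748, 248334808562978, 245313586852034, 230924376995330,
23148213569367307800868, 260910489089925632798184972679371113123, 294640349423050357013732,
247086349291330, 165752311376322, 1273524144518408394085344166350959818636744,
478743168788398270827841802432678, 39818318982370, 584622511214337106836402215742278,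
87098038918914, 2329171964143, 220210542888962, 284155073258557633978292035007078, 145184,
1136052768561656629859461720419139640707592, 146400, 146624, 221826368246658, 71776, 45801665423,
45801660097, 89848362331220205680925117188486, 594528213504329960409649602019942,
275690945753089193111876, 1236646175383, 765915861447412058267281505847686,
248906263451535414090212, 570451060702314050619552704522790, 298167080549500850414948,
253219424875773845579108, 221911523511910935904324, 143998557661691602685540,
782968698276570393637016838381446, 385998944094820191912676, 51618631980100226072772,
337205498958193593820606613539142, 165956163767748893311204, 557383771623458525773422753546854,
406436748198552521071919524118982, 247615832911299355035460, 176808360642443340723439077703910,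
386146714384909624705206026616518, 129672187927687201393604, 137405071303, 137405087797,
132221318348577360966788, 128990172478370, 9302415081685594453284, 390477965424342705627620,
16475872238512113711300, 416641401070528807389526844032070, 137405087811, 106671916346922128195812,
112972786140578, 25521628071731644325668, 339645338198760544843748, 243119056161538,
434839034525042934491799645879110, 330410730600370875981124, 41204354520147949289956,
304369396665995905740164, 34023382027860950942148, 105155642772226, 75250590813657616947108,
657894191738472162023491116619590, 642821773101389743902464669973862, 378474781685696427936036,
3643770126793, 300505026776441, 252859560219080089872580, 73017224472289725,
81641176198033080112452, 305035895541337533467428, 686730341946696568887147777140966,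
300505026801983, 450459552130494528402756, 740237857596046252384553241837254,
74273393130157621726600082726374, 272109092901489538120100, 283214909062100051477956,
109697790347335751923428, 132659129426275311558724, 224889863719202, 33343706243067,
261765568235945977762756, 17290963811979, 224084338106818, 380254439286669887863076, 1696322791,
7143245918754, 171060628010690, 171199278148738, 161427682066914, 585072158581317395,
4654144900802, 24294244294128600966810285745606, 403167853197381941419434814879334,
211600001852980844911716, 116703157696258, 184343763286570451134052,
571906019696093194550713287381926, 380757835744876972738116, 2409336682562,
761054054967894342434854758052966, 594520672882945708996267607846566, 163354938826613360981060,
385519650864271327005508, 517809423824669555468581593751718, 74487585927746,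
437667674281593244922180, 203755566449282, 407817780170919988147268, 282242389557750627920260,
682744069817638096978006313290246, 76422029934018, 417777458117837497114468,
507943496377304406916063827366406, 6661280170050, 278715553564754258677892, 1973577125794,
245837670233012434254116, 219984294800770, 455371905344943439149220,
515341169257927003483110413185190, 50943460525890, 144894919848577162006852,
28847198641488101944548, 4469288724546, 84369998245225044082756, 82535889263586, 196248660813314,
60213215832802, 507943496298285300947328125249926, 507943496364268385862360991738246,
70281774093378, 378760292735144557453316, 494505933826, 5221968913250, 33389447353915,
412215354815, 171199293010690, 62966423620258, 22628386990834180031984193433645,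
167126487322919056304548, 63646371637090, 63646369645282, 63646376233570, 62207125113954,
227669471084002, 24192486451289077, 311517569482903513426020, 10540528880527370500,
71152840253162457223943409424358, 128335678904523126677544381173382, 241230690565794,
648023873896591029779755777473667490017416, 164306389310562, 227669467406818,
72349323133693961589252, 21528382860439462641927579876934, 71298509953250,
299850813884263905119300, 293690918980321391916740, 80951652684974652501668,
402508737370315068435812, 258276673979746, 525064408487047154774998203156646, 52145094467074,
212266097941954, 106453923357413551444036, 183308064955458,
753574528914858036476557809456884785646632, 55975421728642271528675310220454, 88768531211266,
378854741272329858687396, 183966315638207716232004, 313731487596407642124548,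
429914136444628301059972, 197417679411762348007304411722950, 6085501442, 312580518816555113941956,
31829579901282, 246426879516034, 301996719306521729037544391639174, 50943473702466,
594468443778364637805303075165414, 249135837250643530732612, 284774522391147022670820,
162870445717099662065284, 98606082338178, 203399131106178, 751335150541352962528558209907014,
394575954474985671844420, 62240230571010, 320749461401567233296260,
532143554263324636993737389116422, 6163334658, 111326936533118566068868,
744152301247544961182845362401766, 91314433865770211398436, 615177241204407816410486844750662,
162406622487124855354249, 18432528301815317844452453382, 24408567230530, 24408564625858,
901515080381539, 12568758835670472137088602110473759112, 180277521193058, 198414126892834,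
26905413887143485746008728504646, 323074543394, 691918179114633031701415117998598, 252890438890786,
164211998254314121375971342881926, 137216808361250, 3709938518977, 208664462292689727462308,
2704545241267735, 241541097219490, 5499274398818, 2704545241334765, 255253145212546,
2704545241268265, 2704545241335299, 371350172858602558724930899131686, 27334108703513099402532,
3709938577509, 5690729129442, 2704545241301779, 232489464925117008991972, 3709938577503,
507221686352499250708566424832198, 216207591800738, 115521245412386,
15952045450868925163800244410694, 260826717046242, 20109050906047266757919419101574,
329021672345618863325508, 336836750673731411777318856351462, 244121977071842, 14071297141154,
46784034300802, 241435369138306, 63587047782338, 292210484109148321705860, 13468331737954,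
381424323173266645374724, 66509083768476088183696282302086, 167482064479426,
383162367363226719758244233901126, 740863645340094951690672697066182, 88742115855874,
24274093217361047, 423075337406510597268676, 27227706163426, 403276141117542335660836,
33389447367925, 19813228845794, 156673964683074, 68928356263714, 17079101590332258775,
97965302230402, 318398336081503013621668, 194175667486210, 36774661925506,
486719804340543672740154149358502, 33389447398779, 98559784219426,
407859435579014975714823133106278, 17878730447810, 619862117910674525025345532369798,
825035013497041093034609760156425661596392, 732172774188956840919508429266551667673064,
100168342263785, 11467869870818, 228633415375394, 55347326184034, 101247060480482, 11362244752258,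
172213420812387211965476, 231023144404866, 462418016498190992351524, 247839674832610,
603374620782956393942077113117222, 901515080427501, 113060307033511848890052, 207591655055714,
517909319131846005300027949439014, 700598210536897987119404466075526, 162497346781570,
210404244080162, 251590020086082, 135216296086018, 706808955594211249427799357817574,
236675143143778, 39666964667378624890762671895654, 19152253260546, 62961195126338, 109605574737026,
177478155711170, 953585363451504444702126839864935151910568, 192624006468317748497802429216038,
110330010866414701491050814983362216787292248721, 216689636536130, 24340907172073523,
24340907172065017, 24340907172032023, 24340907172045335, 160120411520834, 24340907172073011,
174130747240994, 24340907172076191, 109796477199138, 54620916410498, 191353084952482,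
388376021195740196892092052316486, 6015173662178383982993, 40452331990812469955066887560454,
151936, 1394713708811, 18854429666529, 12339909216175983011, 119785342787489224593380644549638,
267196746843488298065324916875910, 219213311237941710391396, 158855601831449634807300,
4184141253099, 89226217893395177748296799, 4184141229703, 640436298563399566933833, 4184141229711,
27452150945944801, 413615119976839188365, 770558208425325071441499263400326,
91203685667727264539627267248838, 34107618684513956152804, 612008181157588266830096946316550,
1229671355370557459122120911823198395257768, 600746863685649239224506661095462,
729052575233229248319405976914950, 205715310088712997025956, 250523620986647077626372,
345395222172727645634276, 485124325651176298083, 300522041314657047504945040883174,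
717092735597896061649459971235014, 51471540362868003531780, 26473060043808129,
143147467714094687114980, 37657271499749, 90504952966914, 154350818250017083816739623301286,
492077249722487667473769467142278, 263769011996250357345064180607430, 48371470889938537354532,
727367070714267649087009630098918, 68419128699288479557049471946374, 338915443748511,
146381137352596594662948, 511685439895134380285562758541126,
96589832560429664223546069523322703242824, 190115110170114, 233269396941764576866692,
610262516027237435772897348156001974998632, 151981637842200000510276, 418581241136317504775844,
792521299014747684774855414448742, 532419252588696387974182623080646,
550448476982028674775701387804242335828040, 152098898258725351367332,
553370553718474885923514117999942, 157832829225461250282146316710,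
552533440415572435898938596693254, 254857378134592056107812, 400100094839862909772676,
37657271455447, 15320747201853412975002939, 272832046888576769282135, 17839105576418,
540405064789297743150248702207174, 740566036539359259048023909853926,
521036497796649287532095260987142, 158542586106370, 364739880026656608397931457695814,
155653945186687928358212, 214863069128268732808465096441254, 431262883496665705555844,
51390297434544510916942669951206, 253160887574143215381828, 526662435521766183022791992526662,
654103227500190639144606385717766, 324381661930111719624228, 99457864786690, 5222027754370,
544634487424799579067326947183072904506536, 128541286453634, 27445871866324175, 27452150945914297,
52006521939746, 265773354051058372587588, 247069358513526065, 247069358513570465,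
27339412470685773, 153390189720449080614212, 341620318175900634946711663154054,
129419906221408840921156, 333691660464662616519652, 158040732997218,
132481363457158852339486062375206, 252091694777890, 97932714112354, 27452150945917297,
682744260842584301734071597435718, 21496836124066, 73680123496983504841956, 30324314677634,
94446666842498, 732811861237706568566121094970246, 423594481413319227150345023609350,
27452150945905333, 792286378285505858425801811361734, 308131075604794962527771482930534,
516397880132630800393460560885446, 27452150945902333, 1016746331268261, 714281758397508577,
350648153244991566266655178274534, 91812214478658, 136959243586432717536612,
76249619868935432670212, 478243817569191656817476250004486,
596194874348133103926051607824279093511432, 201343906234756692636736576862406,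
293215595883484699824196, 39517032979458, 212288614088075161498972998750151816430120,
43441381994432645864932, 228983429136450, 509403149921015038094266520476102,
291866691505563903095588, 670910674623960601819775901779142, 263963287136013518567140,
7143246002658, 107658013605442, 293784982991983680637846094731270, 108381241885952038042500,
224242795326946, 161447489225410, 128016778435771606044696210885926,
596716648114886870992628574668230, 311546179807539990344772, 725332754712443595562560447136070,
26471716983527385, 8998008444416317603075, 89966785480712299356356, 741208075540729349,
344964302053468855380788723420678, 204031938321867824156365215161966647554339, 222856409319074,
51655985381, 1116773815683027346146911551347362048366600, 107651356370242, 101121602474466,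
229359757509826, 169020354349858, 313293075833109433069348, 1016746331297765, 65930951594466,
741208075540645929, 24736689800879381, 384691755307441999579844732190310, 282069033046572399635172,
12732329376147796464932, 131827889085698, 241990115865410, 707897805927290565549511939265350,
304986579173700887670884, 259261986011842, 283261766055961679071833392712710, 160641929216258,
136325568438114, 156445251353154, 179919653132578, 384579139752865440339524, 38161332919746,
2052486543800241555236, 1140539334755880278004843158695793715, 417777458151113556502980,
6163341282, 265205322049481560931747637975468570039080, 140768241648786237074036857519893786581096,
130931426636386, 29891149947278203861000847377222, 654262765582436873165189970283526,
470020412189961371373972488885685337801064, 608898690962522715012894690448326,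
486082365085046325980839938958470, 142587974620148433743172, 6176977986, 27452150945900765,
175248441736525541360932, 236457344534114, 343843886497436535065572, 2223624226622150647,
27452150945943993, 27452150945924809, 474051617531072576573482938063878, 6162729058,
61764866753666, 27452150945925397, 660600420236157427169524854968774,
574815516933378030970668300866886, 235067523806178, 59195441710466, 146307996630370,
158818816858434, 594050120715744399765819285319686, 299477311283547847560710954582302130614120,
27433348138168167, 210440184658780035185220, 255577660384770, 2223624226622135219,
6670872679866534365, 241494880462242, 202606848342722, 816476202715771121546028955362869811270440,
13785319637634, 247079864909837032106138079704189233787912,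
2442278209041933166431350826951472813180071718154, 158654826557186, 6694359359266, 98559860373026,
20012618039599879683, 20012618039599861067, 27325052567003257219363627671746204549574677729,
27452150945924971, 78593295398562, 256417510733158551212388, 135216296166850,
132677553020794135614274622756102, 180113562356398871371, 180113562356398878581,
180113562356398906167, 180113562356398942177, 8202676959208238137699, 28242953595005,
485775272331668099, 278048348123637449, 401487735817833661407, 20589113209460417,
20589113209425327, 20589113209443325, 20589113209395175, 18552517350622501, 15009463529699868905,
254186582794277, 233351543354626864915250386260262, 1252579473249257523778625679194888696039048,
11356175759000724479266712823361672211624, 1074123763198145943965420637987084104578632,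
48362463342845138394876026972255970804392, 1210415547547194656821985920313061757206856,
29152287393378369640316479385499829598425147246078107, 10926899758280273072669, 555906056655516799,
86788834519311350388800160919, 2735490148940540660513, 15009463529699886471, 15009463529699886921,
288231346138529316738660, 172591565088263593250692, 535950641089809377882586165312390,
135085171767299169319, 135085171767299189115, 135085171767299188221, 135085171767299138727,
34939506008514976234180971335028447336264, 135085171767299166617, 135085171767299191365,
135085171767299197225, 176943710717756639986020, 377461828917633895055236,
1231407117596474970355087244623203996476584, 401114601431863729283727899351846,
14180839798773301421439755770726, 655917010160877810310565835391494,
1362924282093978506036933315516834314438984, 683452059177992936801343016904102, 90518157736738,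
743913584755617354263532725827814, 327589097547213429487287826293094, 20589113209441773,
10940210351677118478263, 405255515301897564207, 28512199420004444834468, 405255515301897610099,
84038974473139913652644, 400077807162613749668351145669616623585416, 257868849002210,
366733003496291151597924, 743913615657578007971720683182374,
9004477784416585333210625981479446461209914272746, 102660072447234,
731994673365008101178997067916550, 207241769548386, 682616208595564487194914781813576740777960,
4951330017538, 99140950363010, 1215766545905692845117, 158509637620610, 1215766545905692857715,
20589113209408569, 175695696023498888753252, 15009463529699851195,
1273999684072657708967409997629134968288904, 313104763002724853676556230238918495734184,
135085171767299148417, 95879370278850, 135085171767299180367, 3647299637717078637813,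
26976957920354, 3138105930295, 10941898913151235869877,
2311668024895876957301615371327764821605354420740618, 10941898913151235859069,
10941898913151235872595, 133437791623795537945, 10941898913151235907223, 103234450350274,
159249045319842, 10941898913151235887899, 141006190599004095694596, 32369998711330, 63808341641538,
270315081602, 654163074541115198450648414831622, 27472087834978, 135085171767299169707,
731452349242864544127114245129458676848936, 135074878779747417747, 162675630762530,
135085171767299187743, 242127971343291545, 4765804859950316075491, 4765804859950316060985,
46966918760228568612276505, 8967702642321605, 6537455226269266835, 6537455226269264091,
128676731218658534415289, 4170071416480397743285, 3574346928411769497685, 58837097036423625123,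
58837097036423627275, 58837097036423638247, 58837097036423646095, 386030193655975603278005,
58119571462808707093, 203693540728161050305432544809007078220459179103914,
740350134566427704410692739057943241089416779077226, 3474271742903780429595587,
386030193655975603288041, 3474271742903780429577159, 3474271742903780429585005,
4765804859950316074415, 3474271742903780429589701, 386030193655975603284317,
1092937536140973663809738756560200548662888, 58837097036423645603, 31268445686134023866424673,
31268445686134023866423107, 31268445686134023866413507, 672985345474, 386030193655975603272463,
26943946001250, 2532744100576855933181411205, 320288750749575571346582992187,
1653442502431742311501, 878707136934827568654784103, 878707136934827568654781583,
878707136934827568654775261, 20412870400391872461, 133928842696971127671159,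
133928842696971127666535, 71175278091721033061037557351, 659030347598680887318521003,
659030337393801308973385643, 878707136934827568654779463, 5765197525429403677944042905863,
244926692256804731415923389333, 335976258239787011544474461, 14462676251072062585378860364050593,
14462676251072062585378860364048353, 14462676251072062585378860364050903,
36496007262801462547181039557131677321, 5562567788873870225145715524634565,
4123020165856090648291689038124970181616860175465,
3820019803187300947572762807097656047679740555897372519347415249]]

noncomputable def edges9 : List (List ℕ) := [
[692087710956650194674211553771798821891070758953305684123815021176373584254281664021,
1657720691922864613351740797566994796135780024855498607765903989606170616702031959559835510269878759906,
1681290616317900666902490565970700164282214924908749410938778187969029778454371725453617938248390790622,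
1682025210852537505517133527612001996804753883310538937718433360771207360345475556381098403579402700508,
1592656495664149897551937594842435421370714216085162113946715135062500510074555287466974462527545375229,
1716226982236273130744394641901363887769250150337628214806288228421803215618073770695916550041546513620091250301973499,
9309836411367454453485594732605344946391045889834503661242085089692021929640510373453911911099855621652184216015703933,
15538012074520386604420880975072012761174950996126854370221451997994238969611181877289588515164259221903215550820546633415908,
1537809951476063947222485886539151385866992930276625239459453146065051427884199760818266629962991751069074498841513255,
1537934372207694270852940612902562845407723125530930037600313275503164085467686733718657588266858569392254478241266271,
220516500576779297219000403469424352143833952443506432214993683195278721574811881130375609271976664496518946396428708009669,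
125454536495415031668712241754597529060149732253999029320650813068985270731115542664165457044780792766862071215484955448061,
1456359586536645460377040397842399899173062898915458848677879908975515190912680675126501429392593910490025631429562257,
127182104837355695301491917303479145910056785533988143081396181792520790409883544211703981467977358622685326245580309675980,
1456722189054204394933907529081048055167002929043999896848629481047650982611556058225350934514196374960939797119656401,
122008615439250704874002547030866150946152172148186929595933934283976710768636910727099199152242147476402211606362008361760,
47163693141392867949297433638249361106643892274887673120553427862419579199181512402725039758561660830763582698240502365712271637989,
1418881445033128170968468910215049960810168887300530028058016879676345743733338930070772243017686650555291742703910700271010366907686516,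
7227290366705550289107079003214389415229135724816312471006063218848914540165711593034626705783070179981833687765196768096263346037,
1101085849576276098389951452701350407877200934401358293160853405422077836684633153810776197200171403556975150357304141459792140812884172,
1313106568668226009169889565489799991413847781859644590342178719127546620914754591319037596449245279753792197676079425149412698239887418,
1315982697396244908494641019328107648459685876870779976187483812350073192996735275742119313369006861348496964054013323049919305271712960,
3824306334001877106038854057406056230689260029826411550892272409728962327673386724196667529861862763162086353924150502392460405722631255,
1188668885410170572058539718359819908848629367610853383621998051863326268594746469280943455476787013011442896440029426431329544823559893,
2190953984094594410538215440377010305456385349759097673930927130342418930974853255179173578877255767452933898099884016987183951809151119,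
47306404598499342218433115088378571517907754012173519538489174406835681491310932949069092850437618883977328281273598634098572443024,
7376887380215718142103317911288831564328283129807859935365817454121988315254977689605297576522708625049941853959964670947336355250,
792758148738551702543565957263797743037093292212044492326522147431855334275207748478561370966213432829371616957724399036522611511653504,
1302412895262347333335961181320703781040396947750181204487440776485663418450705065706219409008989987717618222358548743921086233019758509,
1267102470622909746433864828230093567240533072679299647405073386487345448841028848228128130608021880060827653329727081225662233159397075,
1401954824747559846444948358344346743596039443386551034512191287301307254875022715624086811968139188556853782461459657751017589168785584,
1426105979872865935774537623798738845161258766843489611047494991298870506698219707363239268845702858679763454642345511538487574609656567648060,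
1337581212304679735757658266131988686840715550204787851610380481954758200025821939981546953177043575263333193749954275778676016585606351,
2044502224098284264177820889802635688558581347202561524721140141961007217372894856299867835599079417269250732144516834347539737991892989,
1510365601943459189356826867530472212008048908842654844310971391440259992207148573632380159375081417374128453475282622163025881873755082,
6586252086199421162841366384336398099500547952584758291195437122123407904150265501032748468749572974302308703708521254017743259804349312,
5714733714328830313939488928626148341806817114981401968944173509145105716021784708953854411707615972861765165843683809883215470111183789,
46780991595165002466664879641110533389068366948044957651698756532302660939665799570648746066530790438898205352880360349179520065137,
1320173796207347421219464742682496937801814538408354025741698754989772069597114091379492919929872233855368612016880594398953332897515280,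
1228648786224259035867943155142495994989938016143581813543186144187264885874065968446499136490487593158716744744427936922807212688524569,
1295486213746443106703478292081826981162884915284258545215462924039579513462405941638617425510705553010560679821857786458313997683484482824304,
1267050709317736601337833136422412997476963834526179307057250900741098415378842972796802058342713919786166247636761661401807509500233925,
77912479248462720675475393819006398390338699373441571099404311461234908704816386478865752277551698871589648231199210759760840699649670275084770441,
1360116197944474803280661244395402560432697444639903630239628590437391663164408563943216046822138476142451220015566797306551571787607448897020,
90070024582141083998743832195225086635178376921325313729226408763314834953617779404746402655608514216126686637500769674772068062867535297342079244,
95340050479991439648016238590082879515699375820072186763293171433905537072419768389855407886422782562916528325492166326832421232096569968529106900,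
69154646163466653632103612779864765039244560204376133612881413345261762362278688372439991751404769004832711381599964971933836077813244956935463502,
60297120083326597961289073073510273013672740838109696589443291317571098128377583566159738154761541659185700062186218750618636256268331009579715698,
117111866850977658907302302325048488475790466950711042215630977429802999137728772342423624456063398005150213588050965286568782945945242950538434747,
394366470471837363287892086980278276049406622095683122428064283480113567443240187682214468597142696452436544916641435521791554621022733073248845058,
55367519609835290563191087623675473335729433927498786247004943553781891723629151369840928853545033487579847379648132612990553799336184122753551830,
65165598397019050020684107968688800933573285860729958903093845622037690453850883001521363276165326763138137637850753789373140132706112398005386135,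
65236143571029009057309433622551130028245058570003896897999715338091521272175390676551098636943121200003043729353322085514888886009818621639646896,
151817610442200896716565218406369811166505818261249754668661675198278774321668488984905673249125272231256127878446236853396270515984003175318145398,
405075001565805532156593934317164010177539666500060504539541557696407180367193851106257049911747341117459569967224235239973180882897615101705167066,
161662248241969119664760715959456205594338189208980592731536095832297359550938295753614167685762471409024072324764792124008451579332057150775193508,
375208864958758585505768246839431053716976993138444782967438225361664691731129577825429592457872677262022557377189122629977240130570155628572630477,
61314022811473109365142446990912967612601415785264983954320863151057501418303227000450239325344251132048483135819326870197084522075941442915094010,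
372406853900018248549520466231442333650497471701156303663698482604935351549942928013121954749990231418623244506885997293125489746654525361022299640,
77925489326907945516681675654772063949275452102218600037454450988117238525456968266520432548422235686345304111194904502283111727575244645565972368260851,
95012698934039119575293809212534052444529770090623983822810198434661294122025918425877580370716056409256289520070542289652255954736314776330668217457660,
30408240849120436568719285582768059066737030088331006643150396048120159198920663614321038364768496897373153707283109553004895919223993356545625219665056,
108445628244322698306414209624940937275747823754623119124551330707006051026719713886985991492837308035544502637968443508181715161920396116053,
26593287204043035180248917679083039432700687361911629275105691861227907192433875689901573778476877959328154336716375633710336758157605470307831316156461,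
16461621285816633802473395241576449175018986113885259779252336218624567605710996915633414366879658817964404960172346503298094393116724336670397258042489,
29829546586887961864986287045153013754674314170411478200929082036635596862348670960485348354402585065577385135381927807912644342868964699741747365100881,
16502624999939175991032009262411435312740141409209268060060113420760570016884684932894123848022634074145682218452590274253319167303981153068455559141981,
59645783906890215176554434036062441635071879787651395106566614540296613875768616019300039992161966635872642284950489918107769921930869283512868528,
175345500249181344989081753805288515781312626895983301720258217204712017888699653261488063803174533419249567892114210744343040009509117003686423868,
57284021807122112965062491237629314228681810849339600499354919883487066861235582546189685676980133811527775398982812125964135510532092836896896257,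
12768989589568121630993605878864730504681100493733659179252171282310717251603584972353087931965410604698447405571932203588247653204424073930114775771925,
24977434692318575259673103274453704363455754680906685045992891438426899451215077627300938293395890431087115962816471327559035067167583842418461025393175,
22975169497429474072974008615107697165988233293185652340603521822989055713888722404915651053422299531590566305436436100476730623833213752259337646793680,
78104167812793847914795258556894518699039306619492683247958111185340463238694055583825404605513832896202856462091420301997264190582267354755923059,
228836900959887682294504932571865802678395613318368738075516846703194910612234363676293812289264160345586309490195931424992430779337311074994368831,
34312254200262868778787183876430781695234763251364311269397017117162973546406476904929632787467189566702881252589100543605537733057440063815768544070707,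
63341659433707296808642862739515161222184716573103817300594339719200536811258982205569756600641196275993168438110787500649460066090211838567912069,
72428904344223360584720049392818890945611279929446141295611150429242287853550125993843552717664425666653398684952268434023357417621567886993622983,
15635174621449902371655935580118897712059246827902797472286082224321688223669585246811568230290615073922705378063107685327162101323822942064440464649750,
14089827435174812867731338800766637911892236754017033282936909453898308681373818668464376554336520528188441969953213195564253806900668316505725726846327,
15322439799002415881200728548797777043162230066237949809387387876646399525669689856683772455024114570692018766065984909546892241644645089327491108179748,
177873800143357540869586468692384148972976656476937901255827520609979752865358135913285796461620559244184357913020702298761054749902139042906899552,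
57098182283811220533726307290387750832517522869773989515896964298644595814618885221172583481522678477658657742484937634302672803026367920611672191,
1086968385329428088975992119872705682258542952044205930987507007147972477396539302897939226682564927360251226091257350197152116036210966640089594811767,
601428953492259977599058050428796316022637150790086928298292460759418465989154892139008987572307264592036222560900563858203366049918002109984049756895970,
483311740051745256326062429822672352020800227377666542555253963945571701693759869437497724158182553032068527205386078598676689194039605457383694386033174,
2999413326126872590514545966261149513371082975327143447346329356720897971550840769136135678719756136165814575067723176827909222447357636112706535861277235,
3040366440799791246156155559459223735053118776561848119272729445955578827487367440087705169628983767263474001735775360346428487894632889274636183070735163,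
420930077226453283471592326121709122793808666369333971940543480894163825121799349315792323542646613681939246236607710346670503413373695388883421200651250471366,
620790744802724403835818174427059754085554065513210223148960387763988293581054879584738538098242005290533260559612463306351537580998291966114681048913009,
2921433436162563732968542680550432511979441402300121143571130299787296341012139788038547445937090900171949442028416253606973506150441908392105820299772977,
403012196245489416467170895870633445889896239771553523370251392822672643533821530677850412887514509250991225250240779183436448560350351356106143397526801,
152620790400341396485675294815217904533436100218215335276546233443227364723136067367375761990400333173591136101075037293874525733422940730014223937702236657761,
279722493335478931622861647731510816746769193606485297947994164764128974197287878701381014257775308872507199911993359531749621438665909471170071655199331469001,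
890429404608687639087638407143261260098486161347326606421282365214930972906416819384094005813845455042342708472333943409946667497040708381796870458051129654395,
158599119086554287517167049214671183704507448554823660284035018738631575539260881789777961525853832402310733745829658473710265318558861402060730902079078188873,
1248118995985208938607398226771759807385251023535246339321817089752149694345669399716025819929097328169060436243931713523106676834189150996728820438710588,
453516149689892104382461118023769070055398425758357925015706058222313887777500635787223425944966111907251092891839425726756658323110979032791115625249504,
1850551801190840724837332116002019024689719653207031896127630905692154281222564885754988675255306519201185157449696077669450830528526712797508910025671057,
933682697926196623754242649784540206966763882826015152179179265688745296300976150544374279735373733175061421277929688142038705591111290503540428859841840816296,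
291075276282821723998481472072338255670772871653522631068489211063117779037757095549838987652295418422955431737484200125212627279319762453333120728150271301419,
122631424146143027051340538728388936381612593450721194676392182443743233717373483775088548821953842340233704444198537781212327471838690930774552437285838275422,
209044958071343095412287044448088372940650977002136223222173861727885549793842290754639833955408556801253756287206278486409889535260672799921438083474707469835,
141511019153803410887832787497113745399124688672854351935194906214517418601789898701166971820027051056815086070420853370738358168950650784873176602946744995908,
133934373459808880981546131505238779016792193714412004247897545256353682428964752995872116004354805304401296355833970741466092761669704744917111597711287197872,
160469457813441966882574973734904859977905772625240625461527785023034859047399859103855686360740137555115849133259450837749887608362073297922559897087101461218,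
270783659134249464486552251317330155321342724507270252080061019129547626518101851898236117412173288417580655914425993753274926895597695920848325067997163598585,
355609145165408689547105127680953697702443674991179413922823843198420951085044429361028912852532699968096917032566857369502052239666007956981495491589009449597,
644708441692095493101953485523305570727301886120028901115200980541178498885939966690450988123277202534356170951625720548911299603177832407877427601933360072837,
888387785344817434211944244677774107753864946394848083054290765030465308919978044519000332290825600632290353299148944629532576595473204250027704740924117698676,
188416622835596036894826597743906294886166580827329782045818990996100196812091128576724972299958772495900601922569232920218466728626541501453609099452077491512,
622257624115633845748420966510542630964195656339166852147654564888426713501191595003490078407819249335551952541397523911503280884497149552282557703165951,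
635427178691702385820586835749398143789329620967808450218751963305892228122125740078056301831998807835623031419697424075893914169621296255809431884286457802997,
1198618339791002267682662624601192715556629936716231338980167028284903433044156877852376319054816356502866555077075905796784614070024526279993574621412400,
71813086412017319673748335929845284557057450892117520000316558847814786067881252564416961387432354342776414722812056837727063457004730237094044357060238613690,
1092578142656831811079369851412004537566090294373994377985475798255811280805433308722776935764672566122263471822115615188693185340757438212615871500573324,
794125271574183974074090092490180644607716880459907248556077015341260722182877053160135781212465908445658170340188034187449251193022081858082925790277346334487,
896719546837091624309458046626769203425260315672222017348002094360930931465766544997549598333911746258644686631451280309535644642686378867501526622167367526125,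
1086437212793971303412329660255117806696726211946962204554913163502815390758757985294355674164886523019004990476399793532511646643250343000023207097898636,
535424995323168221618500685832998338735409712863673303579454102242382693480987404412642328968128916864864442709221092339238215945868066365368436716510926436929,
785442100924243333798609646298291460315444479483702282328794702288475221685844379017770997250211427288044585870749640184744596219096000785712916776712303224714,
2843366024191355825724349755541233440613616862635207665937953731441484109042541849851360524930597805275691933806428457991514620118649343140595739397299877,
2469690944597097161090600066912044214907854315916134338030731533219697024736367344220681048123388517113023830256082521730550680949240441455359603386687345,
143601720901215012577393348612788027049851853385929540944392316290744947959431891969668516619030217329637116730513087863214440230201153955381006697398022377979,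
156567617950309443667694371371752748533580509063204777317079173929703068382039541365302500324198182682494362921716844044808016377740479194451332108379885873495,
69851038201285349605361789836392582005247301339250587850213751338940662495077420888672474800914422550504190370492077847449975128193227504668905693082130,
696663632533023293679958961875249486333145784507343417960070642826914251090097801544450543456732272382185158548198880513794495713341518647548870452822453196681,
129570302358084400021559542119024660781980343241885395142319879282958990500622308817091284109793285085121304302932618147506677891055018006372625128837840757703,
124691058638755725870145552023513305772263320032476814745877041309920782575347848473458715218680566233418627940127552709191422165296957724929822823177728361882,
938187165213043809812612746299588302577843581581239627239819125574143731831749039687797504123764883450725409308937155822054303986566745037722740145462842491370,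
16101842430401637476287615625114636523651315573774381018640768984227101785987978882635949249574877982291039036055574323899707672645066319794660205128609050138,
366637722762910572605746838837041633784423935799969968641063723330272882452073545630701416093686846295218866122064595603214485956681713094257359609507624,
533689046002294796230303748106198005047616110856714311834747415218313794318190639529633316381293337673153769959857661352866397699883420526746113008987122,
2221395671456336277142099504220770809084044440177188601329784362441369550108132269928599598495350442697805553951530563588017460715819274974347576269897843,
1093093774061249154915919076150830143093601528909911790451988565356526259230059516319238667811494798085831071428498403578072086425615062924074950015792416,
135472050043975813860613024258703333818913774449163394681523557929426251875132674697658268881332387375356389663932604877585241592262667597127465399149071917477,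
47894492037801286610184325948460373486936257511576589834440827884631416749615370969925004744628455379405220238705414599164562163498972663781532685921544498503193,
223732563346776740105990247349996704619691466504310064431993495012347373193963297699860404731654198791524940083825036797794885557848568338437809906201736186,
42815559193259791415515910555326765694602120216222925036792545283337126528368298382525638923764869293916433197641206670114380738819583467493991580299061681925814,
43508198404046694255869646219940003386692034994985276240767686810478732431599041212968963766435629476686258714709916517784132714375287395610894594740895553757413,
14748752230372996646616646087161424515002253303358774332065650046893710350639632777600652617902585161958414167300991133227134777621357510400684974677526772709202,
19341651235698134739606926028178327850602485196445716863610925654609777249105466691669221361071522315371794775537712915380847022142921009370848923284554968519815,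
43987586984300456104461798442140020540890642710258415369400511418974782690450447445362247137864188952492311840665298039921887207387610141526658974178923932769137,
8537418733664334956879828783388136696416128787402791311562851681166165449444101055741084625697357787107844231310931158177529112141536354140148774043322527000534,
16104870821501740147119635038765462741432841810926055793551471723338981518101981577981165964709032461168384738849142098637971225316890545425769182285931232466190,
80982880274915790521439709621821392751561201807869116334579652743670452416781019628264148988483394340897991531817878980624303267342469657560990011462496062,
204328910838330296564117352786846255106677932932600141045354096626055560635338110516415984578662692507425582870539898169479884546459913145150180617221875179,
33762164884520133616878526392475135247603701417600977646813924624433405254631531878850504020895918174218273287661564486127613514291243642334536704089929071,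
17252745495540100697753750100607585902702526585772949506990999204490650307110216400851024723539320747013342133908055056646668205592552992719722737739127949236331,
51094803499867509523327374624389796965291723202015035054823199573997331158783194571660116417029781675312497763090525269975231675353505757755201056161910442008750,
49832811777445058732757829155978820003801831224082426650793881782083235028172632880212723392498040307387491738845626642058789051498146238686261820312925463910334,
27156969158297715430622374895244586972600310005058020618346746356739995078622468008670547306420733314428944469034456386879615538210295754153372850926039733300671,
49322960118704415194974568607064051801210431602280384489633754989325467790239334076607005517122892514719381428243326916416752078387919414328209884867550328442830,
7464105180174825169583774800330523476166520552529527217593815024516186803824757406734612781152368919230613786339454448118431056812135414218518697033685976847360,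
19106232774933187028547858439738777600325580949958196654512979933305037229075133055310320375076150846979602293767083495263465963659797438028854848975368229195972,
10543103812820031972682988868919765931656567363393945317899302148780745276779682952130591987760299018032832244394966091229948314084389261317202853005290295764536,
51693494344207614696605106218248940194029035875081169064474192060504922646267375798415502360604812739083638009848654617133442359132955012704191894095526253239596,
213809963692366609268409983574411912519504877329468716935536454056024835482024700734020508871127079758587219373977904396725089649903569020359306314287415212,
32084774703023007300947853605062025423176389213617882993503491909624533773331892637294525704775121733995309475300927514045571334446124526436928751665653872879248,
25833764299440513051813766876532084787482524277930199535515480312740549714360168980924399615544467127893695965960537728300074185115401362582975860762651842229052,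
51745501697362105817667757701296095130260371470720317561965001127609451716525853468188282841916674833610915400295629199805631960244855341709073165776735526070496,
6225181610819595794860936996255885682053997835136937874309647490761422236994103176830588932363855752313566972756229167896263954909979188566506248495234127280110,
93137583446182143339126692775795918326860946352249921155377505166113091709949182411494266364638499856729941892955737046529571761882529372067066530165714483,
17086640077213630963118489819816593582307652297139561732689471328262308943016410505754440129948298694492806163451762105402887898766439324847893115062258744747633,
14944219525090748705169612469423539102505966695545135955471358714628045241725987819215390856654636754912368623799281464831083296527796652417873943160439611047631,
49842646237095018780783870496754679263503671628236403462387439634929729009349790062597520600062431018164733193967280182314228504136882735254290299581191331958406,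
13356891018186380959009716373563402157753666018546237317000086783746279916846257112274919960675135746989326310560914991044582434362178057040980693548131934540498,
32692059660392111237831294349920939034458618719876210458654607699991051106058078078423531191383036655314068047036573195231546131198238902075909611903761179972726,
142312477212409159974170171358625401875060283327935047938983327016280903656324214453695854755696920582935311386133263943224342528768825072367458506066985528,
42356417836294470289499706038702793106884909087566749208119940117285223066081307371095366750098812560770969770662494301885215290191354858138984331697316442558435,
49177942322508947224580629915990188155204944202611872073436205432804084162993766527449196064536249912661418246439031730730518051669439441454085298793152664120669,
9834593187434864184198002541726872355231384593545157473723327999543606355202636988576857917025690953483772627074611188024587038252569511735947585823138837780125,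
10575339977451360630647198558546223901317633311637782460243243793073345328124072768955627310177963931165228696966331363784179882778046416699489975653820927835133,
165417734404884551284096688663616036776994098085986300057222892527033970678109909081016741347618197911795210380523775672677562304625495278463125717346026879,
50865799319104585235313160291629853598961506158178114734299016239264754627014273976775074547689413412703737872961706080548185004395197521938769043051104706219934,
52353147211100393220738808126943003469067397722317238493764021432377568378890266875255057314665589404717159237790707366180427658210802426604022467836730759554099,
46690642667927032798588607287989455345686527031952253746273416857856987129291075061086886984849223554361237823133883030381815208155152094029785221863136856037389,
169028806247341954633267177802067400456382104814970791473957716767396183311168087984348805761252356358625615245111363761173600314045158875770969705621176119,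
173986942445454228479341826217574881802816829800974130727392128525744863606469758910593634508073902645306975781561101092307444854832869651417204699037369659,
52672280441732526123347430974249526895001688873408951684266114249262269093917729546874188419709193077332005052522277248418713805051677485514409264490666187855981,
42717950961919647445000055805724505364080525483536482087268680777589634299511658033143432947046220494052013825694281422940069035984042112315485359262768073318147,
90977506388726699554179310561944304130337279588293712082957304883122163286903760421798372603466628862797747607573195536304733634001998951605603196782923134,
26864095523436813151457868602211856907916215746488205601397926460048278884523656814652015828695500468372635944965894896424868807425070811858510781378099586,
84085457054860053771192891901227389685088005407863268446666501124710813089928713655410893140400142992431409900336920514751918699154343814561785178923562080,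
65589028061980967715733727682150719252138823628442261795980126847112864258355985006932402294795187129827062540476708772680546868323944732900820119432459496,
40835251578011783658611007574993244625752962393646002975579774929519030674715242191019168091020930913940527271293918023410704682733486408544557574070089990,
85772998424132809844761346886923305905709118987395800710836399701615536053786536668642437683551054993802869884527020589041545471965933133517235513888250828,
819678531610277724502598406821793947635254392157638487734849033412252784156405745157757259970817486515868550155774740915658779764713614125647639912428,
6053543051670799479398675608619321479986832339535809759694955266001796480244917187029830026888944715053907446687972028346433874806193383280860988395701,
6084290179912820650347748702281736194561016031167344101650000883947390218871691707593503816997182450984635952859297917864584681023260431141349937206940,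
25936150887741657328694339762053166765293808681455655146215720513452034475985997019842706048965671739733212917752651844948624012658890345076889088318685752,
73049231330859967938711902971549969832740709703216560396166768045703427823692927878500524941398462665634101387886598421537380248416077433045653386431064125,
92590961492810923632376271834964477588195325372910595992080619403672250398009035776146761091379723869234008594624124591331814985881861477576554661508955799,
21629061287443135718956966409124443297867732751614463864994295433707906998554620161421177407224870065982143687021405444990085579679115644110750396081660169,
32385095323874998904077860207344837165105490546345562703652334805595962618226127033433874428453277378315470741218512973054447198934019341063318056619412,
27358480201490959744109431816122109934867164363308158599948340648265551328408928741233770828554117683463016577663647608723153760103433260305877570438999378,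
15034715700615998658511890290932387107963180791825249220689560951116722030078210603332293764135155373809082334851891546324571580045012756401141596384779749,
936518159201430099809342818964959620926002895790372291406409662208970084138855811135939992812419934645507381236491244922526863206344294132683410777797,
678099878042182931024459941726466276642522447280612615720219582349324790443092681913827679177040440507734359808632839760717455452953104731431382864826,
43100346692951508732393452268536537220179584910446594009892224454124244963833939510488044210136022535669156555408583406045214150822272709394824593144192493,
22164824626908068455515325003263563151597678938762818661553364609789972458980638569829780587300920638841319261173445964864930216590052221805214917337827955,
85523319600414036801320568496424994800507304589564997618475534305615012069172708190390319158981237490114914306597103025860184050005694745707923510069853118,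
86338781776126856514050778689584600157034723515508887932788962696541055472397922311021386500604586530290699383130337780782952743123268592437517392813879091,
87601800351308894370357033344262518443596039279671364056618123951039967183610849944832326364919735745600143883568293246527959486161464002466219884773983074,
26480633434996708177833429511965086355295099899176306888529682816509030028130019202788087279419808884684817142492102321725166552847152424289213652249277836,
14351917628886312480593364212059782124244084393434243574554841710196199730627959156059165336457188861492415093055550980619192045040490555291230265650733549,
336422015334343905940040749208743371478489987272393497373157309206750408118246810518796519705231390554913848622600560176516840205267877374428072645568,
30038229515345407890514833170192919713758147994984927535559853666563689455359076436222255283180948824764957606850072022597786842473218003616815178135154985,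
26481474216186749941840171059032870643172447675752514916365863720593727719499041442251900865773401476841873079924647151016035144609508101488870733842655824,
11981813787938190407598996356491638285755840080776236928676797500512468709927831210157856553211409818962036363441901614634579679686586752347545041844871943,
1545272503921872274663198832843210327262658771556221509894166630739371010102615848070306020206485820081379097122225113524308213783989956257193773468783553,
26488989857057569198835890007993834462672861001084559835625562552142129977342317659673744482056174275968121853416964631395928403462350508811603936296497483,
13136499613290640829099926014678092707047729667835465546476480639211009654136149615308035413083931904379298755794365818590416405702359318401001417,
25157834604559552311120778847280607580580117495845939131162350561102830913772921590890647716195296751763466369096587289570752283113397841291079206,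
877287852480826962044608285962913363053541815259335100326442871603796614435579527908319461384369494089371041889342332465602337030729359432645494,
26555551462244542079753277920963017389216290603825480110002640948386661599407332741003343026470206299087892558241402207630168030286998574928518711,
2821755856558271556216246487138216339316820559416479212028890959227161427570513042174891788995066000014820332235272498024884394546729561658482,
938505724693944076339078290886942299128557311150689872078642412905315521182497314933793544827531934934381574130745515580420897141558258232117,
7583228145489320794547581351038044186711908929677636973823655296081178256489183094269171445461799063074360829167426648909505170137184203852462913,
11237187362674327813333040319539665259285466902433982031867953127340364116084734273614503415949435129446893388132812762804547931846698573360049001,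
29691457549320575872826689028844359126677384764956492102894576077776865227966672034968371058204958918367608812612640184042099489451803106772815801,
25693968223023703733322950193296984304962947054104069599535099158818473722268989896691057606504956932248968065550954788861281585139934231025217002,
25859511233137245031887901223509284115659852887317248456079229636324805982042238850017696848457522658550354670069771485680666329309702133985499001,
8457862316341098424857465575727137058568276776505303180006093205223217829198967681428774960223433322371891883886739784157572832518885538752950556,
2846211071617041380738059103160055214788235919067014440175442982810939046531336503198174309555714218036849101753781478439985297678107726086599686,
37809005084197390437333361172121990891584964389002365922806789150286149743228898842250778966173239922186580370853709352187377702606520204,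
12243199932901744783043543775413238103293735929269481516484826608108729341655265257413655628437893915105852196814721678033501506525927,
11171932117593434512555781257782874844388017880192162949431217043729153776517971830011482242640025791402830916463134424874382466336807425,
5031955137598884644273573410949707705775030244263030139697328385585167158067714909212761263190540612536646537307723695499676991518927503,
78062738985759272826431977976160419766657112880178020642893649380511126816660319932432751913673442804097832799942362477935142763123132167,
286724820970570316610984018168311375976939483487396703374202600044206536060589626690865724399927095154172321264610381595568453798,
95182002024941169339823158076788872306522626493516563124002696551754255666909508264948693633403550861531890117906271219180891988,
21873807804593151034738047487656926699513770971596646895927879297095722677588453335318218291456200022635659483484697423,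
1499332630553773209346677666521133388010626741550269150211156695567316158762581281225469295188439646623489926712530585]]

/-! ### Checking the certificates -/

/-- Two consecutive layers, and the eager evaluation of functions of them. -/
structure Tower where
  below : Layer
  top : Layer
  eval : (Layer → Layer → Bool) → Bool
  eval_eq : ∀ f, eval f = f below top

/-- Adding a layer to a tower. -/
noncomputable def Tower.next (T : Tower) (n : ℕ) (sizes : List ℕ) (rows : List (List ℕ)) :
    Tower where
  below := T.top
  top := mkLayer n T.top sizes rows
  eval f := T.eval fun _ L => withLayer n L sizes rows (f L)
  eval_eq f := by rw [T.eval_eq, withLayer_eq]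

theorem Tower.valid_next {T : Tower} {n : ℕ} {sizes : List ℕ} {rows edges : List (List ℕ)}
    (hT : T.top.Valid) (hn : n = T.top.n + 1)
    (h : ∀ c < rows.length, checkPart rows edges c (T.next n sizes rows).eval = true) :
    (T.next n sizes rows).top.Valid :=
  valid_mkLayer hT hn (T.next n sizes rows).eval_eq h

noncomputable def tower2 : Tower := ⟨layer2, layer2, fun f => f layer2 layer2, fun _ => rfl⟩

noncomputable def tower3 : Tower := tower2.next 3 sizes3 rows3

noncomputable def tower4 : Tower := tower3.next 4 sizes4 rows4

noncomputable def tower5 : Tower := tower4.next 5 sizes5 rows5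

noncomputable def tower6 : Tower := tower5.next 6 sizes6 rows6

noncomputable def tower7 : Tower := tower6.next 7 sizes7 rows7

noncomputable def tower8 : Tower := tower7.next 8 sizes8 rows8

noncomputable def tower9 : Tower := tower8.next 9 sizes9 rows9

set_option maxHeartbeats 0

theorem checkPart_rows3 : checkPart rows3 edges3 0 tower3.eval = true := by
  decide +kernel

theorem checkPart_rows4 : checkPart rows4 edges4 0 tower4.eval = true := by
  decide +kernel

theorem checkPart_rows5 : checkPart rows5 edges5 0 tower5.eval = true := by
  decide +kernel

theorem checkPart_rows6 : checkPart rows6 edges6 0 tower6.eval = true := by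
  decide +kernel

theorem checkPart_rows7_first : checkPart rows7 edges7 0 tower7.eval = true := by
  decide +kernel

theorem checkPart_rows7_second : checkPart rows7 edges7 1 tower7.eval = true := by
  decide +kernel

theorem checkPart_rows7_third : checkPart rows7 edges7 2 tower7.eval = true := by
  decide +kernel

theorem checkPart_rows7_fourth : checkPart rows7 edges7 3 tower7.eval = true := by
  decide +kernel

theorem checkPart_rows8_first : checkPart rows8 edges8 0 tower8.eval = true := by
  decide +kernel

theorem checkPart_rows8_second : checkPart rows8 edges8 1 tower8.eval = true := by
  decide +kernel

theorem checkPart_rows8_third : checkPart rows8 edges8 2 tower8.eval = true := by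
  decide +kernel

theorem checkPart_rows9 : checkPart rows9 edges9 0 tower9.eval = true := by
  decide +kernel

theorem valid_tower3 : tower3.top.Valid :=
  Tower.valid_next valid_layer2 rfl fun c hc => by
    obtain rfl : c = 0 := Nat.lt_one_iff.1 hc
    exact checkPart_rows3

theorem valid_tower4 : tower4.top.Valid :=
  Tower.valid_next valid_tower3 rfl fun c hc => by
    obtain rfl : c = 0 := Nat.lt_one_iff.1 hc
    exact checkPart_rows4

theorem valid_tower5 : tower5.top.Valid :=
  Tower.valid_next valid_tower4 rfl fun c hc => by
    obtain rfl : c = 0 := Nat.lt_one_iff.1 hc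
    exact checkPart_rows5

theorem valid_tower6 : tower6.top.Valid :=
  Tower.valid_next valid_tower5 rfl fun c hc => by
    obtain rfl : c = 0 := Nat.lt_one_iff.1 hc
    exact checkPart_rows6

theorem valid_tower7 : tower7.top.Valid :=
  Tower.valid_next valid_tower6 rfl fun c hc => match c, hc with
    | 0, _ => checkPart_rows7_first
    | 1, _ => checkPart_rows7_second
    | 2, _ => checkPart_rows7_third
    | 3, _ => checkPart_rows7_fourth
    | c + 4, hc => absurd (show c + 4 < 4 from hc) (by omega)

theorem valid_tower8 : tower8.top.Valid :=
  Tower.valid_next valid_tower7 rfl fun c hc => match c, hc with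
    | 0, _ => checkPart_rows8_first
    | 1, _ => checkPart_rows8_second
    | 2, _ => checkPart_rows8_third
    | c + 3, hc => absurd (show c + 3 < 3 from hc) (by omega)

theorem valid_tower9 : tower9.top.Valid :=
  Tower.valid_next valid_tower8 rfl fun c hc => by
    obtain rfl : c = 0 := Nat.lt_one_iff.1 hc
    exact checkPart_rows9

theorem low_tower9 : tower9.top.low (tower9.top.size - 1) = 25 := by
  decide +kernel

/-- The minimal size of a sorting network on 9 channels is 25. -/
theorem sortSize_nine_eq_25 :
    (∃ C : List (Fin 9 × Fin 9), IsSortingNet C ∧ C.length = 25) ∧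
      (∀ C : List (Fin 9 × Fin 9), IsSortingNet C → 25 ≤ C.length) ∧
      sortSize 9 = 25 := by
  have lower : ∀ C : List (Fin 9 × Fin 9), IsSortingNet C → 25 ≤ C.length := fun C hC =>
    hC.le_length fun m hm => valid_tower9 (tower9.top.size - 1) m (low_tower9 ▸ hm)
  refine ⟨⟨net25, isSortingNet_net25, rfl⟩, lower,
    le_antisymm (Nat.sInf_le ⟨net25, isSortingNet_net25, rfl⟩) ?_⟩
  exact le_csInf ⟨25, net25, isSortingNet_net25, rfl⟩ fun k ⟨C, hC, hk⟩ => hk ▸ lower C hC
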